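/- Let ℓ be a prime. The only solutions in integers x ≥ 1, y to the equation (x+1)³ + (x+2)³ + ⋯ + (x+49)³ = yˡ are (x, y, ℓ) = (117575, ±282298800, 2) and (290, 1155, 3), the latter being 291³ + 292³ + ⋯ + 339³ = 1115³. -/

import Mathlib

section

open Finset

section DetBound

/-- The interpolation matrix attached to the functions `P k` and `P k * f` for `k < K`, evaluated
at `2 * K` points. -/
def interpMatrix {K : ℕ} (P : ℕ → Fin K ⊕ Fin K → ℝ) (f : Fin K ⊕ Fin K → ℝ) :
    Matrix (Fin K ⊕ Fin K) (Fin K ⊕ Fin K) ℝ :=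
  Matrix.of fun i j => Sum.elim (fun k : Fin K => P k j) (fun k : Fin K => P k j * f j) i

theorem abs_det_le_factorial_mul_prod {ι : Type*} [Fintype ι] [DecidableEq ι]
    (A : Matrix ι ι ℝ) (B : ι → ℝ) (hB : ∀ i j, |A i j| ≤ B i) :
    |A.det| ≤ (Fintype.card ι).factorial * ∏ i, B i := by
  rw [← Matrix.det_transpose, Matrix.det_apply]
  calc |∑ σ : Equiv.Perm ι, Equiv.Perm.sign σ • ∏ i, A.transpose (σ i) i|
      ≤ ∑ σ : Equiv.Perm ι, |Equiv.Perm.sign σ • ∏ i, A.transpose (σ i) i| := abs_sum_le_sum_abs _ _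
    _ ≤ ∑ _σ : Equiv.Perm ι, ∏ i, B i := by
        refine sum_le_sum fun σ _ => ?_
        have h : |Equiv.Perm.sign σ • ∏ i, A.transpose (σ i) i| = ∏ i, |A i (σ i)| := by
          rcases Int.units_eq_one_or (Equiv.Perm.sign σ) with h | h <;>
            simp [h, abs_prod, Matrix.transpose_apply]
        rw [h]
        exact prod_le_prod (fun i _ => abs_nonneg _) fun i _ => hB i _
    _ = _ := by
        rw [sum_const, card_univ, Fintype.card_perm, nsmul_eq_mul]

theorem sum_two_mul_sub_le {κ : Type*} (s : Finset κ) (e : κ → ℕ) (K : ℕ)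
    (he : Set.InjOn e s) :
    ∑ i ∈ s, (2 * (K : ℤ) - e i) ≤ K * (2 * K + 1) := by
  classical
  have h1 : ∑ i ∈ s, (2 * (K : ℤ) - e i) = ∑ n ∈ s.image e, (2 * (K : ℤ) - n) :=
    (sum_image (f := fun n : ℕ => (2 * (K : ℤ) - n)) he).symm
  have h2 : ∑ n ∈ s.image e, (2 * (K : ℤ) - n) ≤ ∑ n ∈ range (2 * K), (2 * (K : ℤ) - n) := by
    calc ∑ n ∈ s.image e, (2 * (K : ℤ) - n)
        ≤ ∑ n ∈ (s.image e).filter (· < 2 * K), (2 * (K : ℤ) - n) := by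
          rw [← sum_filter_add_sum_filter_not (s.image e) (· < 2 * K)]
          have : ∑ n ∈ (s.image e).filter (¬ · < 2 * K), (2 * (K : ℤ) - n) ≤ 0 :=
            sum_nonpos fun n hn => by
              have := (mem_filter.1 hn).2
              push Not at this
              have : (2 * K : ℤ) ≤ n := by exact_mod_cast this
              linarith
          linarith
      _ ≤ ∑ n ∈ range (2 * K), (2 * (K : ℤ) - n) := by
          refine sum_le_sum_of_subset_of_nonneg ?_ ?_
          · intro n hn
            exact mem_range.2 (mem_filter.1 hn).2
          · intro n hn _
            have : (n : ℤ) < 2 * K := by exact_mod_cast mem_range.1 hn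
            linarith
  have h3 : ∀ K : ℕ, ∑ n ∈ range (2 * K), (2 * (K : ℤ) - n) = K * (2 * K + 1) := by
    intro K
    have : ∀ M : ℕ, ∑ n ∈ range M, (2 * (M : ℤ) - 2 * n) = M * (M + 1) := by
      intro M
      induction M with
      | zero => simp
      | succ M ih =>
        rw [sum_range_succ]
        have : ∑ n ∈ range M, (2 * ((M + 1 : ℕ) : ℤ) - 2 * n)
            = ∑ n ∈ range M, (2 * (M : ℤ) - 2 * n) + 2 * M := by
          have h : ∀ n ∈ range M, (2 * ((M + 1 : ℕ) : ℤ) - 2 * n)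
            = (2 * (M : ℤ) - 2 * n) + 2 := fun n _ => by push_cast; ring
          rw [sum_congr rfl h, sum_add_distrib]; simp; ring
        rw [this, ih]; push_cast; ring
    have h := this (2 * K)
    have h' : ∑ n ∈ range (2 * K), (2 * ((2 * K : ℕ) : ℤ) - 2 * n)
        = 2 * ∑ n ∈ range (2 * K), (2 * (K : ℤ) - n) := by
      rw [mul_sum]; refine sum_congr rfl fun n _ => by push_cast; ring
    rw [h'] at h; push_cast at h; linarith
  rw [h1]; exact h2.trans (h3 K).le

variable {K M : ℕ}

/-- The weight of an atom in the expansion of a row: the degree of a Taylor term, or `2 * K` for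
the error term. -/
def atomWeight (K : ℕ) {M : ℕ} : Fin K ⊕ Fin K → Option (Fin M) → ℕ
  | Sum.inl _, _ => 0
  | Sum.inr _, none => 2 * K
  | Sum.inr _, some n => n

/-- The atoms occurring in the expansion of a row. -/
def atomRow {K M : ℕ} (t e : Fin K ⊕ Fin K → ℝ) (b : ℕ → ℝ) :
    Fin K ⊕ Fin K → Option (Fin M) → Fin K ⊕ Fin K → ℝ
  | Sum.inl k, _ => fun i => t i ^ (k : ℕ)
  | Sum.inr k, none => fun i => t i ^ (k : ℕ) * e i
  | Sum.inr k, some n => fun i => b n * t i ^ ((k : ℕ) + n)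

/-- An upper bound for the entries of an atom. -/
def atomBound {K M : ℕ} (X ε : ℝ) (b : ℕ → ℝ) : Fin K ⊕ Fin K → Option (Fin M) → ℝ
  | Sum.inl k, _ => X ^ (k : ℕ)
  | Sum.inr k, none => X ^ (k : ℕ) * ε
  | Sum.inr k, some n => X ^ (k : ℕ) * (|b n| * X ^ (n : ℕ))

/-- The atoms used in a row. -/
def atomSet {K M : ℕ} : Fin K ⊕ Fin K → Finset (Option (Fin M))
  | Sum.inl _ => {none}
  | Sum.inr _ => univ

theorem sq_le_sum_atomWeight_of_det_ne_zero (t e : Fin K ⊕ Fin K → ℝ) (b : ℕ → ℝ)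
    (a : Fin K ⊕ Fin K → Option (Fin M))
    (h : Matrix.det (fun i => atomRow t e b i (a i)) ≠ 0) :
    K ^ 2 ≤ ∑ i, atomWeight K i (a i) := by
  classical
  let base : Fin K ⊕ Fin K → ℕ := Sum.elim (fun k => (k : ℕ)) (fun k => (k : ℕ))
  let ex : Fin K ⊕ Fin K → ℕ := fun i => base i + atomWeight K i (a i)
  let mono : Fin K ⊕ Fin K → Prop := fun i => i.isLeft ∨ (a i).isSome
  have hrow : ∀ i, mono i → ∃ β : ℝ, atomRow t e b i (a i) = β • fun j => t j ^ ex i := by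
    rintro (k | k) hm
    · exact ⟨1, by funext j; simp [atomRow, ex, base, atomWeight]⟩
    · obtain ⟨n, hn⟩ : ∃ n, a (Sum.inr k) = some n := by
        rcases hm with hm | hm
        · simp at hm
        · exact Option.isSome_iff_exists.1 hm
      exact ⟨b n, by funext j; simp [atomRow, ex, base, atomWeight, hn]⟩
  have hinj : Set.InjOn ex (univ.filter mono : Finset _) := by
    intro i hi j hj hij
    by_contra hne
    apply h
    obtain ⟨β, hβ⟩ := hrow i (mem_filter.1 hi).2
    obtain ⟨γ, hγ⟩ := hrow j (mem_filter.1 hj).2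
    have hdep : ¬ LinearIndependent ℝ (fun i => atomRow t e b i (a i)) := by
      intro hli
      have h1 := linearIndependent_iff'.1 hli {i, j} (fun x => if x = i then γ else -β) (by
        rw [sum_pair hne, if_pos rfl, if_neg (Ne.symm hne), hβ, hγ, hij]; module) j (by simp)
      rw [if_neg (Ne.symm hne), neg_eq_zero] at h1
      have h0i := hli.ne_zero i
      apply h0i
      simp only [hβ, h1, zero_smul]
    by_contra hdet
    exact hdep (Matrix.linearIndependent_rows_of_det_ne_zero (A := fun i => atomRow t e b i (a i)) hdet)
  have h1 := sum_two_mul_sub_le _ ex K hinj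
  have h2 : ∑ i, (2 * (K : ℤ) - ex i) ≤ ∑ i ∈ univ.filter mono, (2 * (K : ℤ) - ex i) := by
    rw [← sum_filter_add_sum_filter_not univ mono]
    have : ∑ i ∈ univ.filter (fun i => ¬ mono i), (2 * (K : ℤ) - ex i) ≤ 0 := by
      refine sum_nonpos fun i hi => ?_
      have hi := (mem_filter.1 hi).2
      rcases i with k | k
      · simp [mono] at hi
      · have : a (Sum.inr k) = none := by simpa [mono] using hi
        simp [ex, base, atomWeight, this]
    linarith
  have h3 : ∑ i, (2 * (K : ℤ) - ex i)
      = 4 * K ^ 2 - K * (K - 1) - ((∑ i, atomWeight K i (a i) : ℕ) : ℤ) := by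
    have hb : ∑ i, (base i : ℤ) = K * (K - 1) := by
      rw [Fintype.sum_sum_type]
      simp only [base, Sum.elim_inl, Sum.elim_inr]
      have : ∑ k : Fin K, ((k : ℕ) : ℤ) = ∑ k ∈ range K, (k : ℤ) := Fin.sum_univ_eq_sum_range (fun k => (k : ℤ)) K
      rw [this]
      have h := Finset.sum_range_id_mul_two K
      have h' : (∑ k ∈ range K, (k : ℤ)) * 2 = K * (K - 1) := by
        rcases K with _ | K
        · simp
        · have := congrArg (Nat.cast : ℕ → ℤ) h
          push_cast at this
          simpa using this
      linarith
    simp only [ex, Nat.cast_add, sum_sub_distrib, sum_add_distrib, hb, sum_const, card_univ,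
      Fintype.card_sum, Fintype.card_fin, nsmul_eq_mul, Nat.cast_sum]
    ring
  have h4 : ((K ^ 2 : ℕ) : ℤ) ≤ ((∑ i, atomWeight K i (a i) : ℕ) : ℤ) := by
    rw [h3] at h2
    push_cast at *
    nlinarith
  exact_mod_cast h4

theorem abs_det_le_of_approx (t e f : Fin K ⊕ Fin K → ℝ) (b : ℕ → ℝ) (X ε ρ : ℝ)
    (hK : 0 < K) (hX : 0 ≤ X) (hρ : 1 ≤ ρ) (ht : ∀ i, |t i| ≤ X) (he : ∀ i, |e i| ≤ ε)
    (hf : ∀ i, f i = (∑ n ∈ range M, b n * t i ^ n) + e i) :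
    |(interpMatrix (fun k j => t j ^ k) f).det| * ρ ^ (K ^ 2)
      ≤ (2 * K).factorial * X ^ (K * (K - 1)) *
        ((∑ n ∈ range M, |b n| * (ρ * X) ^ n) + ε * ρ ^ (2 * K)) ^ K := by
  classical
  have hε : 0 ≤ ε := (abs_nonneg _).trans (he (Sum.inl ⟨0, hK⟩))
  have hmat : interpMatrix (fun k j => t j ^ k) f
      = fun i => ∑ a ∈ atomSet (M := M) i, atomRow t e b i a := by
    funext i
    rcases i with k | k
    · funext j; simp [interpMatrix, atomSet, atomRow]
    · funext j
      simp only [interpMatrix, Matrix.of_apply, Sum.elim_inr, atomSet, Finset.sum_apply, Fintype.sum_option, atomRow, hf,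
        Finset.sum_range]
      rw [mul_add, mul_sum, add_comm]
      congr 1
      exact sum_congr rfl fun n _ => by ring
  have hexp : Matrix.det (fun i => ∑ a ∈ atomSet (M := M) i, atomRow t e b i a)
      = ∑ a ∈ Fintype.piFinset (atomSet (M := M)),
          Matrix.det (fun i => atomRow t e b i (a i)) :=
    (Matrix.detRowAlternating (R := ℝ)).toMultilinearMap.map_sum_finset
      (fun i a => atomRow t e b i a) atomSet
  have hbd : ∀ i (a : Option (Fin M)) j, |atomRow t e b i a j| ≤ atomBound X ε b i a := by
    intro i a j
    rcases i with k | k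
    · simpa [atomRow, atomBound, abs_pow] using pow_le_pow_left₀ (abs_nonneg _) (ht j) _
    · rcases a with _ | n
      · simp only [atomRow, atomBound, abs_mul, abs_pow]
        exact mul_le_mul (pow_le_pow_left₀ (abs_nonneg _) (ht j) _) (he j) (abs_nonneg _)
          (by positivity)
      · simp only [atomRow, atomBound, abs_mul, abs_pow]
        have := pow_le_pow_left₀ (abs_nonneg _) (ht j) ((k : ℕ) + n)
        calc |b n| * |t j| ^ ((k : ℕ) + n) ≤ |b n| * X ^ ((k : ℕ) + n) := by gcongr
          _ = _ := by rw [pow_add]; ring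
  have hbd0 : ∀ i (a : Option (Fin M)), 0 ≤ atomBound X ε b i a := fun i a =>
    (abs_nonneg _).trans (hbd i a i)
  have hterm : ∀ a : Fin K ⊕ Fin K → Option (Fin M),
      |Matrix.det (fun i => atomRow t e b i (a i))| * ρ ^ (K ^ 2)
        ≤ (2 * K).factorial * ∏ i, (atomBound X ε b i (a i) * ρ ^ atomWeight K i (a i)) := by
    intro a
    by_cases h0 : Matrix.det (fun i => atomRow t e b i (a i)) = 0
    · rw [h0]; simp only [abs_zero, zero_mul]
      exact mul_nonneg (by positivity)
        (prod_nonneg fun i _ => mul_nonneg (hbd0 _ _) (by positivity))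
    · have hw := sq_le_sum_atomWeight_of_det_ne_zero t e b a h0
      have h1 := abs_det_le_factorial_mul_prod (fun i => atomRow t e b i (a i))
        (fun i => atomBound X ε b i (a i)) (fun i j => hbd i (a i) j)
      have hc : Fintype.card (Fin K ⊕ Fin K) = 2 * K := by simp; ring
      rw [hc] at h1
      rw [prod_mul_distrib, prod_pow_eq_pow_sum, ← mul_assoc]
      exact mul_le_mul h1 (pow_le_pow_right₀ hρ hw) (by positivity)
        (mul_nonneg (by positivity) (prod_nonneg fun i _ => hbd0 _ _))
  rw [hmat, hexp]
  calc |∑ a ∈ Fintype.piFinset (atomSet (M := M)),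
          Matrix.det (fun i => atomRow t e b i (a i))| * ρ ^ (K ^ 2)
      ≤ (∑ a ∈ Fintype.piFinset (atomSet (M := M)),
          |Matrix.det (fun i => atomRow t e b i (a i))|) * ρ ^ (K ^ 2) := by
        gcongr; exact abs_sum_le_sum_abs _ _
    _ ≤ ∑ a ∈ Fintype.piFinset (atomSet (M := M)),
          (2 * K).factorial * ∏ i, (atomBound X ε b i (a i) * ρ ^ atomWeight K i (a i)) := by
        rw [sum_mul]; exact sum_le_sum fun a _ => hterm a
    _ = (2 * K).factorial * ∏ i, ∑ a ∈ atomSet (M := M) i,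
          (atomBound X ε b i a * ρ ^ atomWeight K i a) := by
        rw [← mul_sum, prod_univ_sum]
    _ = _ := by
        rw [Fintype.prod_sum_type, mul_assoc]
        congr 1
        have hl : ∏ k : Fin K, ∑ a ∈ atomSet (M := M) (Sum.inl k : Fin K ⊕ Fin K),
            (atomBound X ε b (Sum.inl k) a * ρ ^ atomWeight K (Sum.inl k) a)
            = X ^ (∑ k ∈ range K, k) := by
          simp only [atomSet, sum_singleton, atomBound, atomWeight, pow_zero, mul_one]
          rw [prod_pow_eq_pow_sum, Fin.sum_univ_eq_sum_range (fun k => k)]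
        have hr : ∏ k : Fin K, ∑ a ∈ atomSet (M := M) (Sum.inr k : Fin K ⊕ Fin K),
            (atomBound X ε b (Sum.inr k) a * ρ ^ atomWeight K (Sum.inr k) a)
            = X ^ (∑ k ∈ range K, k) *
              ((∑ n ∈ range M, |b n| * (ρ * X) ^ n) + ε * ρ ^ (2 * K)) ^ K := by
          have : ∀ k : Fin K, ∑ a ∈ atomSet (M := M) (Sum.inr k : Fin K ⊕ Fin K),
            (atomBound X ε b (Sum.inr k) a * ρ ^ atomWeight K (Sum.inr k) a)
            = X ^ (k : ℕ) * ((∑ n ∈ range M, |b n| * (ρ * X) ^ n) + ε * ρ ^ (2 * K)) := by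
            intro k
            simp only [atomSet, Fintype.sum_option, atomBound, atomWeight, Finset.sum_range]
            rw [mul_add, mul_sum, add_comm]
            congr 1
            · exact sum_congr rfl fun n _ => by rw [mul_pow]; ring
            · ring
          simp only [this, prod_mul_distrib, prod_const, card_univ, Fintype.card_fin]
          rw [prod_pow_eq_pow_sum, Fin.sum_univ_eq_sum_range (fun k => k)]
        rw [hl, hr, ← mul_assoc, ← pow_add]
        congr 2
        have := Finset.sum_range_id_mul_two K
        omega

end DetBound

section Minor

theorem exists_minor_ne_zero {ι G : Type*} [Fintype ι] [DecidableEq ι] [Fintype G]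
    (v : ι → G → ℝ) (h : ∀ a : ι → ℝ, (∀ g, ∑ i, a i * v i g = 0) → a = 0) :
    ∃ s : ι → G, Function.Injective s ∧ Matrix.det (fun i j => v i (s j)) ≠ 0 := by
  classical
  let col : G → ι → ℝ := fun g i => v i g
  have hspan : Submodule.span ℝ (Set.range col) = ⊤ := by
    by_contra hne
    obtain ⟨f, hf0, hf⟩ := Submodule.exists_le_ker_of_lt_top _ (lt_top_iff_ne_top.2 hne)
    apply hf0
    have hrep : ∀ w : ι → ℝ, f w = ∑ i, f (Pi.single i 1) * w i := by
      intro w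
      conv_lhs => rw [pi_eq_sum_univ' w]
      rw [map_sum]
      refine sum_congr rfl fun i _ => ?_
      rw [map_smul, smul_eq_mul, mul_comm]
    have hz := h (fun i => f (Pi.single i 1)) (fun g => by
      have : col g ∈ LinearMap.ker f := hf (Submodule.subset_span ⟨g, rfl⟩)
      rw [LinearMap.mem_ker, hrep] at this
      exact this)
    ext i
    simpa using congrFun hz i
  obtain ⟨b, hb, hbs, hli⟩ := exists_linearIndependent ℝ (Set.range col)
  have hfin : b.Finite := (Set.finite_range col).subset hb
  have := hfin.fintype
  have hcard : Fintype.card ι = Fintype.card b := by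
    have h1 := finrank_span_set_eq_card hli
    rw [hbs, hspan, finrank_top, Module.finrank_fintype_fun_eq_card, Set.toFinset_card] at h1
    exact h1
  let φ : ι ≃ b := Fintype.equivOfCardEq hcard
  choose s hs using fun i => hb (φ i).2
  refine ⟨s, ?_, ?_⟩
  · intro i j hij
    apply φ.injective
    apply Subtype.ext
    rw [← hs i, ← hs j, hij]
  · have hli2 : LinearIndependent ℝ (fun j => col (s j)) := by
      have h1 := hli.comp φ φ.injective
      have h2 : (fun j => col (s j)) = Subtype.val ∘ φ := funext hs
      rw [h2]; exact h1
    have hu := (Matrix.isUnit_iff_isUnit_det _).1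
      ((Matrix.linearIndependent_rows_iff_isUnit (A := fun j => col (s j))).1 hli2)
    have h2 : Matrix.det (fun i j => v i (s j)) = Matrix.det (fun j => col (s j)) := by
      exact Matrix.det_transpose (fun j => col (s j))
    rw [h2]; exact hu.ne_zero

open Polynomial in
/-- A nontrivial exponential polynomial `A(x) + B(x) α ^ x` cannot vanish at many points of a
grid, even if the values `α ^ (r + s ℓ)` are replaced by `α ^ r * c ^ s`. -/
theorem eq_zero_of_vanish_on_grid (A B : ℝ[X]) (K R S ℓ : ℕ) (α c : ℝ) (hα : α ≠ 0) (hα1 : α ≠ 1)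
    (hc : c ≠ 0) (hR : R + 1 ≤ ℓ) (hRS : 2 * K ≤ R * S) (hA : A.natDegree < K)
    (hB : B.natDegree < K)
    (h : ∀ r ≤ R, ∀ s < S, A.eval ((r + s * ℓ : ℕ) : ℝ)
      + B.eval ((r + s * ℓ : ℕ) : ℝ) * (α ^ r * c ^ s) = 0) :
    A = 0 ∧ B = 0 := by
  classical
  let pts : Finset ℝ := ((range R) ×ˢ (range S)).image fun x => ((x.1 + x.2 * ℓ : ℕ) : ℝ)
  have hpts : pts.card = R * S := by
    rw [card_image_of_injOn, card_product, card_range, card_range]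
    rintro ⟨r, s⟩ h1 ⟨r', s'⟩ h2 h3
    simp only [coe_product, coe_range, Set.mem_prod, Set.mem_Iio] at h1 h2
    have h3 : r + s * ℓ = r' + s' * ℓ := by
      simp only at h3
      exact_mod_cast h3
    have hr : r = r' := by
      have := congrArg (· % ℓ) h3
      simp only [Nat.add_mul_mod_self_right] at this
      rwa [Nat.mod_eq_of_lt (by omega), Nat.mod_eq_of_lt (by omega)] at this
    subst hr
    have : s * ℓ = s' * ℓ := by omega
    have := Nat.eq_of_mul_eq_mul_right (by omega) this
    simp [this]
  have hzero : ∀ D : ℝ[X], D.natDegree < 2 * K → (∀ x ∈ pts, D.eval x = 0) → D = 0 := by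
    intro D hD hx
    exact Polynomial.eq_zero_of_natDegree_lt_card_of_eval_eq_zero' D pts hx (by omega)
  have hD : C α * A * B.comp (X + C 1) - A.comp (X + C 1) * B = 0 := by
    apply hzero
    · have e1 : (A.comp (X + C 1)).natDegree = A.natDegree := by
        rw [natDegree_comp, natDegree_X_add_C, mul_one]
      have e2 : (B.comp (X + C 1)).natDegree = B.natDegree := by
        rw [natDegree_comp, natDegree_X_add_C, mul_one]
      have := natDegree_sub_le (C α * A * B.comp (X + C 1)) (A.comp (X + C 1) * B)
      have h1 : (C α * A * B.comp (X + C 1)).natDegree ≤ A.natDegree + B.natDegree := by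
        refine natDegree_mul_le.trans ?_
        rw [e2]
        exact Nat.add_le_add_right (natDegree_C_mul_le _ _) _
      have h2 : (A.comp (X + C 1) * B).natDegree ≤ A.natDegree + B.natDegree := by
        refine natDegree_mul_le.trans ?_
        rw [e1]
      have := max_le h1 h2
      omega
    · intro x hx
      obtain ⟨⟨r, s⟩, hrs, rfl⟩ := mem_image.1 hx
      simp only [mem_product, mem_range] at hrs
      have h1 := h r hrs.1.le s hrs.2
      have h2 := h (r + 1) hrs.1 s hrs.2
      simp only [eval_sub, eval_mul, eval_C, eval_comp, eval_add, eval_X]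
      have e : (((r + 1) + s * ℓ : ℕ) : ℝ) = ((r + s * ℓ : ℕ) : ℝ) + 1 := by push_cast; ring
      rw [e] at h2
      generalize ((r + s * ℓ : ℕ) : ℝ) = x at *
      linear_combination α * eval (x + 1) B * h1 - eval x B * h2
  by_cases hB0 : B = 0
  · refine ⟨hzero A (by omega) fun x hx => ?_, hB0⟩
    obtain ⟨⟨r, s⟩, hrs, rfl⟩ := mem_image.1 hx
    simp only [mem_product, mem_range] at hrs
    have h1 := h r hrs.1.le s hrs.2
    simpa [hB0] using h1
  by_cases hA0 : A = 0
  · refine ⟨hA0, hzero B (by omega) fun x hx => ?_⟩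
    obtain ⟨⟨r, s⟩, hrs, rfl⟩ := mem_image.1 hx
    simp only [mem_product, mem_range] at hrs
    have h1 := h r hrs.1.le s hrs.2
    simpa [hA0, hα, hc] using h1
  exfalso
  have hlc := congrArg Polynomial.leadingCoeff (sub_eq_zero.1 hD)
  have e3 : ∀ F : ℝ[X], (F.comp (X + C 1)).leadingCoeff = F.leadingCoeff := by
    intro F
    rw [leadingCoeff_comp (by rw [natDegree_X_add_C]; norm_num), leadingCoeff_X_add_C]; simp
  rw [leadingCoeff_mul, leadingCoeff_mul, leadingCoeff_mul, e3, e3, leadingCoeff_C] at hlc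
  have hAB : A.leadingCoeff * B.leadingCoeff ≠ 0 :=
    mul_ne_zero (leadingCoeff_ne_zero.2 hA0) (leadingCoeff_ne_zero.2 hB0)
  apply hα1
  have : (α - 1) * (A.leadingCoeff * B.leadingCoeff) = 0 := by linear_combination hlc
  rcases mul_eq_zero.1 this with h | h
  · linarith
  · exact absurd h hAB

open Polynomial in
/-- Nonvanishing of a minor of the interpolation matrix. -/
theorem exists_grid_minor_ne_zero (K R S ℓ : ℕ) (α c : ℝ) (hα : α ≠ 0) (hα1 : α ≠ 1)
    (hc : c ≠ 0) (hR : R + 1 ≤ ℓ) (hK : 0 < K) (hRS : 2 * K ≤ R * S) :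
    ∃ g : Fin K ⊕ Fin K → Fin (R + 1) × Fin S, Function.Injective g ∧
      (interpMatrix (K := K) (fun k j => (((g j).1 + (g j).2 * ℓ : ℕ) : ℝ) ^ k)
        (fun j => α ^ ((g j).1 : ℕ) * c ^ ((g j).2 : ℕ))).det ≠ 0 := by
  classical
  refine exists_minor_ne_zero (G := Fin (R + 1) × Fin S) (fun i y =>
    Sum.elim (fun k : Fin K => ((y.1 + y.2 * ℓ : ℕ) : ℝ) ^ (k : ℕ))
          (fun k : Fin K => ((y.1 + y.2 * ℓ : ℕ) : ℝ) ^ (k : ℕ)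
            * (α ^ (y.1 : ℕ) * c ^ (y.2 : ℕ))) i) ?_
  intro a ha
  let A : ℝ[X] := ∑ k : Fin K, C (a (Sum.inl k)) * X ^ (k : ℕ)
  let B : ℝ[X] := ∑ k : Fin K, C (a (Sum.inr k)) * X ^ (k : ℕ)
  have hdeg : ∀ b : Fin K → ℝ, (∑ k : Fin K, C (b k) * X ^ (k : ℕ)).natDegree < K := by
    intro b
    refine lt_of_le_of_lt (natDegree_sum_le_of_forall_le (n := K - 1) _ _ fun k _ => ?_) (by omega)
    exact (natDegree_C_mul_X_pow_le _ _).trans (by omega)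
  have hcoeff : ∀ (b : Fin K → ℝ) (m : Fin K),
      (∑ k : Fin K, C (b k) * X ^ (k : ℕ)).coeff (m : ℕ) = b m := by
    intro b m
    simp [coeff_C_mul, coeff_X_pow, Fin.val_inj]
  have hAB := eq_zero_of_vanish_on_grid A B K R S ℓ α c hα hα1 hc hR hRS (hdeg _) (hdeg _) (by
    intro r hr s hs
    have := ha (⟨r, by omega⟩, ⟨s, hs⟩)
    rw [Fintype.sum_sum_type] at this
    simp only [Sum.elim_inl, Sum.elim_inr] at this
    simp only [A, B, eval_finsetSum, eval_mul, eval_C, eval_pow, eval_X]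
    rw [sum_mul]
    convert this using 3
    ring)
  funext i
  rcases i with k | k
  · have := hcoeff (fun k => a (Sum.inl k)) k
    rw [show (∑ k : Fin K, C (a (Sum.inl k)) * X ^ (k : ℕ)) = 0 from hAB.1] at this
    simpa using this.symm
  · have := hcoeff (fun k => a (Sum.inr k)) k
    rw [show (∑ k : Fin K, C (a (Sum.inr k)) * X ^ (k : ℕ)) = 0 from hAB.2] at this
    simpa using this.symm

end Minor

section Integrality

open Polynomial in
/-- Replacing the monomials in the interpolation matrix by monic polynomials, evaluated at shifted
points, does not change the determinant. -/
theorem det_interpMatrix_monic {K : ℕ} (Q : ℕ → ℝ[X]) (hd : ∀ k, (Q k).natDegree = k)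
    (hm : ∀ k, (Q k).Monic) (t f : Fin K ⊕ Fin K → ℝ) :
    (interpMatrix (fun k j => (Q k).eval (t j)) f).det
      = (interpMatrix (fun k j => t j ^ k) f).det := by
  classical
  let T : Matrix (Fin K) (Fin K) ℝ := Matrix.of fun k m => (Q k).coeff (m : ℕ)
  have hT : T.det = 1 := by
    rw [← Matrix.det_transpose]
    exact Matrix.det_matrixOfPolynomials (fun k : Fin K => Q k) (fun k => hd k) (fun k => hm k)
  have hev : ∀ (k : Fin K) (x : ℝ), (Q k).eval x = ∑ m : Fin K, T k m * x ^ (m : ℕ) := by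
    intro k x
    rw [eval_eq_sum_range' (n := K) (by rw [hd]; exact k.2), Finset.sum_range]
    rfl
  have hmul : interpMatrix (fun k j => (Q k).eval (t j)) f
      = Matrix.fromBlocks T 0 0 T * interpMatrix (fun k j => t j ^ k) f := by
    ext i j
    rw [Matrix.mul_apply, Fintype.sum_sum_type]
    rcases i with k | k
    · simp only [interpMatrix, Matrix.of_apply, Sum.elim_inl, Matrix.fromBlocks_apply₁₁,
        Matrix.fromBlocks_apply₁₂, Matrix.zero_apply, zero_mul, sum_const_zero, add_zero, hev]
    · simp only [interpMatrix, Matrix.of_apply, Sum.elim_inl, Sum.elim_inr,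
        Matrix.fromBlocks_apply₂₁,
        Matrix.fromBlocks_apply₂₂, Matrix.zero_apply, zero_mul, sum_const_zero, zero_add, hev,
        sum_mul, mul_assoc]
  rw [hmul, Matrix.det_mul, Matrix.det_fromBlocks_zero₂₁, hT, one_mul, one_mul]

/-- Scaling the polynomials in the interpolation matrix. -/
theorem det_interpMatrix_scale {K : ℕ} (a : ℕ → ℝ) (P : ℕ → Fin K ⊕ Fin K → ℝ)
    (f : Fin K ⊕ Fin K → ℝ) :
    (interpMatrix (fun k j => a k * P k j) f).det
      = (∏ k ∈ range K, a k) ^ 2 * (interpMatrix P f).det := by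
  have : interpMatrix (fun k j => a k * P k j) f
      = Matrix.of fun i j => Sum.elim (fun k : Fin K => a k) (fun k : Fin K => a k) i
          * interpMatrix P f i j := by
    ext i j
    rcases i with k | k <;> simp [interpMatrix, mul_assoc]
  rw [this, Matrix.det_mul_column, Fintype.prod_sum_type]
  simp only [Sum.elim_inl, Sum.elim_inr]
  rw [Finset.prod_range, sq]

open Polynomial in
theorem det_interpMatrix_choose {K : ℕ} (x : Fin K ⊕ Fin K → ℕ) (y : ℝ)
    (f : Fin K ⊕ Fin K → ℝ) :
    (interpMatrix (fun k j => ((x j : ℝ) - y) ^ k) f).det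
      = (∏ k ∈ range K, (k.factorial : ℝ)) ^ 2
        * (interpMatrix (fun k j => ((x j).choose k : ℝ)) f).det := by
  rw [← det_interpMatrix_scale]
  have h1 := det_interpMatrix_monic (fun k => (descPochhammer ℝ k).comp (X + C y))
    (fun k => by rw [natDegree_comp, natDegree_X_add_C, mul_one, descPochhammer_natDegree])
    (fun k => (monic_descPochhammer ℝ k).comp_X_add_C y) (fun j => (x j : ℝ) - y) f
  rw [← h1]
  congr 2
  funext k j
  simp only [eval_comp, eval_add, eval_X, eval_C, sub_add_cancel]
  rw [descPochhammer_eval_eq_descFactorial, Nat.descFactorial_eq_factorial_mul_choose]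
  push_cast; ring

theorem sum_fst_bounds {ι : Type*} {h S : ℕ} (g : ι → Fin (2 * h + 1) × Fin S)
    (hg : Function.Injective g) (T : Finset ι) (hT : T.card = h * S) :
    (∑ i ∈ T, ((g i).1 : ℕ) ≤ h * S * h + S * ∑ i ∈ range (h + 1), i) ∧
      (h * S * h ≤ ∑ i ∈ T, ((g i).1 : ℕ) + S * ∑ i ∈ range (h + 1), i) := by
  classical
  have key : ∀ φ : ℕ → ℕ, ∑ i ∈ T, φ (g i).1 ≤ S * ∑ r ∈ range (2 * h + 1), φ r := by
    intro φ
    calc ∑ i ∈ T, φ (g i).1 = ∑ y ∈ T.image g, φ y.1 := by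
          rw [sum_image hg.injOn]
      _ ≤ ∑ y : Fin (2 * h + 1) × Fin S, φ y.1 :=
          sum_le_sum_of_subset (subset_univ _)
      _ = S * ∑ r ∈ range (2 * h + 1), φ r := by
          rw [Fintype.sum_prod_type]
          simp only [sum_const, card_univ, Fintype.card_fin, smul_eq_mul]
          rw [← mul_sum, Fin.sum_univ_eq_sum_range]
  have e1 : ∀ h : ℕ, ∑ r ∈ range (2 * h + 1), (r - h) = ∑ i ∈ range (h + 1), i := by
    intro h
    rw [show 2 * h + 1 = h + (h + 1) by ring, sum_range_add]
    rw [sum_eq_zero fun r hr => by have := mem_range.1 hr; omega, zero_add]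
    exact sum_congr rfl fun r _ => by omega
  have e2 : ∀ h : ℕ, ∑ r ∈ range (2 * h + 1), (h - r) = ∑ i ∈ range (h + 1), i := by
    intro h
    rw [show 2 * h + 1 = (h + 1) + h by ring, sum_range_add]
    rw [sum_eq_zero (s := range h) fun r hr => by omega, add_zero,
      ← sum_range_reflect (fun i => i)]
    exact sum_congr rfl fun r _ => by omega
  have k1 := key (fun r => r - h)
  have k2 := key (fun r => h - r)
  rw [e1] at k1
  rw [e2] at k2
  have hc : ∑ _i ∈ T, h = h * S * h := by rw [sum_const, hT, smul_eq_mul]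
  constructor
  · calc ∑ i ∈ T, ((g i).1 : ℕ) ≤ ∑ i ∈ T, (h + (((g i).1 : ℕ) - h)) :=
          sum_le_sum fun i _ => by omega
      _ ≤ _ := by rw [sum_add_distrib, hc]; exact Nat.add_le_add_left k1 _
  · calc h * S * h = ∑ _i ∈ T, h := hc.symm
      _ ≤ ∑ i ∈ T, (((g i).1 : ℕ) + (h - ((g i).1 : ℕ))) := sum_le_sum fun i _ => by omega
      _ ≤ _ := by rw [sum_add_distrib]; exact Nat.add_le_add_left k2 _

/-- Arithmetic lower bound for a nonzero interpolation determinant. -/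
theorem le_abs_det_interpMatrix {h S : ℕ} (x : Fin (h * S) ⊕ Fin (h * S) → ℕ)
    (g : Fin (h * S) ⊕ Fin (h * S) → Fin (2 * h + 1) × Fin S) (hg : Function.Injective g)
    (q P c₁ c₂ a₀ a₁ : ℕ) (hq : 0 < q) (hP : 0 < P) (hc₂ : 0 < c₂)
    (ha₀ : a₀ + S * ∑ i ∈ range (h + 1), i ≤ h * S * h)
    (ha₁ : h * S * h + S * ∑ i ∈ range (h + 1), i ≤ a₁)
    (hne : (interpMatrix (fun k j => ((x j).choose k : ℝ))
      (fun j => ((q : ℝ) / P) ^ ((g j).1 : ℕ) * ((c₁ : ℝ) / c₂) ^ ((g j).2 : ℕ))).det ≠ 0) :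
    (q : ℝ) ^ a₀ ≤ |(interpMatrix (fun k j => ((x j).choose k : ℝ))
      (fun j => ((q : ℝ) / P) ^ ((g j).1 : ℕ) * ((c₁ : ℝ) / c₂) ^ ((g j).2 : ℕ))).det|
        * ((P : ℝ) ^ a₁ * (c₂ : ℝ) ^ (h * S * S)) := by
  classical
  set Δ := (interpMatrix (fun k j => ((x j).choose k : ℝ))
      (fun j => ((q : ℝ) / P) ^ ((g j).1 : ℕ) * ((c₁ : ℝ) / c₂) ^ ((g j).2 : ℕ))).det with hΔ
  have hq' : (0 : ℝ) < q := by exact_mod_cast hq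
  have hP' : (0 : ℝ) < P := by exact_mod_cast hP
  have hc' : (0 : ℝ) < c₂ := by exact_mod_cast hc₂
  have hterm : ∀ σ : Equiv.Perm (Fin (h * S) ⊕ Fin (h * S)), ∃ z : ℤ,
      (∏ j, interpMatrix (fun k j => ((x j).choose k : ℝ))
        (fun j => ((q : ℝ) / P) ^ ((g j).1 : ℕ) * ((c₁ : ℝ) / c₂) ^ ((g j).2 : ℕ)) (σ j) j)
        * ((P : ℝ) ^ a₁ * (c₂ : ℝ) ^ (h * S * S)) = (q : ℝ) ^ a₀ * z := by
    intro σ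
    let T : Finset (Fin (h * S) ⊕ Fin (h * S)) := univ.filter fun j => (σ j).isRight
    have hT : T.card = h * S := by
      have : T = (univ.filter fun i : Fin (h * S) ⊕ Fin (h * S) => i.isRight).map
          σ.symm.toEmbedding := by
        ext j
        simp [T, Finset.mem_map_equiv]
      rw [this, card_map, Finset.card_filter, Fintype.sum_sum_type]
      simp
    let n : Fin (h * S) ⊕ Fin (h * S) → ℕ := fun j =>
      Sum.elim (fun k : Fin (h * S) => (x j).choose k)
        (fun k : Fin (h * S) => (x j).choose k) (σ j)
    have hprod : ∏ j, interpMatrix (fun k j => ((x j).choose k : ℝ))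
        (fun j => ((q : ℝ) / P) ^ ((g j).1 : ℕ) * ((c₁ : ℝ) / c₂) ^ ((g j).2 : ℕ)) (σ j) j
        = (∏ j, (n j : ℝ)) * ∏ j ∈ T, (((q : ℝ) / P) ^ ((g j).1 : ℕ)
            * ((c₁ : ℝ) / c₂) ^ ((g j).2 : ℕ)) := by
      rw [prod_filter, ← prod_mul_distrib]
      refine prod_congr rfl fun j _ => ?_
      rcases hσ : σ j with k | k <;> simp [interpMatrix, n, hσ]
    have hb := sum_fst_bounds g hg T hT
    have hs : ∑ j ∈ T, ((g j).2 : ℕ) ≤ h * S * S := by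
      calc ∑ j ∈ T, ((g j).2 : ℕ) ≤ ∑ _j ∈ T, S := sum_le_sum fun j _ => (g j).2.2.le
        _ = h * S * S := by rw [sum_const, hT, smul_eq_mul]
    set a := ∑ j ∈ T, ((g j).1 : ℕ)
    set b := ∑ j ∈ T, ((g j).2 : ℕ)
    have h2 : ∏ j ∈ T, (((q : ℝ) / P) ^ ((g j).1 : ℕ) * ((c₁ : ℝ) / c₂) ^ ((g j).2 : ℕ))
        = ((q : ℝ) / P) ^ a * ((c₁ : ℝ) / c₂) ^ b := by
      rw [prod_mul_distrib, prod_pow_eq_pow_sum, prod_pow_eq_pow_sum]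
    refine ⟨(∏ j, (n j : ℤ)) * q ^ (a - a₀) * P ^ (a₁ - a) * c₁ ^ b * c₂ ^ (h * S * S - b), ?_⟩
    rw [hprod, h2]
    obtain ⟨d₀, hd₀⟩ : ∃ d, a = a₀ + d := ⟨a - a₀, by omega⟩
    obtain ⟨d₁, hd₁⟩ : ∃ d, a₁ = a + d := ⟨a₁ - a, by omega⟩
    obtain ⟨d₂, hd₂⟩ : ∃ d, h * S * S = b + d := ⟨h * S * S - b, by omega⟩
    rw [show a - a₀ = d₀ by omega, show a₁ - a = d₁ by omega, show h * S * S - b = d₂ by omega,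
      hd₁, hd₂]
    push_cast
    have e1 : ((q : ℝ) / P) ^ a * (P : ℝ) ^ (a + d₁) = (q : ℝ) ^ a₀ * q ^ d₀ * P ^ d₁ := by
      rw [div_pow, ← pow_add (q : ℝ), ← hd₀, pow_add]; field_simp
    have e2 : ((c₁ : ℝ) / c₂) ^ b * (c₂ : ℝ) ^ (b + d₂) = (c₁ : ℝ) ^ b * c₂ ^ d₂ := by
      rw [div_pow, pow_add]; field_simp
    calc (∏ j, (n j : ℝ)) * (((q : ℝ) / P) ^ a * ((c₁ : ℝ) / c₂) ^ b)
          * ((P : ℝ) ^ (a + d₁) * (c₂ : ℝ) ^ (b + d₂))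
        = (∏ j, (n j : ℝ)) * (((q : ℝ) / P) ^ a * (P : ℝ) ^ (a + d₁))
            * (((c₁ : ℝ) / c₂) ^ b * (c₂ : ℝ) ^ (b + d₂)) := by ring
      _ = _ := by rw [e1, e2]; ring
  choose z hz using hterm
  have hsum : Δ * ((P : ℝ) ^ a₁ * (c₂ : ℝ) ^ (h * S * S))
      = (q : ℝ) ^ a₀ * ((∑ σ, (Equiv.Perm.sign σ : ℤ) * z σ : ℤ) : ℝ) := by
    rw [hΔ, Matrix.det_apply', sum_mul]
    push_cast
    rw [mul_sum]
    refine sum_congr rfl fun σ _ => ?_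
    rw [mul_assoc, hz σ]; ring
  set Z : ℤ := ∑ σ, (Equiv.Perm.sign σ : ℤ) * z σ
  have hpos : (0 : ℝ) < (P : ℝ) ^ a₁ * (c₂ : ℝ) ^ (h * S * S) := by positivity
  have hZ : Z ≠ 0 := by
    intro h0
    rw [h0] at hsum
    simp only [Int.cast_zero, mul_zero] at hsum
    exact (mul_ne_zero hne hpos.ne') hsum
  have hZ1 : (1 : ℝ) ≤ |(Z : ℝ)| := by
    exact_mod_cast Int.one_le_abs hZ
  have habs := congrArg abs hsum
  rw [abs_mul, abs_of_pos hpos, abs_mul, abs_of_pos (by positivity : (0:ℝ) < (q : ℝ) ^ a₀)] at habs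
  rw [habs]
  exact le_mul_of_one_le_right (by positivity) hZ1

end Integrality

section Comparison

set_option maxHeartbeats 400000 in
theorem interpolation_inequality (h S ℓ q P c₁ c₂ a₀ a₁ : ℕ) (η ρ L : ℝ)
    (hh : 0 < h) (hS : 0 < S) (hℓ : 2 * h + 1 ≤ ℓ) (hq : 0 < q) (hP : 0 < P) (hc₁ : 0 < c₁)
    (hc₂ : 0 < c₂) (hqP : q ≠ P) (hη : 0 < η) (hρ : 1 ≤ ρ)
    (hL : Real.exp L = (q : ℝ) / P)
    (hα : ((q : ℝ) / P) ^ ℓ = (c₁ : ℝ) / c₂ * (1 + η))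
    (ha₀ : a₀ + S * ∑ i ∈ range (h + 1), i ≤ h * S * h)
    (ha₁ : h * S * h + S * ∑ i ∈ range (h + 1), i ≤ a₁) :
    (q : ℝ) ^ a₀ * (∏ k ∈ range (h * S), (k.factorial : ℝ)) ^ 2 * ρ ^ ((h * S) ^ 2)
      ≤ (P : ℝ) ^ a₁ * (c₂ : ℝ) ^ (h * S * S) * (2 * (h * S)).factorial
        * ((ℓ : ℝ) * S / 2) ^ (h * S * (h * S - 1))
        * (Real.exp (L * (h + ℓ * (S - 1) / 2)) * (Real.exp (ρ * |L| * (ℓ * S / 2))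
          + 2 * S * η * Real.exp (|L| * (ℓ * S / 2)) * ρ ^ (2 * (h * S)))) ^ (h * S) := by
  classical
  have hq' : (0 : ℝ) < q := by exact_mod_cast hq
  have hP' : (0 : ℝ) < P := by exact_mod_cast hP
  have hc₁' : (0 : ℝ) < c₁ := by exact_mod_cast hc₁
  have hc₂' : (0 : ℝ) < c₂ := by exact_mod_cast hc₂
  have hS' : (1 : ℝ) ≤ S := by exact_mod_cast hS
  have hℓh : (2 * h + 1 : ℝ) ≤ ℓ := by exact_mod_cast hℓ
  have hK : 0 < h * S := Nat.mul_pos hh hS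
  obtain ⟨g, hg, hdet⟩ := exists_grid_minor_ne_zero (h * S) (2 * h) S ℓ ((q : ℝ) / P)
    ((c₁ : ℝ) / c₂) (by positivity)
    (by rw [Ne, div_eq_one_iff_eq hP'.ne']; exact_mod_cast hqP) (by positivity) hℓ hK
    (by rw [mul_assoc])
  set x : Fin (h * S) ⊕ Fin (h * S) → ℕ := fun j => (g j).1 + (g j).2 * ℓ with hx
  set f : Fin (h * S) ⊕ Fin (h * S) → ℝ :=
    fun j => ((q : ℝ) / P) ^ ((g j).1 : ℕ) * ((c₁ : ℝ) / c₂) ^ ((g j).2 : ℕ) with hf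
  set X : ℝ := (ℓ : ℝ) * S / 2 with hX
  set y : ℝ := h + ℓ * (S - 1) / 2 with hy
  have hX0 : 0 ≤ X := by positivity
  have hd0 := det_interpMatrix_choose x 0 f
  have hd1 := det_interpMatrix_choose x y f
  simp only [sub_zero] at hd0
  have hdet' : (interpMatrix (fun k j => ((x j).choose k : ℝ)) f).det ≠ 0 := by
    intro h0
    rw [h0, mul_zero] at hd0
    exact hdet hd0
  have hlow := le_abs_det_interpMatrix x g hg q P c₁ c₂ a₀ a₁ hq hP hc₂ ha₀ ha₁ hdet'
  set t : Fin (h * S) ⊕ Fin (h * S) → ℝ := fun j => (x j : ℝ) - y with ht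
  have htX : ∀ j, |t j| ≤ X := by
    intro j
    have h1 : (((g j).1 : ℕ) : ℝ) ≤ 2 * h := by
      have : ((g j).1 : ℕ) ≤ 2 * h := by have := (g j).1.2; omega
      exact_mod_cast this
    have h2 : (((g j).2 : ℕ) : ℝ) ≤ S - 1 := by
      have : ((g j).2 : ℕ) + 1 ≤ S := (g j).2.2
      have : (((g j).2 : ℕ) : ℝ) + 1 ≤ S := by exact_mod_cast this
      linarith
    have h1' : (0 : ℝ) ≤ ((g j).1 : ℕ) := by positivity
    have h2' : (0 : ℝ) ≤ ((g j).2 : ℕ) := by positivity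
    simp only [ht, hx, hy, hX]
    push_cast
    rw [abs_le]
    constructor <;> nlinarith
  set μ := Real.exp (L * y) with hμ
  have hμ0 : 0 < μ := Real.exp_pos _
  set δ := μ * (S * η * Real.exp (|L| * X)) with hδ
  have hδ0 : 0 < δ := by positivity
  have hM : ∃ M : ℕ, ∀ j, |μ * Real.exp (L * t j)
      - ∑ n ∈ range M, μ * (L ^ n / n.factorial) * t j ^ n| ≤ δ := by
    have hev : ∀ j, ∀ᶠ M : ℕ in Filter.atTop, |μ * Real.exp (L * t j)
      - ∑ n ∈ range M, μ * (L ^ n / n.factorial) * t j ^ n| ≤ δ := by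
      intro j
      have hs : HasSum (fun n : ℕ => μ * (L ^ n / n.factorial) * t j ^ n)
          (μ * Real.exp (L * t j)) := by
        have h1 := (NormedSpace.expSeries_div_hasSum_exp (𝔸 := ℝ) (L * t j)).mul_left μ
        rw [← Real.exp_eq_exp_ℝ] at h1
        refine h1.congr_fun ?_ |> fun h => h
        intro n
        rw [mul_pow]; ring
      have h2 := (Metric.tendsto_atTop.1 hs.tendsto_sum_nat) δ hδ0
      obtain ⟨N, hN⟩ := h2
      refine Filter.eventually_atTop.2 ⟨N, fun n hn => ?_⟩
      have := (hN n hn).le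
      rw [Real.dist_eq, abs_sub_comm] at this
      exact this
    exact (Filter.eventually_all.2 hev).exists
  obtain ⟨M, hM⟩ := hM
  have hfj : ∀ j, f j = μ * Real.exp (L * t j) * ((1 + η) ^ ((g j).2 : ℕ))⁻¹ := by
    intro j
    have hc : (c₁ : ℝ) / c₂ = ((q : ℝ) / P) ^ ℓ * (1 + η)⁻¹ := by
      rw [hα]; field_simp
    have hexp : μ * Real.exp (L * t j) = ((q : ℝ) / P) ^ (x j) := by
      rw [hμ, ← Real.exp_add, ← hL, ← Real.exp_nat_mul]
      congr 1
      simp only [ht]; ring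
    rw [hexp]
    simp only [hf, hc, hx]
    rw [mul_pow, ← pow_mul, pow_add, inv_pow, mul_comm ℓ]
    ring
  have hpert : ∀ j, |f j - μ * Real.exp (L * t j)| ≤ δ := by
    intro j
    have h1 : (1 : ℝ) ≤ (1 + η) ^ ((g j).2 : ℕ) := one_le_pow₀ (by linarith)
    have h2 : 1 - S * η ≤ ((1 + η) ^ ((g j).2 : ℕ))⁻¹ := by
      have hb := one_add_mul_le_pow (a := -(η / (1 + η))) (by
        have : η / (1 + η) ≤ 1 := by rw [div_le_one (by linarith)]; linarith
        linarith) ((g j).2 : ℕ)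
      have e : (1 + -(η / (1 + η))) = (1 + η)⁻¹ := by field_simp; ring
      rw [e, inv_pow] at hb
      refine le_trans ?_ hb
      have h3 : η / (1 + η) ≤ η := div_le_self hη.le (by linarith)
      have h4 : (((g j).2 : ℕ) : ℝ) ≤ S := by exact_mod_cast (g j).2.2.le
      have h5 : (((g j).2 : ℕ) : ℝ) * (η / (1 + η)) ≤ S * η := by
        apply mul_le_mul h4 h3 (by positivity) (by positivity)
      linarith
    have h3 : ((1 + η) ^ ((g j).2 : ℕ))⁻¹ ≤ 1 := inv_le_one_of_one_le₀ h1
    have h4 : Real.exp (L * t j) ≤ Real.exp (|L| * X) := by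
      apply Real.exp_le_exp.2
      calc L * t j ≤ |L * t j| := le_abs_self _
        _ = |L| * |t j| := abs_mul _ _
        _ ≤ |L| * X := by gcongr; exact htX j
    rw [hfj j]
    have h5 : μ * Real.exp (L * t j) * ((1 + η) ^ ((g j).2 : ℕ))⁻¹ - μ * Real.exp (L * t j)
        = -(μ * Real.exp (L * t j) * (1 - ((1 + η) ^ ((g j).2 : ℕ))⁻¹)) := by ring
    rw [h5, abs_neg, abs_of_nonneg (mul_nonneg (by positivity) (by linarith))]
    rw [hδ, mul_assoc]
    apply mul_le_mul_of_nonneg_left _ hμ0.le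
    rw [mul_comm]
    exact mul_le_mul (by linarith) h4 (by positivity) (by positivity)
  have hup := abs_det_le_of_approx (K := h * S) (M := M) t
    (fun j => f j - ∑ n ∈ range M, μ * (L ^ n / n.factorial) * t j ^ n) f
    (fun n => μ * (L ^ n / n.factorial)) X (2 * δ) ρ hK hX0 hρ htX (by
      intro j
      have := abs_add_le (f j - μ * Real.exp (L * t j)) (μ * Real.exp (L * t j)
        - ∑ n ∈ range M, μ * (L ^ n / n.factorial) * t j ^ n)
      rw [sub_add_sub_cancel] at this
      linarith [hpert j, hM j]) (by intro j; ring)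
  have hsum : ∑ n ∈ range M, |μ * (L ^ n / n.factorial)| * (ρ * X) ^ n
      ≤ μ * Real.exp (ρ * |L| * X) := by
    have := Real.sum_le_exp_of_nonneg (x := ρ * |L| * X) (by positivity) M
    calc ∑ n ∈ range M, |μ * (L ^ n / n.factorial)| * (ρ * X) ^ n
        = μ * ∑ n ∈ range M, (ρ * |L| * X) ^ n / n.factorial := by
          rw [mul_sum]
          refine sum_congr rfl fun n _ => ?_
          rw [abs_mul, abs_of_pos hμ0, abs_div, abs_pow, Nat.abs_cast]
          rw [mul_pow, mul_pow, mul_pow]; ring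
      _ ≤ _ := by gcongr
  rw [hd1] at hup
  set D := |(interpMatrix (fun k j => ((x j).choose k : ℝ)) f).det|
  set F := ∏ k ∈ range (h * S), (k.factorial : ℝ)
  rw [abs_mul, abs_of_nonneg (by positivity : 0 ≤ F ^ 2)] at hup
  have hW : (∑ n ∈ range M, |μ * (L ^ n / n.factorial)| * (ρ * X) ^ n) + 2 * δ * ρ ^ (2 * (h * S))
      ≤ μ * (Real.exp (ρ * |L| * X) + 2 * S * η * Real.exp (|L| * X) * ρ ^ (2 * (h * S))) := by
    rw [hδ]
    nlinarith [hsum]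
  have hF : 0 ≤ F := by positivity
  have hWs : 0 ≤ (∑ n ∈ range M, |μ * (L ^ n / n.factorial)| * (ρ * X) ^ n)
      + 2 * δ * ρ ^ (2 * (h * S)) := by positivity
  have hup' := hup.trans (mul_le_mul_of_nonneg_left (pow_le_pow_left₀ hWs hW (h * S))
    (by positivity))
  clear hup hW hWs hsum hM hpert hfj hd0 hd1
  have hρ0 : 0 ≤ ρ ^ ((h * S) ^ 2) := by positivity
  have h1 := mul_le_mul_of_nonneg_right (mul_le_mul_of_nonneg_right hlow (sq_nonneg F)) hρ0
  have h2 := mul_le_mul_of_nonneg_left hup'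
    (by positivity : 0 ≤ (P : ℝ) ^ a₁ * (c₂ : ℝ) ^ (h * S * S))
  refine h1.trans (le_trans (le_of_eq ?_) (h2.trans (le_of_eq ?_)))
  · ring
  · simp only [mul_assoc]

end Comparison

section LargeExponent

theorem two_mul_log_prod_factorial_ge (K : ℕ) (hK : 1 ≤ K) :
    (K : ℝ) ^ 2 * Real.log K - 3 / 2 * (K : ℝ) ^ 2 - 2 * K * Real.log K
      ≤ 2 * Real.log (∏ k ∈ range K, (k.factorial : ℝ)) := by
  induction K, hK using Nat.le_induction with
  | base => simp; norm_num
  | succ K hK ih =>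
    have hK' : (1 : ℝ) ≤ K := by exact_mod_cast hK
    have hfac : (K : ℝ) * Real.log K - K ≤ Real.log (K.factorial : ℝ) := by
      have h1 := Real.pow_div_factorial_le_exp (K : ℝ) (by positivity) K
      have h2 := Real.log_le_log (by positivity) h1
      rw [Real.log_exp, Real.log_div (by positivity) (by positivity), Real.log_pow] at h2
      linarith
    rw [prod_range_succ, Real.log_mul (by positivity) (by positivity), mul_add]
    have hstep : Real.log ((K : ℝ) + 1) ≤ Real.log K + 1 / K := by
      have h1 : Real.log (((K : ℝ) + 1) / K) ≤ ((K : ℝ) + 1) / K - 1 :=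
        Real.log_le_sub_one_of_pos (by positivity)
      rw [Real.log_div (by positivity) (by positivity)] at h1
      have h2 : ((K : ℝ) + 1) / K - 1 = 1 / K := by field_simp; ring
      linarith
    have hlog : 0 ≤ Real.log K := Real.log_nonneg hK'
    push_cast
    have h3 : ((K : ℝ) ^ 2 - 1) * Real.log ((K : ℝ) + 1)
        ≤ ((K : ℝ) ^ 2 - 1) * (Real.log K + 1 / K) :=
      mul_le_mul_of_nonneg_left hstep (by nlinarith)
    have h4 : ((K : ℝ) ^ 2 - 1) * (1 / K) ≤ K := by
      rw [mul_one_div, div_le_iff₀ (by positivity)]; nlinarith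
    nlinarith

theorem log_three_gt : (1.09 : ℝ) < Real.log 3 := by
  rw [Real.lt_log_iff_exp_lt (by norm_num)]
  have h := Real.exp_one_lt_d9
  have h2 : Real.exp (1.09 : ℝ) = Real.exp 1 * Real.exp 0.09 := by
    rw [← Real.exp_add]; norm_num
  have h3 : Real.exp (0.09 : ℝ) ≤ 1 / (1 - 0.09) := by
    have := Real.one_sub_le_exp_neg (0.09 : ℝ)
    rw [Real.exp_neg] at this
    rw [le_div_iff₀ (by norm_num)]
    have hp := Real.exp_pos (0.09 : ℝ)
    calc Real.exp 0.09 * (1 - 0.09) ≤ Real.exp 0.09 * (Real.exp 0.09)⁻¹ := by gcongr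
      _ = 1 := by field_simp
  rw [h2]
  calc Real.exp 1 * Real.exp 0.09 ≤ 2.7182818286 * (1 / (1 - 0.09)) := by gcongr
    _ < 3 := by norm_num

theorem log_le_div_add (a z : ℝ) (ha : 0 < a) (hz : 0 < z) :
    Real.log z ≤ z / a - 1 + Real.log a := by
  have h := Real.log_le_sub_one_of_pos (div_pos hz ha)
  rw [Real.log_div hz.ne' ha.ne'] at h
  linarith

end LargeExponent

theorem log_interpolation_inequality (h S ℓ q P c₁ c₂ : ℕ) (η : ℝ)
    (hh : 12 ≤ h) (hS : 0 < S) (hℓ : 2 * h + 1 ≤ ℓ) (hq : 0 < q) (hP : 0 < P) (hc₁ : 0 < c₁)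
    (hc₂ : 0 < c₂) (hqP : q ≠ P) (hη : 0 < η)
    (hα : ((q : ℝ) / P) ^ ℓ = (c₁ : ℝ) / c₂ * (1 + η))
    (hL : |Real.log ((q : ℝ) / P)| * ℓ ≤ 24) (hlc : Real.log c₂ ≤ 28)
    (herr : 2 * S * η * Real.exp (12 * S) * ((h : ℝ) / 12) ^ (2 * (h * S))
      ≤ Real.exp (h * S)) :
    ((h : ℝ) * S) * (Real.log ((h : ℝ) ^ 2 / (6 * ℓ)) - 5 / 2)
      ≤ (h + 1) * Real.log P + 6 + 40 * S + 4 * Real.log (h * S) + 3 * Real.log 2 := by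
  have hq' : (0 : ℝ) < q := by exact_mod_cast hq
  have hP' : (1 : ℝ) ≤ P := by exact_mod_cast hP
  have hc₂' : (1 : ℝ) ≤ c₂ := by exact_mod_cast hc₂
  have hS' : (1 : ℝ) ≤ S := by exact_mod_cast hS
  have hh' : (12 : ℝ) ≤ h := by exact_mod_cast hh
  have hℓh : (2 * h + 1 : ℝ) ≤ ℓ := by exact_mod_cast hℓ
  have hℓ0 : (0 : ℝ) < ℓ := by linarith
  have hsum : 2 * ∑ i ∈ range (h + 1), i = h * (h + 1) := by
    have := Finset.sum_range_id_mul_two (h + 1)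
    simp only [Nat.add_sub_cancel] at this
    linarith
  set T : ℕ := ∑ i ∈ range (h + 1), i with hT
  have hTle : S * T ≤ h * S * h := by
    have : 2 * (S * T) ≤ 2 * (h * S * h) := by
      calc 2 * (S * T) = S * (2 * T) := by ring
        _ = S * (h * (h + 1)) := by rw [hsum]
        _ ≤ S * (h * (h + h)) := by gcongr; omega
        _ = 2 * (h * S * h) := by ring
    omega
  set L := Real.log ((q : ℝ) / P) with hLdef
  obtain ⟨a₀, ha₀⟩ : ∃ a₀, a₀ + S * T = h * S * h := ⟨h * S * h - S * T, by omega⟩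
  have key := interpolation_inequality h S ℓ q P c₁ c₂ a₀ (h * S * h + S * T) η ((h : ℝ) / 12) L
    (by omega) hS hℓ hq hP hc₁ hc₂ hqP hη (by linarith)
    (Real.exp_log (by positivity)) hα ha₀.le le_rfl
  have hKnat : 1 ≤ h * S := Nat.mul_pos (by omega) hS
  have hK : (1 : ℝ) ≤ (h : ℝ) * S := by exact_mod_cast hKnat
  have hLS : |L| * (ℓ * S / 2) ≤ 12 * S := by nlinarith
  have hE : Real.exp ((h : ℝ) / 12 * |L| * (ℓ * S / 2))
      + 2 * S * η * Real.exp (|L| * (ℓ * S / 2)) * ((h : ℝ) / 12) ^ (2 * (h * S))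
      ≤ 2 * Real.exp (h * S) := by
    have e1 : Real.exp ((h : ℝ) / 12 * |L| * (ℓ * S / 2)) ≤ Real.exp (h * S) := by
      apply Real.exp_le_exp.2
      calc (h : ℝ) / 12 * |L| * (ℓ * S / 2) = (h : ℝ) / 12 * (|L| * (ℓ * S / 2)) := by ring
        _ ≤ (h : ℝ) / 12 * (12 * S) := by gcongr
        _ = h * S := by ring
    have e2 : 2 * S * η * Real.exp (|L| * (ℓ * S / 2)) * ((h : ℝ) / 12) ^ (2 * (h * S))
        ≤ 2 * S * η * Real.exp (12 * S) * ((h : ℝ) / 12) ^ (2 * (h * S)) := by gcongr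
    linarith
  have hLy : L * (h + ℓ * (S - 1) / 2) ≤ 12 * S := by
    have hy : 0 ≤ (h + ℓ * (S - 1) / 2 : ℝ) := by
      have : (0 : ℝ) ≤ S - 1 := by linarith
      positivity
    calc L * (h + ℓ * (S - 1) / 2) ≤ |L| * (h + ℓ * (S - 1) / 2) := by
          gcongr; exact le_abs_self L
      _ ≤ |L| * (ℓ * S / 2) := by gcongr; linarith
      _ ≤ 12 * S := hLS
  have hfac : ((2 * (h * S)).factorial : ℝ) ≤ (2 * ((h : ℝ) * S)) ^ (2 * (h * S)) := by
    have := Nat.factorial_le_pow (2 * (h * S))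
    exact_mod_cast this
  have hX : (1 : ℝ) ≤ (ℓ : ℝ) * S / 2 := by nlinarith
  have key2 : (q : ℝ) ^ a₀ * (∏ k ∈ range (h * S), (k.factorial : ℝ)) ^ 2
      * ((h : ℝ) / 12) ^ ((h * S) ^ 2)
      ≤ (P : ℝ) ^ (h * S * h + S * T) * (c₂ : ℝ) ^ (h * S * S)
        * (2 * ((h : ℝ) * S)) ^ (2 * (h * S))
        * ((ℓ : ℝ) * S / 2) ^ (h * S * (h * S))
        * (Real.exp (12 * S) * (2 * Real.exp (h * S))) ^ (h * S) := by
    refine key.trans ?_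
    gcongr
    omega
  have hprodpos : (0 : ℝ) < ∏ k ∈ range (h * S), (k.factorial : ℝ) :=
    Finset.prod_pos fun k _ => by positivity
  have key3 := Real.log_le_log (by positivity) key2
  have hLq : Real.log q = L + Real.log P := by
    rw [hLdef, Real.log_div (by positivity) (by positivity)]; ring
  have hlog2K : Real.log (2 * ((h : ℝ) * S)) = Real.log 2 + Real.log (h * S) :=
    Real.log_mul (by positivity) (by positivity)
  have hlogE : Real.log (Real.exp (12 * S) * (2 * Real.exp (h * S)))
      = 12 * S + (Real.log 2 + h * S) := by
    rw [Real.log_mul (by positivity) (by positivity), Real.log_mul (by positivity) (by positivity),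
      Real.log_exp, Real.log_exp]
  rw [Real.log_mul (by positivity) (by positivity), Real.log_mul (by positivity) (by positivity),
    Real.log_mul (by positivity) (by positivity), Real.log_mul (by positivity) (by positivity),
    Real.log_mul (by positivity) (by positivity), Real.log_mul (by positivity) (by positivity),
    Real.log_pow, Real.log_pow, Real.log_pow, Real.log_pow, Real.log_pow, Real.log_pow,
    Real.log_pow, Real.log_pow, hlog2K, hlogE, hLq] at key3
  have hpf := two_mul_log_prod_factorial_ge (h * S) hKnat
  have hlogeq : Real.log ((h : ℝ) ^ 2 / (6 * ℓ))
      = Real.log (h * S) + Real.log ((h : ℝ) / 12) - Real.log ((ℓ : ℝ) * S / 2) := by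
    rw [← Real.log_mul (by positivity) (by positivity), ← Real.log_div (by positivity)
      (by positivity)]
    congr 1
    field_simp
    ring
  rw [hlogeq]
  push_cast at key3 hpf
  have hTr : 2 * (T : ℝ) = h * (h + 1) := by exact_mod_cast hsum
  have ha₀r : (a₀ : ℝ) = h * S * h - S * T := by
    have : (a₀ : ℝ) + S * T = h * S * h := by exact_mod_cast ha₀
    linarith
  set K : ℝ := (h : ℝ) * S with hKdef
  have ha₀K : (a₀ : ℝ) = K * (h - 1) / 2 := by
    rw [ha₀r, hKdef]
    linear_combination (-(S : ℝ) / 2) * hTr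
  have haL : -(6 * K) ≤ (a₀ : ℝ) * L := by
    have h1 : (a₀ : ℝ) * |L| ≤ 6 * K := by
      rw [ha₀K]
      have : (h - 1 : ℝ) * |L| ≤ 12 := by
        have h3 : (h - 1 : ℝ) * |L| ≤ ℓ / 2 * |L| :=
          mul_le_mul_of_nonneg_right (by linarith) (abs_nonneg L)
        linarith
      have h4 := mul_le_mul_of_nonneg_left this (by linarith : 0 ≤ K / 2)
      linarith
    have h2 : -((a₀ : ℝ) * |L|) ≤ a₀ * L := by
      have h3 := mul_le_mul_of_nonneg_left (neg_abs_le L) (Nat.cast_nonneg (α := ℝ) a₀)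
      linarith
    linarith
  have hST : K * h + S * T = a₀ + K * (h + 1) := by
    rw [ha₀r, hKdef]; linear_combination (S : ℝ) * hTr
  have hcc : K * S * Real.log c₂ ≤ K * S * 28 := by gcongr
  rw [hST] at key3
  have hfin : K * (K * (Real.log K + Real.log ((h : ℝ) / 12) - Real.log ((ℓ : ℝ) * S / 2) - 5 / 2))
      ≤ K * ((h + 1) * Real.log P + 6 + 40 * S + 4 * Real.log K + 3 * Real.log 2) := by
    linarith
  exact le_of_mul_le_mul_left hfin (by linarith)

/-- The numerical inequality that contradicts `log_interpolation_inequality`. -/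
theorem rate_gt {w κ : ℝ} (hw : 1296 ≤ w) (hκ : 1 / 4 ≤ κ) (hκ' : κ ≤ 1 / 3) :
    (0.07 : ℝ) ≤ 2 * Real.log κ + (1 - κ) * Real.log w - 5 / 2 := by
  have hl2 := Real.log_two_gt_d9
  have hl2' := Real.log_two_lt_d9
  have hl3 := log_three_gt
  have hlw : 4 * Real.log 2 + 4 * Real.log 3 ≤ Real.log w := by
    have h1 : Real.log 1296 = 4 * Real.log 2 + 4 * Real.log 3 := by
      rw [show (1296 : ℝ) = 2 ^ 4 * 3 ^ 4 by norm_num, Real.log_mul (by norm_num) (by norm_num),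
        Real.log_pow, Real.log_pow]
      norm_num
    rw [← h1]
    exact Real.log_le_log (by norm_num) hw
  have hcon := strictConcaveOn_log_Ioi.concaveOn.2 (show (1 / 4 : ℝ) ∈ Set.Ioi 0 by norm_num)
    (show (1 / 3 : ℝ) ∈ Set.Ioi 0 by norm_num) (show 0 ≤ 4 - 12 * κ by linarith)
    (show 0 ≤ 12 * κ - 3 by linarith) (by ring)
  simp only [smul_eq_mul] at hcon
  rw [show (4 - 12 * κ) * (1 / 4) + (12 * κ - 3) * (1 / 3) = κ by ring, one_div, one_div,
    Real.log_inv, Real.log_inv, show (4 : ℝ) = 2 ^ 2 by norm_num, Real.log_pow] at hcon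
  have h2 : (1 - κ) * (4 * Real.log 2 + 4 * Real.log 3) ≤ (1 - κ) * Real.log w :=
    mul_le_mul_of_nonneg_left hlw (by linarith)
  push_cast at hcon
  nlinarith

theorem one_div_le_abs_log_div {q P : ℕ} (hq : 0 < q) (hP : 0 < P) (hqP : q ≠ P) :
    1 / ((P : ℝ) + 1) ≤ |Real.log ((q : ℝ) / P)| := by
  have hq' : (0 : ℝ) < q := by exact_mod_cast hq
  have hP' : (0 : ℝ) < P := by exact_mod_cast hP
  rcases lt_or_gt_of_ne hqP with hlt | hgt
  · have h1 : (q : ℝ) + 1 ≤ P := by exact_mod_cast hlt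
    have h2 := Real.log_le_sub_one_of_pos (div_pos hq' hP')
    have h3 : (q : ℝ) / P - 1 ≤ -(1 / (P + 1)) := by
      have : (q : ℝ) / P ≤ 1 - 1 / (P + 1) := by
        rw [div_le_iff₀ hP', one_sub_div (by positivity), div_mul_eq_mul_div,
          le_div_iff₀ (by positivity)]
        nlinarith
      linarith
    have h4 := neg_le_abs (Real.log ((q : ℝ) / P))
    linarith
  · have h1 : (P : ℝ) + 1 ≤ q := by exact_mod_cast hgt
    have h2 := Real.log_le_sub_one_of_pos (div_pos hP' hq')
    have h5 : Real.log ((P : ℝ) / q) = -Real.log ((q : ℝ) / P) := by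
      rw [← Real.log_inv, inv_div]
    have h3 : (P : ℝ) / q - 1 ≤ -(1 / (P + 1)) := by
      have : (P : ℝ) / q ≤ P / (P + 1) := by gcongr
      have h6 : (P : ℝ) / (P + 1) = 1 - 1 / (P + 1) := by field_simp; ring
      linarith
    have h4 := le_abs_self (Real.log ((q : ℝ) / P))
    linarith

set_option maxHeartbeats 1000000 in
theorem false_of_large_exponent (ℓ p q c₁ c₂ : ℕ) (η : ℝ) (hℓ : 32000 ≤ ℓ) (hp : 2 ≤ p)
    (hq : 0 < q) (hqp : q ≠ p ^ 2) (hc₁ : 0 < c₁) (hc₂ : 0 < c₂) (hlc : Real.log c₂ ≤ 28)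
    (hη : 0 < η) (hηle : Real.log η ≤ 28 - 2 * ℓ * Real.log p)
    (hα : ((q : ℝ) / (p ^ 2 : ℕ)) ^ ℓ = (c₁ : ℝ) / c₂ * (1 + η))
    (hL : |Real.log ((q : ℝ) / (p ^ 2 : ℕ))| * ℓ ≤ 24) : False := by
  have hp0 : 0 < p ^ 2 := by positivity
  have hp' : (2 : ℝ) ≤ p := by exact_mod_cast hp
  have hℓ' : (32000 : ℝ) ≤ ℓ := by exact_mod_cast hℓ
  set w : ℝ := ℓ / 24 with hw
  have hw1 : 1333 ≤ w := by rw [hw, le_div_iff₀ (by norm_num)]; linarith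
  have hℓw : (ℓ : ℝ) = 24 * w := by rw [hw]; ring
  have hlw : (7 : ℝ) ≤ Real.log w := by
    have h1 : Real.log 1296 = 4 * Real.log 2 + 4 * Real.log 3 := by
      rw [show (1296 : ℝ) = 2 ^ 4 * 3 ^ 4 by norm_num, Real.log_mul (by norm_num) (by norm_num),
        Real.log_pow, Real.log_pow]
      norm_num
    have h2 : Real.log 1296 ≤ Real.log w := Real.log_le_log (by norm_num) (by linarith)
    linarith [Real.log_two_gt_d9, log_three_gt]
  have hP1 : w ≤ ((p ^ 2 : ℕ) : ℝ) + 1 := by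
    have h1 := one_div_le_abs_log_div hq hp0 hqp
    have h2 : 1 / (((p ^ 2 : ℕ) : ℝ) + 1) * ℓ ≤ 24 :=
      (mul_le_mul_of_nonneg_right h1 (by positivity)).trans hL
    rw [one_div_mul_eq_div, div_le_iff₀ (by positivity)] at h2
    linarith
  have hlogP : Real.log ((p ^ 2 : ℕ) : ℝ) = 2 * Real.log p := by
    push_cast; rw [Real.log_pow]; norm_num
  clear_value w
  set x : ℝ := Real.log p / Real.log w with hx
  have hxl : Real.log p = x * Real.log w := by rw [hx]; field_simp
  have hx4 : 2 / 5 ≤ x := by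
    rw [hx, le_div_iff₀ (by linarith)]
    have h1 : Real.log (w - 1) ≤ 2 * Real.log p := by
      rw [← hlogP]; exact Real.log_le_log (by linarith) (by linarith)
    have h2 : Real.log w ≤ Real.log (w - 1) + 1 := by
      have h3 := log_le_div_add (w - 1) w (by linarith) (by linarith)
      have h4 : w / (w - 1) ≤ 2 := by rw [div_le_iff₀ (by linarith)]; linarith
      linarith
    linarith
  set S : ℕ := ⌈6 * x⌉₊ with hSdef
  have hS1 : 6 * x ≤ S := Nat.le_ceil _
  have hS2 : (S : ℝ) < 6 * x + 1 := Nat.ceil_lt_add_one (by linarith)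
  have hS3 : 3 ≤ S := by
    have : (2 : ℝ) < S := by linarith
    exact_mod_cast this
  have hS3' : (3 : ℝ) ≤ S := by exact_mod_cast hS3
  set κ : ℝ := 2 * x / S with hκ
  have hκS : κ * S = 2 * x := by rw [hκ]; field_simp
  have hκ3 : κ ≤ 1 / 3 := by rw [hκ, div_le_iff₀ (by linarith)]; linarith
  have hκ4 : 1 / 4 ≤ κ := by
    rw [hκ, le_div_iff₀ (by linarith)]
    rcases Nat.lt_or_ge 3 S with h4 | h3
    · have : (4 : ℝ) ≤ S := by exact_mod_cast h4
      linarith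
    · have : (S : ℝ) ≤ 3 := by exact_mod_cast h3
      linarith
  clear_value κ
  set h : ℕ := ⌊(κ * ℓ - 1) / 2⌋₊ with hhdef
  have hκℓ : 8000 ≤ κ * ℓ := by
    calc (8000 : ℝ) = 1 / 4 * 32000 := by norm_num
      _ ≤ κ * ℓ := by gcongr
  have hκℓ' : κ * ℓ ≤ ℓ / 3 := by
    calc κ * ℓ ≤ 1 / 3 * ℓ := by gcongr
      _ = ℓ / 3 := by ring
  have hh1 : (h : ℝ) ≤ (κ * ℓ - 1) / 2 := Nat.floor_le (by linarith)
  have hh2 : (κ * ℓ - 1) / 2 < h + 1 := Nat.lt_floor_add_one _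
  have hh3 : (3998 : ℝ) < h := by linarith
  have hh3' : 3998 < h := by exact_mod_cast hh3
  have h2h : 2 * h + 1 ≤ ℓ := by
    have : (2 * h + 1 : ℝ) ≤ ℓ := by linarith
    exact_mod_cast this
  have hlogκ : Real.log κ ≤ -1 := by
    have h1 : Real.log κ ≤ Real.log (1 / 3) := Real.log_le_log (by linarith) hκ3
    rw [one_div, Real.log_inv] at h1
    linarith [log_three_gt]
  have hlogρ : Real.log ((h : ℝ) / 12) ≤ Real.log w - 1 := by
    have h1 : Real.log ((h : ℝ) / 12) ≤ Real.log (κ * w) :=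
      Real.log_le_log (by positivity) (by rw [div_le_iff₀ (by norm_num)]; rw [hℓw] at hh1; linarith)
    rw [Real.log_mul (by linarith) (by linarith)] at h1
    linarith
  have hKx : 2 * ((h : ℝ) * S) ≤ 2 * x * ℓ := by
    have h1 : 2 * (h : ℝ) * S ≤ κ * ℓ * S := by
      apply mul_le_mul_of_nonneg_right _ (by linarith)
      linarith
    calc 2 * ((h : ℝ) * S) = 2 * h * S := by ring
      _ ≤ κ * ℓ * S := h1
      _ = κ * S * ℓ := by ring
      _ = 2 * x * ℓ := by rw [hκS]
  have herr : 2 * S * η * Real.exp (12 * S) * ((h : ℝ) / 12) ^ (2 * (h * S))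
      ≤ Real.exp (h * S) := by
    rw [← Real.log_le_iff_le_exp (by positivity), Real.log_mul (by positivity) (by positivity),
      Real.log_mul (by positivity) (by positivity), Real.log_mul (by positivity) (by positivity),
      Real.log_exp, Real.log_pow]
    push_cast
    have h1 : Real.log (2 * (S : ℝ)) ≤ 2 * S := by
      have := Real.log_le_sub_one_of_pos (by positivity : (0 : ℝ) < 2 * S)
      linarith
    have h2 : 2 * ((h : ℝ) * S) * Real.log ((h : ℝ) / 12)
        ≤ 2 * ((h : ℝ) * S) * (Real.log w - 1) :=
      mul_le_mul_of_nonneg_left hlogρ (by positivity)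
    have h3 : 2 * ((h : ℝ) * S) * Real.log w ≤ 2 * x * ℓ * Real.log w :=
      mul_le_mul_of_nonneg_right hKx (by linarith)
    have h4 : 2 * (ℓ : ℝ) * Real.log p = 2 * x * ℓ * Real.log w := by rw [hxl]; ring
    have h5 : 3998 * (S : ℝ) ≤ h * S := by gcongr
    linarith
  have key := log_interpolation_inequality h S ℓ q (p ^ 2) c₁ c₂ η (by omega) (by omega) h2h hq hp0
    hc₁ hc₂ hqp hη hα hL hlc herr
  have hrate := rate_gt (w := w) (by linarith) hκ4 hκ3
  have hlogh : 2 * Real.log κ + Real.log w - 0.001 ≤ Real.log ((h : ℝ) ^ 2 / (6 * ℓ)) := by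
    have h1 : κ * w * 12 * (1 - 3 / 8000) ≤ h := by
      have : κ * ℓ = 24 * (κ * w) := by rw [hℓw]; ring
      rw [this] at hh2 hκℓ
      linarith
    have h2 : Real.log (κ * w * 12 * (1 - 3 / 8000)) ≤ Real.log h :=
      Real.log_le_log (by linarith [mul_pos (by linarith : 0 < κ) (by linarith : 0 < w)]) h1
    have hκ0 : κ ≠ 0 := by linarith
    have hw0 : w ≠ 0 := by linarith
    rw [Real.log_mul (mul_ne_zero (mul_ne_zero hκ0 hw0) (by norm_num)) (by norm_num),
      Real.log_mul (mul_ne_zero hκ0 hw0) (by norm_num), Real.log_mul hκ0 hw0] at h2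
    have h3 : -0.0005 ≤ Real.log (1 - 3 / 8000 : ℝ) := by
      have := Real.one_sub_inv_le_log_of_pos (by norm_num : (0 : ℝ) < 1 - 3 / 8000)
      norm_num at this ⊢
      linarith
    rw [Real.log_div (by positivity) (by positivity), Real.log_pow, hℓw,
      show (6 : ℝ) * (24 * w) = 12 * 12 * w by ring, Real.log_mul (by norm_num) hw0,
      Real.log_mul (by norm_num) (by norm_num)]
    push_cast
    linarith
  have hK : (11994 : ℝ) ≤ h * S := by
    calc (11994 : ℝ) = 3998 * 3 := by norm_num
      _ ≤ h * S := by gcongr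
  have hlogK : Real.log ((h : ℝ) * S) ≤ h * S / 1000 := by
    have h1 := log_le_div_add 8192 ((h : ℝ) * S) (by norm_num) (by linarith)
    have h2 : Real.log 8192 = 13 * Real.log 2 := by
      rw [show (8192 : ℝ) = 2 ^ 13 by norm_num, Real.log_pow]; norm_num
    linarith [Real.log_two_lt_d9]
  have hlogw : Real.log w ≤ h / 200 := by
    have h1 := log_le_div_add 1024 w (by norm_num) (by linarith)
    have h2 : Real.log 1024 = 10 * Real.log 2 := by
      rw [show (1024 : ℝ) = 2 ^ 10 by norm_num, Real.log_pow]; norm_num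
    have h3 : κ * ℓ = 24 * (κ * w) := by rw [hℓw]; ring
    have h4 : 1 / 4 * w ≤ κ * w := mul_le_mul_of_nonneg_right hκ4 (by linarith)
    linarith [Real.log_two_lt_d9]
  rw [hlogP] at key
  have hmain : ((h : ℝ) + 1) * (2 * Real.log p) = h * S * (κ * Real.log w)
      + S * (κ * Real.log w) := by
    rw [hxl]; linear_combination (-(h : ℝ) - 1) * Real.log w * hκS
  have h1 : (h : ℝ) * S * (2 * Real.log κ + Real.log w - 0.001 - 5 / 2)
      ≤ h * S * (Real.log ((h : ℝ) ^ 2 / (6 * ℓ)) - 5 / 2) :=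
    mul_le_mul_of_nonneg_left (by linarith) (by positivity)
  have h2 : (h : ℝ) * S * 0.07 ≤ h * S * (2 * Real.log κ + (1 - κ) * Real.log w - 5 / 2) :=
    mul_le_mul_of_nonneg_left hrate (by positivity)
  have h3 : (S : ℝ) * (κ * Real.log w) ≤ S * (h / 600) := by
    apply mul_le_mul_of_nonneg_left _ (by positivity)
    have h5 : κ * Real.log w ≤ 1 / 3 * Real.log w :=
      mul_le_mul_of_nonneg_right hκ3 (by linarith)
    linarith
  have h4 : 3998 * (S : ℝ) ≤ h * S := by gcongr
  rw [hmain] at key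
  linarith [Real.log_two_lt_d9]

end

theorem natCast_le_exp_of_le_pow {n k : ℕ} (h : (n : ℝ) ≤ 2.718 ^ k) : (n : ℝ) ≤ Real.exp k := by
  refine h.trans ?_
  rw [← Real.exp_one_pow]
  have := Real.exp_one_gt_d9
  gcongr
  linarith

theorem no_solution_large_exponent (ℓ u v p q : ℕ) (hℓ : 32000 ≤ ℓ) (hu : 0 < u) (hu5 : u ≤ 5)
    (hv : 0 < v) (hv' : v ≤ 9800) (hp : 2 ≤ p)
    (h : v ^ 3 * q ^ ℓ = 49 * u * (u ^ 2 * (p ^ ℓ) ^ 2 + 600 * v ^ 2)) : False := by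
  have hu' : (1 : ℝ) ≤ u := by exact_mod_cast hu
  have hu5' : (u : ℝ) ≤ 5 := by exact_mod_cast hu5
  have hv1 : (1 : ℝ) ≤ v := by exact_mod_cast hv
  have hv'' : (v : ℝ) ≤ 9800 := by exact_mod_cast hv'
  have hp' : (2 : ℝ) ≤ p := by exact_mod_cast hp
  have hXbig : 2 ^ 64 ≤ (p ^ ℓ) ^ 2 := by
    calc 2 ^ 64 ≤ (2 ^ ℓ) ^ 2 := by
          rw [← pow_mul]; exact Nat.pow_le_pow_right (by norm_num) (by omega)
      _ ≤ (p ^ ℓ) ^ 2 := by gcongr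
  have hXbig' : (2 : ℝ) ^ 64 ≤ ((p : ℝ) ^ ℓ) ^ 2 := by exact_mod_cast hXbig
  have hq : 0 < q := by
    rcases Nat.eq_zero_or_pos q with h0 | h0
    · subst h0
      rw [zero_pow (by omega)] at h
      have : 0 < 49 * u * (u ^ 2 * (p ^ ℓ) ^ 2 + 600 * v ^ 2) := by positivity
      omega
    · exact h0
  have hbound : 29400 * (u * v ^ 2) < 2 ^ 64 := by
    calc 29400 * (u * v ^ 2) ≤ 29400 * (5 * 9800 ^ 2) := by gcongr
      _ < 2 ^ 64 := by norm_num
  have hqp : q ≠ p ^ 2 := by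
    rintro rfl
    rw [pow_right_comm] at h
    generalize (p ^ ℓ) ^ 2 = X at h hXbig
    have h1 : v ^ 3 * X = 49 * u ^ 3 * X + 29400 * (u * v ^ 2) := by rw [h]; ring
    have h2 : 0 < u * v ^ 2 := by positivity
    rcases le_or_gt (v ^ 3) (49 * u ^ 3) with h3 | h3
    · have := Nat.mul_le_mul_right X h3
      omega
    · have := Nat.mul_le_mul_right X h3
      rw [Nat.succ_mul] at this
      omega
  set X : ℝ := ((p : ℝ) ^ ℓ) ^ 2 with hX
  have hX0 : 0 < X := by positivity
  have hreal : (v : ℝ) ^ 3 * (q : ℝ) ^ ℓ = 49 * u * (u ^ 2 * X + 600 * v ^ 2) := by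
    rw [hX]; exact_mod_cast h
  have hα : ((q : ℝ) / (p ^ 2 : ℕ)) ^ ℓ
      = ((49 * u ^ 3 : ℕ) : ℝ) / (v ^ 3 : ℕ) * (1 + 600 * v ^ 2 / (u ^ 2 * X)) := by
    have hpX : (((p ^ 2 : ℕ) : ℝ)) ^ ℓ = X := by rw [hX]; push_cast; rw [pow_right_comm]
    rw [div_pow, hpX]
    push_cast
    field_simp
    linear_combination hreal
  have hη1 : 600 * (v : ℝ) ^ 2 / (u ^ 2 * X) ≤ 1 := by
    rw [div_le_one (by positivity)]
    calc 600 * (v : ℝ) ^ 2 ≤ 600 * 9800 ^ 2 := by gcongr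
      _ ≤ 1 ^ 2 * 2 ^ 64 := by norm_num
      _ ≤ u ^ 2 * X := by gcongr
  have hη0 : 0 < 600 * (v : ℝ) ^ 2 / (u ^ 2 * X) := by positivity
  have he24 : (9800 : ℝ) ^ 3 ≤ Real.exp 28 := by
    exact_mod_cast natCast_le_exp_of_le_pow (n := 9800 ^ 3) (k := 28) (by norm_num)
  refine false_of_large_exponent ℓ p q (49 * u ^ 3) (v ^ 3) _ hℓ hp hq hqp (by positivity)
    (by positivity) ?_ hη0 ?_ hα ?_
  · rw [Real.log_le_iff_le_exp (by positivity)]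
    push_cast
    exact (by gcongr : (v : ℝ) ^ 3 ≤ 9800 ^ 3).trans he24
  · have h1 : Real.log X = 2 * ℓ * Real.log p := by
      rw [hX, Real.log_pow, Real.log_pow]; push_cast; ring
    rw [← h1, mul_comm ((u : ℝ) ^ 2), ← div_div, div_right_comm, Real.log_div (by positivity) hX0.ne']
    have h2 : Real.log (600 * (v : ℝ) ^ 2 / u ^ 2) ≤ 28 := by
      rw [Real.log_le_iff_le_exp (by positivity), div_le_iff₀ (by positivity)]
      calc 600 * (v : ℝ) ^ 2 ≤ 9800 ^ 3 * 1 ^ 2 := by nlinarith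
        _ ≤ Real.exp 28 * u ^ 2 := by gcongr
    linarith
  · rw [mul_comm, ← abs_of_nonneg (Nat.cast_nonneg (α := ℝ) ℓ), ← abs_mul, ← Real.log_pow, hα]
    set c := ((49 * u ^ 3 : ℕ) : ℝ) / (v ^ 3 : ℕ) with hc
    have hc0 : 0 < c := by positivity
    have he := natCast_le_exp_of_le_pow (n := 9800 ^ 3 / 49 + 1) (k := 24) (by norm_num)
    have hcle : c ≤ 6125 := by
      rw [hc, div_le_iff₀ (by positivity)]; push_cast
      calc 49 * (u : ℝ) ^ 3 ≤ 49 * 5 ^ 3 := by gcongr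
        _ ≤ 6125 * 1 ^ 3 := by norm_num
        _ ≤ 6125 * (v : ℝ) ^ 3 := by gcongr
    have hcge : 49 / 9800 ^ 3 ≤ c := by
      rw [hc]; push_cast
      calc (49 : ℝ) / 9800 ^ 3 = 49 * 1 ^ 3 / 9800 ^ 3 := by norm_num
        _ ≤ 49 * (u : ℝ) ^ 3 / v ^ 3 := by gcongr
    rw [abs_le]
    constructor
    · rw [Real.le_log_iff_exp_le (by positivity), Real.exp_neg]
      calc (Real.exp 24)⁻¹ ≤ ((9800 ^ 3 / 49 + 1 : ℕ) : ℝ)⁻¹ := by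
            apply inv_anti₀ (by positivity); exact_mod_cast he
        _ ≤ 49 / 9800 ^ 3 * 1 := by norm_num
        _ ≤ c * (1 + 600 * v ^ 2 / (u ^ 2 * X)) := by gcongr; linarith
    · rw [Real.log_le_iff_le_exp (by positivity)]
      calc c * (1 + 600 * v ^ 2 / (u ^ 2 * X)) ≤ 6125 * (1 + 1) := by gcongr
        _ ≤ ((9800 ^ 3 / 49 + 1 : ℕ) : ℝ) := by norm_num
        _ ≤ Real.exp 24 := by exact_mod_cast he

/-- The equation `v³ q ^ ℓ = 49 u (u² p ^ (2ℓ) + 600 v²)` has no solution. -/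
def NoSolution (ℓ u v : ℕ) : Prop :=
  ∀ p q : ℕ, v ^ 3 * q ^ ℓ ≠ 49 * u * (u ^ 2 * (p ^ ℓ) ^ 2 + 600 * v ^ 2)

/-- Evaluates `n` before handing it to `f`, so that the kernel computes with numerals. -/
def withNumeral {α : Type} (n : ℕ) (f : ℕ → α) : α :=
  Nat.rec (f 0) (fun m _ => f (Nat.succ m)) n

theorem withNumeral_eq {α : Type} (n : ℕ) (f : ℕ → α) : withNumeral n f = f n := by
  cases n <;> rfl

/-- `(a z + b) ^ e` is neither `0` nor `c` modulo `r`. -/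
def residueTest (r e a b c z : ℕ) : Bool :=
  Nat.rec false (fun m _ => !(Nat.beq (Nat.succ m) c))
    (Nat.mod (Nat.pow (Nat.add (Nat.mul a z) b) e) r)

/-- `residueTest` at `z, z h, …, z h ^ (n - 1)`. -/
def orbitTest (r e a b c h : ℕ) : ℕ → ℕ → Bool :=
  Nat.rec (fun _ => true) fun _ ih z =>
    Bool.rec false (withNumeral (Nat.mod (Nat.mul z h) r) ih) (residueTest r e a b c z)

/-- The equation for `(u, v)` is insoluble modulo `r = 2kℓ + 1`, where `h` is a primitive
`k`-th root of unity modulo `r`. -/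
def pairTest (r k h u v : ℕ) : Bool :=
  withNumeral (Nat.mod (Nat.pow v (Nat.mul 6 k)) r) fun c =>
  withNumeral (Nat.mod (Nat.mul 49 (Nat.pow u 3)) r) fun a =>
  withNumeral (Nat.mod (Nat.mul (Nat.mul 29400 u) (Nat.pow v 2)) r) fun b =>
  withNumeral (Nat.mul 2 k) fun e =>
    residueTest r e a b c 0 && orbitTest r e a b c h k 1

/-- None of `z, z h, …, z h ^ (n - 1)` is `1` modulo `r`. -/
def orderTest (r h : ℕ) : ℕ → ℕ → Bool
  | 0, _ => true
  | n + 1, z => !(Nat.beq z 1) && withNumeral (Nat.mod (Nat.mul z h) r) (orderTest r h n)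

/-- Searches for an element of order `k` modulo `r = 2kℓ + 1`. -/
def findRoot (r k ℓ : ℕ) : ℕ → ℕ → ℕ
  | 0, _ => 0
  | n + 1, g => withNumeral (Nat.mod (Nat.pow g (Nat.mul 2 ℓ)) r) fun h =>
      bif orderTest r h (Nat.pred k) h then h else findRoot r k ℓ n (Nat.succ g)

def rootTest (r k h : ℕ) : Bool :=
  Nat.beq (Nat.mod (Nat.pow h k) r) 1 && orderTest r h (Nat.pred k) h

/-- Uses the primes `r = 2kℓ + 1` below `(B + 1)²` for successive `k` to discard the pairs in a
list; `F` stands for `B!`. -/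
def sieveTest (B F ℓ : ℕ) : ℕ → ℕ → List (ℕ × ℕ) → Bool
  | 0, _, _ => false
  | n + 1, k, cs => withNumeral (Nat.succ (Nat.mul (Nat.mul 2 k) ℓ)) fun r =>
     bif Nat.beq (Nat.gcd F r) 1 && Nat.blt r (Nat.mul (Nat.succ B) (Nat.succ B)) then
       withNumeral (findRoot r k ℓ 100 2) fun h =>
        bif rootTest r k h then
          List.rec true (fun c l _ => sieveTest B F ℓ n (Nat.succ k) (c :: l))
            (cs.filter fun c => !(pairTest r k h c.1 c.2))
        else sieveTest B F ℓ n (Nat.succ k) cs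
     else sieveTest B F ℓ n (Nat.succ k) cs

/-- The pairs `(u, v)` that arise, except for `(1, 29400)`. -/
def sievePairs : List (ℕ × ℕ) :=
  [(1, 1), (1, 8), (1, 3), (1, 24), (1, 49), (1, 392), (1, 147), (1, 1176),
   (5, 1), (5, 8), (5, 3), (5, 24), (5, 49), (5, 392), (5, 147), (5, 1176),
   (1, 25), (1, 200), (1, 75), (1, 600), (1, 1225), (1, 9800), (1, 3675)]

/-- `sieveTest` for those of the `2 ^ d` numbers `ℓ, ℓ + 2, …` that are coprime to `f`. -/
def exponentTest (B F f : ℕ) : ℕ → ℕ → Bool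
  | 0, ℓ => bif Nat.beq (Nat.gcd f ℓ) 1 then sieveTest B F ℓ 100 1 sievePairs else true
  | d + 1, ℓ => exponentTest B F f d ℓ &&
     withNumeral (Nat.add ℓ (Nat.pow 2 (Nat.succ d))) (exponentTest B F f d)

/-- The product of `a + 1, …, a + 2 ^ d`. -/
def blockProduct : ℕ → ℕ → ℕ
  | 0, a => Nat.succ a
  | d + 1, a => Nat.mul (blockProduct d a) (blockProduct d (Nat.add a (Nat.pow 2 d)))

/-- `exponentTest` with the bounds `B = 2 ^ D` and `b = 2 ^ e`. -/
def rangeTest (D e d ℓ : ℕ) : Bool :=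
  withNumeral (Nat.pow 2 D) fun B =>
  withNumeral (blockProduct D 0) fun F => withNumeral (blockProduct e 0) fun f =>
    exponentTest B F f d ℓ

theorem residueTest_iff {r e a b c z : ℕ} : residueTest r e a b c z = true ↔
    (a * z + b) ^ e % r ≠ 0 ∧ (a * z + b) ^ e % r ≠ c := by
  have h : residueTest r e a b c z = Nat.rec false (fun m _ => !(Nat.beq (Nat.succ m) c))
    ((a * z + b) ^ e % r) := rfl
  rw [h]
  cases (a * z + b) ^ e % r with
  | zero => simp
  | succ m =>
    have hbeq : Nat.beq (m + 1) c = false ↔ m + 1 ≠ c := by rw [← Bool.not_eq_true, Nat.beq_eq]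
    simp [hbeq]

theorem orbitTest_succ (r e a b c h n z : ℕ) : orbitTest r e a b c h (n + 1) z =
    (residueTest r e a b c z && orbitTest r e a b c h n (z * h % r)) := by
  have h1 : orbitTest r e a b c h (n + 1) z = Bool.rec false
    (withNumeral (z * h % r) (orbitTest r e a b c h n)) (residueTest r e a b c z) := rfl
  rw [h1, withNumeral_eq]
  cases residueTest r e a b c z <;> rfl

theorem orbitTest_sound {r e a b c h : ℕ} (n z : ℕ) (H : orbitTest r e a b c h n z = true)
    {j : ℕ} (hj : j < n) :
    ∃ z' : ℕ, (z' : ZMod r) = z * h ^ j ∧ residueTest r e a b c z' = true := by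
  induction n generalizing z j with
  | zero => omega
  | succ n ih =>
    rw [orbitTest_succ, Bool.and_eq_true] at H
    cases j with
    | zero => exact ⟨z, by simp, H.1⟩
    | succ j =>
      obtain ⟨z', h1, h2⟩ := ih _ H.2 (by omega : j < n)
      refine ⟨z', ?_, h2⟩
      rw [h1, ZMod.natCast_mod, Nat.cast_mul, pow_succ]; ring

theorem orderTest_sound {r h : ℕ} (hr : 1 < r) (n z : ℕ) (H : orderTest r h n z = true)
    (hz : z < r) {j : ℕ} (hj : j < n) : (z * h ^ j : ZMod r) ≠ 1 := by
  induction n generalizing z j with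
  | zero => omega
  | succ n ih =>
    rw [orderTest, withNumeral_eq, Bool.and_eq_true] at H
    cases j with
    | zero =>
      intro h1
      rw [pow_zero, mul_one, ← Nat.cast_one, ZMod.natCast_eq_natCast_iff', Nat.mod_eq_of_lt hz,
        Nat.mod_eq_of_lt hr] at h1
      simp [h1] at H
    | succ j =>
      have h3 := ih _ H.2 (Nat.mod_lt _ (by omega)) (by omega : j < n)
      have : ((Nat.mod (Nat.mul z h) r : ℕ) : ZMod r) = z * h := by
        change ((z * h % r : ℕ) : ZMod r) = _
        rw [ZMod.natCast_mod, Nat.cast_mul]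
      rw [this] at h3
      rwa [pow_succ', ← mul_assoc]

theorem pairTest_sound {r k h u v ℓ : ℕ} (hr : r.Prime) (hk : r = 2 * k * ℓ + 1)
    (hk0 : 0 < k) (hℓ : 0 < ℓ) (hroot : IsPrimitiveRoot (h : ZMod r) k)
    (H : pairTest r k h u v = true) : NoSolution ℓ u v := by
  have := Fact.mk hr
  intro p q heq
  rw [pairTest, withNumeral_eq, withNumeral_eq, withNumeral_eq, withNumeral_eq, Bool.and_eq_true] at H
  obtain ⟨H0, H1⟩ := H
  change residueTest r (2 * k) (49 * u ^ 3 % r) (29400 * u * v ^ 2 % r) (v ^ (6 * k) % r) 0 = true at H0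
  change orbitTest r (2 * k) (49 * u ^ 3 % r) (29400 * u * v ^ 2 % r) (v ^ (6 * k) % r) h k 1 = true at H1
  have hz : ∃ z' : ℕ, (z' : ZMod r) = ((p : ZMod r) ^ ℓ) ^ 2 ∧
      residueTest r (2 * k) (49 * u ^ 3 % r) (29400 * u * v ^ 2 % r) (v ^ (6 * k) % r) z' = true := by
    by_cases hp : (p : ZMod r) = 0
    · exact ⟨0, by simp [hp, hℓ.ne'], H0⟩
    · have h1 : (((p : ZMod r) ^ ℓ) ^ 2) ^ k = 1 := by
        have := ZMod.pow_card_sub_one_eq_one hp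
        rw [← pow_mul, ← pow_mul]
        rwa [show r - 1 = ℓ * (2 * k) by rw [hk, Nat.add_sub_cancel]; ring] at this
      have : NeZero k := ⟨hk0.ne'⟩
      obtain ⟨j, hj, hj'⟩ := hroot.eq_pow_of_pow_eq_one h1
      obtain ⟨z', hz', ht⟩ := orbitTest_sound k 1 H1 hj
      exact ⟨z', by rw [hz', ← hj']; simp, ht⟩
  obtain ⟨z, hz, ht⟩ := hz
  obtain ⟨ht0, ht1⟩ := residueTest_iff.1 ht
  have hcast : (v : ZMod r) ^ 3 * (q : ZMod r) ^ ℓ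
      = 49 * u ^ 3 * z + 29400 * u * v ^ 2 := by
    have h1 := congrArg (Nat.cast : ℕ → ZMod r) heq
    push_cast at h1
    rw [h1, hz]
    ring
  by_cases hq : (q : ZMod r) = 0
  · apply ht0
    rw [← Nat.dvd_iff_mod_eq_zero, ← ZMod.natCast_eq_zero_iff]
    push_cast [ZMod.natCast_mod]
    rw [← hcast, hq, zero_pow hℓ.ne', mul_zero, zero_pow (by omega)]
  · apply ht1
    rw [← ZMod.natCast_eq_natCast_iff']
    push_cast [ZMod.natCast_mod]
    have h1 : (q : ZMod r) ^ (ℓ * (2 * k)) = 1 := by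
      have := ZMod.pow_card_sub_one_eq_one hq
      rwa [show r - 1 = ℓ * (2 * k) by rw [hk, Nat.add_sub_cancel]; ring] at this
    rw [← hcast, mul_pow, ← pow_mul, ← pow_mul, h1, mul_one]
    congr 1
    ring

theorem rootTest_sound {r k h : ℕ} (hr : 1 < r) (hk : 0 < k) (hh : h < r)
    (H : rootTest r k h = true) : IsPrimitiveRoot (h : ZMod r) k := by
  rw [rootTest, Bool.and_eq_true] at H
  refine IsPrimitiveRoot.mk_of_lt _ hk ?_ ?_
  · have h1 : h ^ k % r = 1 := Nat.eq_of_beq_eq_true H.1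
    have h2 : ((h ^ k : ℕ) : ZMod r) = (1 : ℕ) := by
      rw [ZMod.natCast_eq_natCast_iff', h1, Nat.mod_eq_of_lt hr]
    exact_mod_cast h2
  · intro j hj0 hjk
    have := orderTest_sound hr _ _ H.2 hh (j := j - 1) (by rw [Nat.pred_eq_sub_one]; omega)
    rwa [← pow_succ', Nat.sub_add_cancel hj0] at this

theorem prime_of_coprime_factorial {B r : ℕ} (h1 : 1 < r) (hB : r < (B + 1) * (B + 1))
    (h : (B.factorial).gcd r = 1) : r.Prime := by
  by_contra hr
  have h2 := Nat.minFac_sq_le_self (by omega) hr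
  have h3 : r.minFac ≤ B := by
    by_contra! h4
    have : (B + 1) * (B + 1) ≤ r.minFac * r.minFac := Nat.mul_le_mul h4 h4
    rw [sq] at h2
    omega
  have h4 : r.minFac ∣ (B.factorial).gcd r :=
    Nat.dvd_gcd (Nat.dvd_factorial (Nat.minFac_pos r) h3) (Nat.minFac_dvd r)
  rw [h, Nat.dvd_one, Nat.minFac_eq_one_iff] at h4
  omega

theorem findRoot_lt {r : ℕ} (hr : 0 < r) (k ℓ n g : ℕ) : findRoot r k ℓ n g < r := by
  induction n generalizing g with
  | zero => exact hr
  | succ n ih =>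
    rw [findRoot, withNumeral_eq]
    cases orderTest r (Nat.mod (Nat.pow g (Nat.mul 2 ℓ)) r) (Nat.pred k)
      (Nat.mod (Nat.pow g (Nat.mul 2 ℓ)) r)
    · exact ih _
    · exact Nat.mod_lt _ hr

theorem sieveTest_sound {B ℓ : ℕ} (hℓ : 0 < ℓ) (n k : ℕ) (hk : 0 < k) (cs : List (ℕ × ℕ))
    (H : sieveTest B B.factorial ℓ n k cs = true) : ∀ c ∈ cs, NoSolution ℓ c.1 c.2 := by
  induction n generalizing k cs with
  | zero => simp [sieveTest] at H
  | succ n ih =>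
    rw [sieveTest, withNumeral_eq, withNumeral_eq] at H
    set r := Nat.succ (Nat.mul (Nat.mul 2 k) ℓ) with hr
    have hr' : r = 2 * k * ℓ + 1 := rfl
    have hr1 : 1 < r := by rw [hr']; have : 0 < 2 * k * ℓ := by positivity
                           omega
    cases hprime : (Nat.beq (Nat.gcd B.factorial r) 1 &&
      Nat.blt r (Nat.mul (Nat.succ B) (Nat.succ B)))
    · rw [hprime] at H
      exact ih _ (Nat.succ_pos k) cs H
    rw [hprime, cond_true] at H
    rw [Bool.and_eq_true, Nat.blt_eq] at hprime
    have hrp : r.Prime := prime_of_coprime_factorial hr1 hprime.2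
      (Nat.eq_of_beq_eq_true hprime.1)
    cases hroot : rootTest r k (findRoot r k ℓ 100 2)
    · rw [hroot] at H
      exact ih _ (Nat.succ_pos k) cs H
    rw [hroot, cond_true] at H
    have hprim := rootTest_sound hr1 hk (findRoot_lt (by omega) k ℓ 100 2) hroot
    have hrest : ∀ c ∈ cs.filter fun c => !(pairTest r k (findRoot r k ℓ 100 2) c.1 c.2),
        NoSolution ℓ c.1 c.2 := by
      revert H
      cases cs.filter fun c => !(pairTest r k (findRoot r k ℓ 100 2) c.1 c.2) with
      | nil => simp
      | cons c l => exact fun H => ih _ (Nat.succ_pos k) _ H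
    intro c hc
    cases hpair : pairTest r k (findRoot r k ℓ 100 2) c.1 c.2
    · exact hrest c (by simp [hc, hpair])
    · exact pairTest_sound hrp hr' hk hℓ hprim hpair

theorem exponentTest_sound {B b : ℕ} (d ℓ₀ : ℕ)
    (H : exponentTest B B.factorial b.factorial d ℓ₀ = true) {ℓ : ℕ} (hℓ : ℓ.Prime)
    (hb : b < ℓ) (h1 : ℓ₀ ≤ ℓ) (h2 : ℓ < ℓ₀ + 2 * 2 ^ d) (hpar : ℓ % 2 = ℓ₀ % 2) :
    ∀ c ∈ sievePairs, NoSolution ℓ c.1 c.2 := by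
  induction d generalizing ℓ₀ with
  | zero =>
    obtain rfl : ℓ = ℓ₀ := by omega
    have h4 : (b.factorial).gcd ℓ = 1 := by
      rw [Nat.gcd_comm]
      exact (Nat.Prime.coprime_iff_not_dvd hℓ).2 fun h => by
        have := (hℓ.dvd_factorial).1 h
        omega
    rw [exponentTest, h4] at H
    exact sieveTest_sound hℓ.pos 100 1 one_pos _ H
  | succ d ih =>
    rw [exponentTest, withNumeral_eq, Bool.and_eq_true] at H
    rcases lt_or_ge ℓ (ℓ₀ + 2 ^ (d + 1)) with h3 | h3
    · exact ih ℓ₀ H.1 h1 (by rw [pow_succ] at h3; omega) hpar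
    · exact ih (ℓ₀ + 2 ^ (d + 1)) H.2 h3 (by rw [pow_succ] at *; omega)
        (by rw [pow_succ]; omega)

theorem blockProduct_mul_factorial (d a : ℕ) :
    blockProduct d a * a.factorial = (a + 2 ^ d).factorial := by
  induction d generalizing a with
  | zero => rfl
  | succ d ih =>
    change blockProduct d a * blockProduct d (a + 2 ^ d) * a.factorial = _
    rw [mul_right_comm, ih, mul_comm, ih]
    congr 1
    ring

theorem rangeTest_sound {D e d ℓ₀ : ℕ} (H : rangeTest D e d ℓ₀ = true) {ℓ : ℕ} (hℓ : ℓ.Prime)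
    (he : 2 ^ e < ℓ) (h1 : ℓ₀ ≤ ℓ) (h2 : ℓ < ℓ₀ + 2 * 2 ^ d) (hpar : ℓ % 2 = ℓ₀ % 2) :
    ∀ c ∈ sievePairs, NoSolution ℓ c.1 c.2 := by
  have hblock (n : ℕ) : blockProduct n 0 = (2 ^ n).factorial := by
    simpa using blockProduct_mul_factorial n 0
  rw [rangeTest, withNumeral_eq, withNumeral_eq, withNumeral_eq, hblock, hblock] at H
  exact exponentTest_sound d ℓ₀ H hℓ he h1 h2 hpar

theorem rangeTest_small : rangeTest 6 3 5 11 = true := by decide +kernel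

theorem rangeTest_medium : rangeTest 9 6 10 75 = true := by decide +kernel

theorem rangeTest_large : rangeTest 11 8 13 2123 = true := by decide +kernel

theorem rangeTest_larger : rangeTest 11 8 13 18507 = true := by decide +kernel

theorem noSolution_of_exponent_range {ℓ : ℕ} (hℓ : ℓ.Prime) (h11 : 11 ≤ ℓ) (hlt : ℓ < 32001) :
    ∀ c ∈ sievePairs, NoSolution ℓ c.1 c.2 := by
  have hodd : ℓ % 2 = 1 := hℓ.eq_two_or_odd.resolve_left (by omega)
  rcases Nat.lt_or_ge ℓ 75 with h | h
  · exact rangeTest_sound rangeTest_small hℓ (by omega) h11 (by omega) (by omega)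
  rcases Nat.lt_or_ge ℓ 2123 with h' | h'
  · exact rangeTest_sound rangeTest_medium hℓ (by omega) h (by omega) (by omega)
  rcases Nat.lt_or_ge ℓ 18507 with h'' | h''
  · exact rangeTest_sound rangeTest_large hℓ (by omega) h' (by omega) (by omega)
  · exact rangeTest_sound rangeTest_larger hℓ (by omega) h'' (by omega) (by omega)

theorem false_of_seventh_power_eq {p q a b v : ℕ}
    (h : v * q ^ 7 = 49 * (a * p ^ 14 + b)) (hv : ¬ 7 ∣ v)
    (hmod : ∀ x < 49, ¬ 49 ∣ a * x ^ 14 + b) : False := by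
  have h7 : (7 : ℕ).Prime := by norm_num
  have h1 : 7 ∣ v * q ^ 7 := h ▸ ⟨7 * (a * p ^ 14 + b), by ring⟩
  obtain ⟨s, rfl⟩ := h7.dvd_of_dvd_pow ((h7.dvd_mul.1 h1).resolve_left hv)
  have h2 : a * p ^ 14 + b = 49 * (343 * v * s ^ 7) := by
    have : 49 * (a * p ^ 14 + b) = 49 * (49 * (343 * v * s ^ 7)) := by rw [← h]; ring
    omega
  refine hmod (p % 49) (Nat.mod_lt _ (by norm_num)) ?_
  rw [Nat.dvd_iff_mod_eq_zero, Nat.add_mod, Nat.mul_mod, ← Nat.pow_mod, ← Nat.mul_mod,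
    ← Nat.add_mod, h2, Nat.mul_mod_right]

theorem noSolution_five : ∀ c ∈ sievePairs, NoSolution 5 c.1 c.2 := by
  have h1 : NoSolution 5 1 3 := by
    intro p q h
    have h2 : ∀ x < 125, ∀ y < 125, 27 * y ^ 5 % 125 ≠ 49 * (x ^ 10 + 5400) % 125 := by
      decide +kernel
    apply h2 (p % 125) (Nat.mod_lt _ (by norm_num)) (q % 125) (Nat.mod_lt _ (by norm_num))
    have h3 : 27 * q ^ 5 = 49 * (p ^ 10 + 5400) := by linarith
    have h4 := ((Nat.mod_modEq q 125).pow 5).mul_left 27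
    have h5 := (((Nat.mod_modEq p 125).pow 10).add_right 5400).mul_left 49
    rw [h3] at h4
    exact h4.trans h5.symm
  have h5 : NoSolution 5 5 3 := by
    intro p q h
    have hp5 : (5 : ℕ).Prime := by norm_num
    have h3 : 27 * q ^ 5 = 6125 * (p ^ 10 + 216) := by linarith
    have h4 : 5 ∣ 27 * q ^ 5 := h3 ▸ ⟨1225 * (p ^ 10 + 216), by ring⟩
    obtain ⟨s, rfl⟩ := hp5.dvd_of_dvd_pow ((hp5.dvd_mul.1 h4).resolve_left (by norm_num))
    have h6 : 49 * (p ^ 10 + 216) = 25 * (27 * s ^ 5) := by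
      rw [mul_pow] at h3
      linarith
    have h2 : ∀ x < 25, 49 * (x ^ 10 + 216) % 25 ≠ 0 := by decide +kernel
    apply h2 (p % 25) (Nat.mod_lt _ (by norm_num))
    have h7 := (((Nat.mod_modEq p 25).pow 10).add_right 216).mul_left 49
    rw [h6] at h7
    exact Eq.trans h7 (Nat.mul_mod_right 25 (27 * s ^ 5))
  have htest : sieveTest 10 (Nat.factorial 10) 5 100 1
      (sievePairs.filter fun c => !(c == (1, 3) || c == (5, 3))) = true := by decide +kernel
  intro c hc
  by_cases hc3 : c = (1, 3)
  · subst hc3; exact h1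
  by_cases hc5 : c = (5, 3)
  · subst hc5; exact h5
  exact sieveTest_sound (by norm_num) 100 1 one_pos _ htest c (by simp [hc, hc3, hc5])

theorem noSolution_seven : ∀ c ∈ sievePairs, NoSolution 7 c.1 c.2 := by
  have h1 : NoSolution 7 1 3 := fun p q h =>
    false_of_seventh_power_eq (a := 1) (b := 5400) (v := 27) (p := p) (q := q)
      (by linarith) (by norm_num) (by decide +kernel)
  have h2 : NoSolution 7 1 25 := fun p q h =>
    false_of_seventh_power_eq (a := 1) (b := 375000) (v := 15625) (p := p) (q := q)
      (by linarith) (by norm_num) (by decide +kernel)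
  have h5 : NoSolution 7 5 8 := fun p q h =>
    false_of_seventh_power_eq (a := 125) (b := 192000) (v := 512) (p := p) (q := q)
      (by linarith) (by norm_num) (by decide +kernel)
  have htest : sieveTest 10 (Nat.factorial 10) 7 100 1
      (sievePairs.filter fun c => !(c == (1, 3) || c == (1, 25) || c == (5, 8))) = true := by
    decide +kernel
  intro c hc
  by_cases hc3 : c = (1, 3)
  · subst hc3; exact h1
  by_cases hc25 : c = (1, 25)
  · subst hc25; exact h2
  by_cases hc5 : c = (5, 8)
  · subst hc5; exact h5
  exact sieveTest_sound (by norm_num) 100 1 one_pos _ htest c (by simp [hc, hc3, hc25, hc5])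

section OneUnits

variable {R : Type*} [CommRing R]

theorem exists_one_add_pow_eq (y : R) (n : ℕ) : ∃ z, (1 + y) ^ n = 1 + n * y + y ^ 2 * z := by
  induction n with
  | zero => exact ⟨0, by simp⟩
  | succ n ih =>
    obtain ⟨z, hz⟩ := ih
    exact ⟨n + z + y * z, by rw [pow_succ, hz]; push_cast; ring⟩

theorem exists_one_add_pow_odd_eq (y : R) (h : ℕ) :
    ∃ z, (1 + y) ^ (2 * h + 1) = 1 + (2 * h + 1) * y + (2 * h + 1) * h * y ^ 2 + y ^ 3 * z := by
  induction h with
  | zero => exact ⟨0, by simp⟩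
  | succ h ih =>
    obtain ⟨z, hz⟩ := ih
    refine ⟨(2 * h + 1) + 2 * h * (2 * h + 1) + z * (1 + y) ^ 2 + (2 * h + 1) * h * y, ?_⟩
    rw [show 2 * (h + 1) + 1 = (2 * h + 1) + 2 by ring, pow_add, hz]
    push_cast
    ring

theorem exists_one_add_mul_pow_odd_pow_eq (A : R) (h k : ℕ) :
    ∃ C, (1 + (2 * h + 1) * A) ^ ((2 * h + 1) ^ k) =
      1 + (2 * h + 1) ^ (k + 1) * A + (2 * h + 1) ^ (k + 2) * C := by
  induction k with
  | zero => exact ⟨0, by simp⟩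
  | succ k ih =>
    obtain ⟨C, hC⟩ := ih
    obtain ⟨z, hz⟩ := exists_one_add_pow_odd_eq
      ((2 * h + 1) ^ (k + 1) * (A + (2 * h + 1) * C)) h
    refine ⟨C + (2 * h + 1) ^ k * h * (A + (2 * h + 1) * C) ^ 2 +
      (2 * h + 1) ^ (2 * k) * (A + (2 * h + 1) * C) ^ 3 * z, ?_⟩
    rw [pow_succ (2 * h + 1) k, pow_mul, hC,
      show 1 + (2 * h + 1) ^ (k + 1) * A + (2 * h + 1) ^ (k + 2) * C =
        1 + (2 * h + 1 : R) ^ (k + 1) * (A + (2 * h + 1) * C) by ring, hz]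
    ring

/-- If an additive functional vanishes at `β (1 + r A) ^ (r ^ k m) (1 + r B) ^ (r ^ k n)` and at
`β`, where `r = 2 h + 1`, then the linear term vanishes modulo `r`. -/
theorem dvd_linear_term_of_map_eq_zero (φ : R →+ ℤ) {β A B : R} {h k m n : ℕ} (hβ : φ β = 0)
    (hφ : φ (β * ((1 + (2 * h + 1) * A) ^ ((2 * h + 1) ^ k * m) *
      (1 + (2 * h + 1) * B) ^ ((2 * h + 1) ^ k * n))) = 0) :
    (2 * h + 1 : ℤ) ∣ m * φ (β * A) + n * φ (β * B) := by
  obtain ⟨C, hC⟩ := exists_one_add_mul_pow_odd_pow_eq A h k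
  obtain ⟨D, hD⟩ := exists_one_add_mul_pow_odd_pow_eq B h k
  rw [pow_mul, pow_mul, hC, hD] at hφ
  obtain ⟨y, hy⟩ := exists_one_add_pow_eq
    ((2 * h + 1) ^ (k + 1) * (A + (2 * h + 1) * C)) m
  obtain ⟨z, hz⟩ := exists_one_add_pow_eq
    ((2 * h + 1) ^ (k + 1) * (B + (2 * h + 1) * D)) n
  rw [show 1 + (2 * h + 1 : R) ^ (k + 1) * A + (2 * h + 1) ^ (k + 2) * C =
        1 + (2 * h + 1) ^ (k + 1) * (A + (2 * h + 1) * C) by ring, hy,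
      show 1 + (2 * h + 1 : R) ^ (k + 1) * B + (2 * h + 1) ^ (k + 2) * D =
        1 + (2 * h + 1) ^ (k + 1) * (B + (2 * h + 1) * D) by ring, hz] at hφ
  obtain ⟨W, hW⟩ : ∃ W : R, β * ((1 + m * ((2 * h + 1) ^ (k + 1) * (A + (2 * h + 1) * C)) +
      ((2 * h + 1) ^ (k + 1) * (A + (2 * h + 1) * C)) ^ 2 * y) *
      (1 + n * ((2 * h + 1) ^ (k + 1) * (B + (2 * h + 1) * D)) +
      ((2 * h + 1) ^ (k + 1) * (B + (2 * h + 1) * D)) ^ 2 * z)) =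
      β + ((2 * h + 1) ^ (k + 1) : ℕ) • (m • (β * A) + n • (β * B) + (2 * h + 1) • W) := by
    simp only [nsmul_eq_mul]
    push_cast
    set X := A + (2 * h + 1) * C
    set Y := B + (2 * h + 1) * D
    refine ⟨β * (m * C + n * D + (2 * h + 1) ^ k * (X ^ 2 * y + Y ^ 2 * z + m * n * X * Y) +
      (2 * h + 1) ^ (2 * k + 1) * (m * X * Y ^ 2 * z + n * Y * X ^ 2 * y) +
      (2 * h + 1) ^ (3 * k + 2) * X ^ 2 * Y ^ 2 * y * z), ?_⟩
    simp only [X, Y]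
    ring
  rw [hW] at hφ
  simp only [map_add, map_nsmul, hβ, zero_add] at hφ
  simp only [nsmul_eq_mul] at hφ
  have h0 : (((2 * h + 1) ^ (k + 1) : ℕ) : ℤ) ≠ 0 := by positivity
  have h1 := (mul_eq_zero.1 hφ).resolve_left h0
  exact ⟨-φ W, by push_cast at h1; linarith⟩

theorem eq_zero_of_forall_pow_dvd {r m : ℕ} (hr : 1 < r) (h : ∀ k, r ^ k ∣ m) : m = 0 := by
  by_contra hm
  exact absurd (Nat.le_of_dvd (Nat.pos_of_ne_zero hm) (h m)) (not_le.2 (Nat.lt_pow_self hr))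

theorem exponent_eq_zero_of_map_eq_zero (φ : R →+ ℤ) {β A : R} {h m : ℕ} (hh : 0 < h)
    (hβ : φ β = 0) (hA : IsCoprime (2 * h + 1 : ℤ) (φ (β * A)))
    (hφ : φ (β * (1 + (2 * h + 1) * A) ^ m) = 0) : m = 0 := by
  refine eq_zero_of_forall_pow_dvd (r := 2 * h + 1) (by omega) fun k => ?_
  induction k with
  | zero => simp
  | succ k ih =>
    obtain ⟨m, rfl⟩ := ih
    have h1 := dvd_linear_term_of_map_eq_zero φ (B := 0) (n := 0) (k := k) (m := m) (A := A) hβ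
      (by simpa using hφ)
    have h2 : (2 * h + 1 : ℤ) ∣ m := hA.dvd_of_dvd_mul_right (by simpa using h1)
    rw [pow_succ]
    exact mul_dvd_mul_left _ (by exact_mod_cast h2)

theorem exponents_eq_zero_of_map_eq_zero (φ ψ : R →+ ℤ) {β A B : R} {h m n : ℕ} (hh : 0 < h)
    (hβ : φ β = 0) (hβ' : ψ β = 0)
    (hdet : IsCoprime (2 * h + 1 : ℤ) (φ (β * A) * ψ (β * B) - φ (β * B) * ψ (β * A)))
    (hφ : φ (β * ((1 + (2 * h + 1) * A) ^ m * (1 + (2 * h + 1) * B) ^ n)) = 0)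
    (hψ : ψ (β * ((1 + (2 * h + 1) * A) ^ m * (1 + (2 * h + 1) * B) ^ n)) = 0) :
    m = 0 ∧ n = 0 := by
  have key : ∀ k, (2 * h + 1) ^ k ∣ m ∧ (2 * h + 1) ^ k ∣ n := by
    intro k
    induction k with
    | zero => simp
    | succ k ih =>
      obtain ⟨⟨m, rfl⟩, ⟨n, rfl⟩⟩ := ih
      have h1 := dvd_linear_term_of_map_eq_zero φ hβ hφ
      have h2 := dvd_linear_term_of_map_eq_zero ψ hβ' hψ
      have h3 : (2 * h + 1 : ℤ) ∣ m := hdet.dvd_of_dvd_mul_right (by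
        have := dvd_sub (h1.mul_right (ψ (β * B))) (h2.mul_right (φ (β * B)))
        convert this using 1
        ring)
      have h4 : (2 * h + 1 : ℤ) ∣ n := hdet.dvd_of_dvd_mul_right (by
        have := dvd_sub (h2.mul_right (φ (β * A))) (h1.mul_right (ψ (β * A)))
        convert this using 1
        ring)
      rw [pow_succ]
      exact ⟨mul_dvd_mul_left _ (by exact_mod_cast h3), mul_dvd_mul_left _ (by exact_mod_cast h4)⟩
  exact ⟨eq_zero_of_forall_pow_dvd (by omega) fun k => (key k).1,
    eq_zero_of_forall_pow_dvd (by omega) fun k => (key k).2⟩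

theorem dvd_zpow_sub_one {u : Rˣ} {r : R} (h : r ∣ u - 1) (j : ℤ) : r ∣ (u ^ j : Rˣ) - 1 := by
  have hn : ∀ n : ℕ, r ∣ (u : R) ^ n - 1 := fun n => by
    simpa using h.trans (sub_dvd_pow_sub_pow (u : R) 1 n)
  obtain ⟨n, rfl | rfl⟩ := j.eq_nat_or_neg
  · simpa using hn n
  · have h1 : ((u ^ (-(n : ℤ)) : Rˣ) : R) - 1 = -(u ^ (-(n : ℤ)) : Rˣ) * ((u : R) ^ n - 1) := by
      have h2 : ((u ^ (-(n : ℤ)) : Rˣ) : R) * (u : R) ^ n = 1 := by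
        rw [zpow_neg, zpow_natCast, ← Units.val_pow_eq_pow_val, Units.inv_mul]
      linear_combination h2
    rw [h1]
    exact (hn n).mul_left _

theorem dvd_map_of_dvd_map_mul_zpow (φ : R →+ ℤ) {u : Rˣ} {r : ℤ} (h : (r : R) ∣ u - 1)
    {β : R} {j : ℤ} (hφ : r ∣ φ (β * (u ^ j : Rˣ))) : r ∣ φ β := by
  obtain ⟨Z, hZ⟩ := dvd_zpow_sub_one h j
  rw [sub_eq_iff_eq_add.1 hZ, show β * (r * Z + 1) = r • (β * Z) + β by
    rw [zsmul_eq_mul]; ring, map_add, map_zsmul, smul_eq_mul] at hφ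
  exact (dvd_add_right (dvd_mul_right _ _)).1 hφ

theorem zpow_exponent_eq_zero_of_map_eq_zero (φ : R →+ ℤ) {u : Rˣ} {β A A' : R} {h : ℕ} {j : ℤ}
    (hh : 0 < h) (hu : (u : R) = 1 + (2 * h + 1) * A)
    (hu' : ((u⁻¹ : Rˣ) : R) = 1 + (2 * h + 1) * A') (hβ : φ β = 0)
    (hA : IsCoprime (2 * h + 1 : ℤ) (φ (β * A))) (hA' : IsCoprime (2 * h + 1 : ℤ) (φ (β * A')))
    (hφ : φ (β * (u ^ j : Rˣ)) = 0) : j = 0 := by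
  obtain ⟨n, rfl | rfl⟩ := j.eq_nat_or_neg
  · rw [zpow_natCast, Units.val_pow_eq_pow_val, hu] at hφ
    exact_mod_cast exponent_eq_zero_of_map_eq_zero φ hh hβ hA hφ
  · rw [zpow_neg, zpow_natCast, ← inv_pow, Units.val_pow_eq_pow_val, hu'] at hφ
    simpa using exponent_eq_zero_of_map_eq_zero φ hh hβ hA' hφ

end OneUnits

/-- The ring `ℤ[θ]` with `θ³ = 7`; the element `⟨a, b, c⟩` is `a + b θ + c θ²`. -/
@[ext]
structure CbrtSeven where
  a : ℤ
  b : ℤ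
  c : ℤ

namespace CbrtSeven

instance : Zero CbrtSeven := ⟨⟨0, 0, 0⟩⟩
instance : One CbrtSeven := ⟨⟨1, 0, 0⟩⟩
instance : Add CbrtSeven := ⟨fun x y => ⟨x.a + y.a, x.b + y.b, x.c + y.c⟩⟩
instance : Neg CbrtSeven := ⟨fun x => ⟨-x.a, -x.b, -x.c⟩⟩
instance : Mul CbrtSeven := ⟨fun x y => ⟨x.a * y.a + 7 * (x.b * y.c + x.c * y.b),
  x.a * y.b + x.b * y.a + 7 * (x.c * y.c), x.a * y.c + x.b * y.b + x.c * y.a⟩⟩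

@[simp] theorem zero_a : (0 : CbrtSeven).a = 0 := rfl
@[simp] theorem zero_b : (0 : CbrtSeven).b = 0 := rfl
@[simp] theorem zero_c : (0 : CbrtSeven).c = 0 := rfl
@[simp] theorem one_a : (1 : CbrtSeven).a = 1 := rfl
@[simp] theorem one_b : (1 : CbrtSeven).b = 0 := rfl
@[simp] theorem one_c : (1 : CbrtSeven).c = 0 := rfl
@[simp] theorem add_a (x y : CbrtSeven) : (x + y).a = x.a + y.a := rfl
@[simp] theorem add_b (x y : CbrtSeven) : (x + y).b = x.b + y.b := rfl
@[simp] theorem add_c (x y : CbrtSeven) : (x + y).c = x.c + y.c := rfl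
@[simp] theorem neg_a (x : CbrtSeven) : (-x).a = -x.a := rfl
@[simp] theorem neg_b (x : CbrtSeven) : (-x).b = -x.b := rfl
@[simp] theorem neg_c (x : CbrtSeven) : (-x).c = -x.c := rfl
@[simp] theorem mul_a (x y : CbrtSeven) :
    (x * y).a = x.a * y.a + 7 * (x.b * y.c + x.c * y.b) := rfl
@[simp] theorem mul_b (x y : CbrtSeven) :
    (x * y).b = x.a * y.b + x.b * y.a + 7 * (x.c * y.c) := rfl
@[simp] theorem mul_c (x y : CbrtSeven) :
    (x * y).c = x.a * y.c + x.b * y.b + x.c * y.a := rfl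

instance : CommRing CbrtSeven where
  add_assoc x y z := by ext <;> simp <;> ring
  zero_add x := by ext <;> simp
  add_zero x := by ext <;> simp
  add_comm x y := by ext <;> simp <;> ring
  neg_add_cancel x := by ext <;> simp
  mul_assoc x y z := by ext <;> simp <;> ring
  one_mul x := by ext <;> simp
  mul_one x := by ext <;> simp
  left_distrib x y z := by ext <;> simp <;> ring
  right_distrib x y z := by ext <;> simp <;> ring
  mul_comm x y := by ext <;> simp <;> ring
  zero_mul x := by ext <;> simp
  mul_zero x := by ext <;> simp
  nsmul := nsmulRec
  zsmul := zsmulRec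

/-- The coefficient of `θ`. -/
def coeffB : CbrtSeven →+ ℤ := ⟨⟨b, rfl⟩, fun _ _ => rfl⟩

/-- The coefficient of `θ²`. -/
def coeffC : CbrtSeven →+ ℤ := ⟨⟨c, rfl⟩, fun _ _ => rfl⟩

/-- The norm of `ℤ[θ]` over `ℤ`. -/
def norm : CbrtSeven →* ℤ where
  toFun x := x.a ^ 3 + 7 * x.b ^ 3 + 49 * x.c ^ 3 - 21 * x.a * x.b * x.c
  map_one' := by simp
  map_mul' x y := by simp; ring

/-- The embedding sending `θ` to the real cube root `t` of `7`. -/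
noncomputable def toReal (t : ℝ) (ht : t ^ 3 = 7) : CbrtSeven →+* ℝ where
  toFun x := x.a + x.b * t + x.c * t ^ 2
  map_one' := by simp
  map_zero' := by simp
  map_add' x y := by simp; ring
  map_mul' x y := by
    simp
    linear_combination (-(x.b * y.c + x.c * y.b : ℝ) - x.c * y.c * t) * ht

/-- The unit `2 - θ`. -/
def unit : CbrtSevenˣ := ⟨⟨2, -1, 0⟩, ⟨4, 2, 1⟩, by ext <;> simp, by ext <;> simp⟩

theorem norm_unit_zpow (n : ℤ) : norm (unit ^ n : CbrtSevenˣ) = 1 := by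
  have h : Units.map norm unit = 1 := by
    ext
    simp [norm, unit]
  rw [← Units.coe_map norm, map_zpow, h, one_zpow, Units.val_one]

theorem exists_reduced {α : CbrtSeven} (h0 : 0 < norm α) (h8 : norm α ≤ 8) :
    ∃ β : CbrtSeven, ∃ n : ℤ, α = β * (unit ^ n : CbrtSevenˣ) ∧ norm β = norm α ∧
      (-2 ≤ β.a ∧ β.a ≤ 4) ∧ (-1 ≤ β.b ∧ β.b ≤ 2) ∧ (0 ≤ β.c ∧ β.c ≤ 1) := by
  obtain ⟨t, ht0, ht⟩ : ∃ t : ℝ, 0 ≤ t ∧ t ^ 3 = 7 :=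
    ⟨7 ^ ((1 : ℝ) / 3), by positivity, by rw [← Real.rpow_natCast, ← Real.rpow_mul] <;> norm_num⟩
  have ht1 : 1.912 < t := lt_of_pow_lt_pow_left₀ 3 ht0 (by rw [ht]; norm_num)
  have ht2 : t < 1.913 := lt_of_pow_lt_pow_left₀ 3 (by norm_num) (by rw [ht]; norm_num)
  have hsplit : ∀ x : CbrtSeven, (norm x : ℝ) = toReal t ht x *
      ((x.a - x.b * t) ^ 2 + (x.a - x.c * t ^ 2) ^ 2 -
        (x.a - x.b * t) * (x.a - x.c * t ^ 2)) := by
    intro x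
    simp only [norm, toReal, MonoidHom.coe_mk, OneHom.coe_mk, RingHom.coe_mk]
    push_cast
    linear_combination (-(x.b : ℝ) ^ 3 - x.c ^ 3 * (t ^ 3 + 7) + 3 * x.a * x.b * x.c) * ht
  have hpos : ∀ x : CbrtSeven, 0 < norm x → 0 < toReal t ht x := by
    intro x hx
    have h1 : (0 : ℝ) < norm x := by exact_mod_cast hx
    rw [hsplit] at h1
    refine pos_of_mul_pos_left h1 ?_
    nlinarith [sq_nonneg ((x.a - x.b * t) - (x.a - x.c * t ^ 2)), sq_nonneg (x.a - x.b * t),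
      sq_nonneg (x.a - x.c * t ^ 2)]
  have hu : toReal t ht (unit⁻¹ : CbrtSevenˣ) = 4 + 2 * t + t ^ 2 := by
    simp [toReal, unit]
  obtain ⟨n, hn1, hn2⟩ := exists_mem_Ico_zpow (x := toReal t ht α / 0.6)
    (y := toReal t ht (unit⁻¹ : CbrtSevenˣ)) (div_pos (hpos α h0) (by norm_num))
    (by rw [hu]; nlinarith)
  have hmap : ∀ k : ℤ, toReal t ht (unit⁻¹ : CbrtSevenˣ) ^ k =
      toReal t ht ((unit⁻¹ ^ k : CbrtSevenˣ) : CbrtSeven) := by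
    intro k
    have h := map_zpow (Units.map (toReal t ht : CbrtSeven →* ℝ)) unit⁻¹ k
    have h' := congrArg Units.val h
    rw [Units.val_zpow_eq_zpow_val] at h'
    exact h'.symm
  set β : CbrtSeven := α * (unit ^ n : CbrtSevenˣ) with hβ
  have hβs : toReal t ht β = toReal t ht α / toReal t ht (unit⁻¹ : CbrtSevenˣ) ^ n := by
    rw [hβ, map_mul, div_eq_mul_inv, ← zpow_neg, hmap, inv_zpow', neg_neg]
  have hy : 0 < toReal t ht (unit⁻¹ : CbrtSevenˣ) := by rw [hu]; positivity
  have hlo : 0.6 ≤ toReal t ht β := by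
    rw [hβs, le_div_iff₀ (zpow_pos hy n)]
    rw [le_div_iff₀ (by norm_num)] at hn1
    linarith
  have hhi : toReal t ht β < 6.9 := by
    rw [hβs, div_lt_iff₀ (zpow_pos hy n)]
    rw [div_lt_iff₀ (by norm_num), zpow_add_one₀ hy.ne'] at hn2
    have h1 : toReal t ht (unit⁻¹ : CbrtSevenˣ) < 11.5 := by rw [hu]; nlinarith
    nlinarith [zpow_pos hy n]
  have hNβ : norm β = norm α := by rw [hβ, map_mul, norm_unit_zpow, mul_one]
  have hN8 : (norm β : ℝ) ≤ 8 := by exact_mod_cast hNβ ▸ h8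
  rw [hsplit] at hN8
  have hs : toReal t ht β = β.a + β.b * t + β.c * t ^ 2 := rfl
  set s := toReal t ht β
  set D := (β.a : ℝ) - β.b * t with hD
  set E := (β.a : ℝ) - β.c * t ^ 2 with hE
  have hQ : D ^ 2 + E ^ 2 - D * E ≤ 13.34 := by
    by_contra hcon
    nlinarith
  have ha := abs_le_of_sq_le_sq' (a := D + E) (b := 7.31) (by nlinarith [sq_nonneg (D - E)])
    (by norm_num)
  have hb := abs_le_of_sq_le_sq' (a := E - 2 * D) (b := 7.31) (by nlinarith [sq_nonneg E])
    (by norm_num)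
  have hc := abs_le_of_sq_le_sq' (a := D - 2 * E) (b := 7.31) (by nlinarith [sq_nonneg D])
    (by norm_num)
  have hbt : 3 * (β.b * t) = s + (E - 2 * D) := by rw [hs, hD, hE]; ring
  have hct : 3 * (β.c * t ^ 2) = s + (D - 2 * E) := by rw [hs, hD, hE]; ring
  have ht3 : 3.65 < t ^ 2 := by nlinarith
  have hlow : ∀ (z : ℤ) (k : ℤ), (k : ℝ) - 1 < z → k ≤ z := fun z k h => by
    have : k - 1 < z := by exact_mod_cast h
    omega
  have hupp : ∀ (z : ℤ) (k : ℤ), (z : ℝ) < k + 1 → z ≤ k := fun z k h => by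
    have : z < k + 1 := by exact_mod_cast h
    omega
  refine ⟨β, -n, ?_, hNβ, ⟨hlow _ _ ?_, hupp _ _ ?_⟩, ⟨hlow _ _ ?_, hupp _ _ ?_⟩,
    ⟨hlow _ _ ?_, hupp _ _ ?_⟩⟩
  · rw [hβ, mul_assoc, ← Units.val_mul, ← zpow_add, add_neg_cancel, zpow_zero, Units.val_one,
      mul_one]
  · push_cast; linarith
  · push_cast; linarith
  · push_cast
    by_contra! hcon
    have := mul_le_mul_of_nonneg_right hcon ht0
    linarith
  · push_cast
    by_contra! hcon
    have := mul_le_mul_of_nonneg_right hcon ht0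
    linarith
  · push_cast
    by_contra! hcon
    have := mul_le_mul_of_nonneg_right hcon (sq_nonneg t)
    linarith
  · push_cast
    by_contra! hcon
    have := mul_le_mul_of_nonneg_right hcon (sq_nonneg t)
    linarith

end CbrtSeven

namespace CbrtSeven

theorem val_unit : ((unit : CbrtSevenˣ) : CbrtSeven) = ⟨2, -1, 0⟩ := rfl

theorem val_unit_pow_three : ((unit ^ 3 : CbrtSevenˣ) : CbrtSeven) = ⟨1, -12, 6⟩ := by
  rw [Units.val_pow_eq_pow_val, val_unit]
  ext <;> simp [pow_succ]

theorem val_unit_pow_three_inv : (((unit ^ 3)⁻¹ : CbrtSevenˣ) : CbrtSeven) = ⟨505, 264, 138⟩ := by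
  rw [← inv_pow, Units.val_pow_eq_pow_val, show ((unit⁻¹ : CbrtSevenˣ) : CbrtSeven) = ⟨4, 2, 1⟩
    from rfl]
  ext <;> simp [pow_succ]

theorem val_unit_pow_twelve :
    ((unit ^ 12 : CbrtSevenˣ) : CbrtSeven) = ⟨1512001, -288840, -262200⟩ := by
  rw [show 12 = 3 * 4 by norm_num, pow_mul, Units.val_pow_eq_pow_val, val_unit_pow_three]
  ext <;> simp [pow_succ]

theorem val_unit_pow_twelve_inv : (((unit ^ 12)⁻¹ : CbrtSevenˣ) : CbrtSeven) =
    ⟨1756010088001, 917968248840, 479875207800⟩ := by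
  rw [show 12 = 3 * 4 by norm_num, pow_mul, ← inv_pow, Units.val_pow_eq_pow_val,
    val_unit_pow_three_inv]
  ext <;> simp [pow_succ]

theorem intCast_mul (n : ℤ) (x : CbrtSeven) :
    (n : CbrtSeven) * x = ⟨n * x.a, n * x.b, n * x.c⟩ := by
  rw [← zsmul_eq_mul]
  ext
  · exact map_zsmul (⟨⟨a, rfl⟩, fun _ _ => rfl⟩ : CbrtSeven →+ ℤ) n x
  · exact map_zsmul coeffB n x
  · exact map_zsmul coeffC n x

theorem eq_zero_of_coeffB_eq_zero {β : CbrtSeven} {n : ℤ} (hβ : coeffB β = 0)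
    (h : coeffB (β * ((unit ^ 3) ^ n : CbrtSevenˣ)) = 0)
    (h1 : IsCoprime 3 (coeffB (β * ⟨0, -4, 2⟩))) (h2 : IsCoprime 3 (coeffB (β * ⟨168, 88, 46⟩))) :
    n = 0 := by
  have e1 := intCast_mul 3 ⟨0, -4, 2⟩
  have e2 := intCast_mul 3 ⟨168, 88, 46⟩
  push_cast at e1 e2
  refine zpow_exponent_eq_zero_of_map_eq_zero coeffB (u := unit ^ 3) (h := 1) (A := ⟨0, -4, 2⟩)
    (A' := ⟨168, 88, 46⟩) one_pos ?_ ?_ hβ (by norm_num; exact h1) (by norm_num; exact h2) h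
  · rw [val_unit_pow_three]
    norm_num
    rw [e1]
    ext <;> simp
  · rw [val_unit_pow_three_inv]
    norm_num
    rw [e2]
    ext <;> simp

theorem eq_of_cube_sub_fortynine_mul_cube_eq_eight {x y : ℤ} (h : x ^ 3 - 49 * y ^ 3 = 8) :
    y = 0 ∨ y = 3 := by
  have hN : norm ⟨x, 0, -y⟩ = 8 := by
    simp only [norm, MonoidHom.coe_mk, OneHom.coe_mk]
    linarith
  obtain ⟨⟨a, b, c⟩, n, hα, hβ, ha, hb, hc⟩ := exists_reduced (α := ⟨x, 0, -y⟩) (by omega) (by omega)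
  rw [hN] at hβ
  simp only [norm, MonoidHom.coe_mk, OneHom.coe_mk] at hβ
  dsimp only at ha hb hc
  have hbox : ∀ a ∈ Finset.Icc (-2 : ℤ) 4, ∀ b ∈ Finset.Icc (-1 : ℤ) 2, ∀ c ∈ Finset.Icc (0 : ℤ) 1,
      a ^ 3 + 7 * b ^ 3 + 49 * c ^ 3 - 21 * a * b * c = 8 →
      (a = 1 ∧ b = 1 ∧ c = 0) ∨ (a = 2 ∧ b = 0 ∧ c = 0) := by decide
  have hu3 : ((3 : ℤ) : CbrtSeven) ∣ (unit ^ 3 : CbrtSevenˣ) - 1 := by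
    refine ⟨⟨0, -4, 2⟩, ?_⟩
    rw [intCast_mul, val_unit_pow_three, sub_eq_add_neg]
    ext <;> simp
  have hn : ((unit ^ n : CbrtSevenˣ) : CbrtSeven) =
      ((unit ^ (n % 3) : CbrtSevenˣ) : CbrtSeven) * ((unit ^ 3) ^ (n / 3) : CbrtSevenˣ) := by
    rw [← Units.val_mul]
    congr 1
    rw [← zpow_natCast, ← zpow_mul, ← zpow_add]
    congr 1
    push_cast
    omega
  have hr : n % 3 = 0 ∨ n % 3 = 1 ∨ n % 3 = 2 := by omega
  have hα0 : coeffB ⟨x, 0, -y⟩ = 0 := rfl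
  rw [hα, hn, ← mul_assoc] at hα0
  have hdvd := dvd_map_of_dvd_map_mul_zpow coeffB hu3 (hα0 ▸ dvd_zero 3)
  rw [hn, ← mul_assoc] at hα
  have v2 : ((unit ^ (2 : ℤ) : CbrtSevenˣ) : CbrtSeven) = ⟨4, -4, 1⟩ := by
    rw [show (2 : ℤ) = (2 : ℕ) by rfl, zpow_natCast, Units.val_pow_eq_pow_val, val_unit]
    ext <;> simp [pow_succ]
  rcases hbox a (by simpa using ha) b (by simpa using hb) c (by simpa using hc) hβ with
    ⟨rfl, rfl, rfl⟩ | ⟨rfl, rfl, rfl⟩ <;> rcases hr with hr | hr | hr <;>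
    rw [hr] at hα hα0 hdvd <;>
    simp only [zpow_zero, zpow_one, Units.val_one, mul_one, val_unit, v2] at hα hα0 hdvd
  · exact absurd hdvd (by decide)
  · exact absurd hdvd (by decide)
  · have h0 := eq_zero_of_coeffB_eq_zero (by rfl) hα0 (by decide) (by decide)
    rw [h0] at hα
    have := congrArg c hα
    simp at this
    right; omega
  · have h0 := eq_zero_of_coeffB_eq_zero (by rfl) hα0 (by decide) (by decide)
    rw [h0] at hα
    have := congrArg c hα
    simp at this
    left; omega
  · exact absurd hdvd (by decide)
  · exact absurd hdvd (by decide)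

theorem eq_one_of_cube_sub_seven_mul_cube_eq {x y : ℤ} (h : x ^ 3 - 7 * y ^ 3 = -6) :
    x = 1 := by
  have hN : norm ⟨-x, y, 0⟩ = 6 := by
    simp only [norm, MonoidHom.coe_mk, OneHom.coe_mk]
    linarith
  obtain ⟨⟨a, b, c⟩, n, hα, hβ, ha, hb, hc⟩ := exists_reduced (α := ⟨-x, y, 0⟩) (by omega) (by omega)
  rw [hN] at hβ
  simp only [norm, MonoidHom.coe_mk, OneHom.coe_mk] at hβ
  dsimp only at ha hb hc
  have hbox : ∀ a ∈ Finset.Icc (-2 : ℤ) 4, ∀ b ∈ Finset.Icc (-1 : ℤ) 2, ∀ c ∈ Finset.Icc (0 : ℤ) 1,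
      a ^ 3 + 7 * b ^ 3 + 49 * c ^ 3 - 21 * a * b * c = 6 →
      (a = -1 ∧ b = 1 ∧ c = 0) ∨ (a = 3 ∧ b = 2 ∧ c = 1) := by decide
  obtain ⟨k, hk⟩ : ∃ k : ℤ, (⟨-x, y, 0⟩ : CbrtSeven) = ⟨-1, 1, 0⟩ * (unit ^ k : CbrtSevenˣ) := by
    rcases hbox a (by simpa using ha) b (by simpa using hb) c (by simpa using hc) hβ with
      ⟨rfl, rfl, rfl⟩ | ⟨rfl, rfl, rfl⟩
    · exact ⟨n, hα⟩
    · refine ⟨-1 + n, ?_⟩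
      rw [hα, zpow_add, Units.val_mul, ← mul_assoc, zpow_neg_one]
      congr 1
  have hu : ((15 : ℤ) : CbrtSeven) ∣ (unit ^ 12 : CbrtSevenˣ) - 1 := by
    refine ⟨⟨100800, -19256, -17480⟩, ?_⟩
    rw [intCast_mul, val_unit_pow_twelve, sub_eq_add_neg]
    ext <;> simp
  obtain ⟨i, j, hi, rfl⟩ : ∃ (i : ℕ) (j : ℤ), i < 12 ∧ k = i + 12 * j :=
    ⟨(k % 12).toNat, k / 12, by omega, by omega⟩
  have hn : ((unit ^ (i + 12 * j : ℤ) : CbrtSevenˣ) : CbrtSeven) =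
      (⟨2, -1, 0⟩ : CbrtSeven) ^ i * ((unit ^ 12) ^ j : CbrtSevenˣ) := by
    rw [zpow_add, zpow_natCast, Units.val_mul, Units.val_pow_eq_pow_val, val_unit, zpow_mul]
    rfl
  have hα0 : coeffC ⟨-x, y, 0⟩ = 0 := rfl
  rw [hk, hn, ← mul_assoc] at hα0
  have hdvd := dvd_map_of_dvd_map_mul_zpow coeffC hu (hα0 ▸ dvd_zero 15)
  rw [hn, ← mul_assoc] at hk
  have hi0 : i = 0 := by
    interval_cases i
    · rfl
    all_goals
      exfalso
      revert hdvd
      simp only [coeffC, AddMonoidHom.coe_mk, ZeroHom.coe_mk, pow_succ, pow_zero]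
      simp
      try decide
  rw [hi0, pow_zero, mul_one] at hk hα0
  have e1 := intCast_mul 5 ⟨302400, -57768, -52440⟩
  have e2 := intCast_mul 5 ⟨351202017600, 183593649768, 95975041560⟩
  push_cast at e1 e2
  have h0 := zpow_exponent_eq_zero_of_map_eq_zero coeffC (u := unit ^ 12) (h := 2)
    (A := ⟨302400, -57768, -52440⟩) (A' := ⟨351202017600, 183593649768, 95975041560⟩)
    two_pos (by
      rw [val_unit_pow_twelve]
      norm_num
      rw [e1]
      ext <;> simp) (by
      rw [val_unit_pow_twelve_inv]
      norm_num
      rw [e2]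
      ext <;> simp) (by rfl) (by norm_num [coeffC]) (by norm_num [coeffC]) hα0
  rw [h0] at hk
  have := congrArg CbrtSeven.a hk
  simp at this
  omega

end CbrtSeven

/-- The ring `ℤ[θ]` with `θ⁴ = 6`; the element `⟨a, b, c, d⟩` is `a + b θ + c θ² + d θ³`. -/
@[ext]
structure FourthRootSix where
  a : ℤ
  b : ℤ
  c : ℤ
  d : ℤ

namespace FourthRootSix

instance : Zero FourthRootSix := ⟨⟨0, 0, 0, 0⟩⟩
instance : One FourthRootSix := ⟨⟨1, 0, 0, 0⟩⟩
instance : Add FourthRootSix := ⟨fun x y => ⟨x.a + y.a, x.b + y.b, x.c + y.c, x.d + y.d⟩⟩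
instance : Neg FourthRootSix := ⟨fun x => ⟨-x.a, -x.b, -x.c, -x.d⟩⟩
instance : Mul FourthRootSix := ⟨fun x y =>
  ⟨x.a * y.a + 6 * (x.b * y.d + x.c * y.c + x.d * y.b),
  x.a * y.b + x.b * y.a + 6 * (x.c * y.d + x.d * y.c),
  x.a * y.c + x.b * y.b + x.c * y.a + 6 * (x.d * y.d),
  x.a * y.d + x.b * y.c + x.c * y.b + x.d * y.a⟩⟩

@[simp] theorem zero_a : (0 : FourthRootSix).a = 0 := rfl
@[simp] theorem zero_b : (0 : FourthRootSix).b = 0 := rfl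
@[simp] theorem zero_c : (0 : FourthRootSix).c = 0 := rfl
@[simp] theorem zero_d : (0 : FourthRootSix).d = 0 := rfl
@[simp] theorem one_a : (1 : FourthRootSix).a = 1 := rfl
@[simp] theorem one_b : (1 : FourthRootSix).b = 0 := rfl
@[simp] theorem one_c : (1 : FourthRootSix).c = 0 := rfl
@[simp] theorem one_d : (1 : FourthRootSix).d = 0 := rfl
@[simp] theorem add_a (x y : FourthRootSix) : (x + y).a = x.a + y.a := rfl
@[simp] theorem add_b (x y : FourthRootSix) : (x + y).b = x.b + y.b := rfl
@[simp] theorem add_c (x y : FourthRootSix) : (x + y).c = x.c + y.c := rfl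
@[simp] theorem add_d (x y : FourthRootSix) : (x + y).d = x.d + y.d := rfl
@[simp] theorem neg_a (x : FourthRootSix) : (-x).a = -x.a := rfl
@[simp] theorem neg_b (x : FourthRootSix) : (-x).b = -x.b := rfl
@[simp] theorem neg_c (x : FourthRootSix) : (-x).c = -x.c := rfl
@[simp] theorem neg_d (x : FourthRootSix) : (-x).d = -x.d := rfl
@[simp] theorem mul_a (x y : FourthRootSix) :
    (x * y).a = x.a * y.a + 6 * (x.b * y.d + x.c * y.c + x.d * y.b) := rfl
@[simp] theorem mul_b (x y : FourthRootSix) :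
    (x * y).b = x.a * y.b + x.b * y.a + 6 * (x.c * y.d + x.d * y.c) := rfl
@[simp] theorem mul_c (x y : FourthRootSix) :
    (x * y).c = x.a * y.c + x.b * y.b + x.c * y.a + 6 * (x.d * y.d) := rfl
@[simp] theorem mul_d (x y : FourthRootSix) :
    (x * y).d = x.a * y.d + x.b * y.c + x.c * y.b + x.d * y.a := rfl

instance : CommRing FourthRootSix where
  add_assoc x y z := by ext <;> simp <;> ring
  zero_add x := by ext <;> simp
  add_zero x := by ext <;> simp
  add_comm x y := by ext <;> simp <;> ring
  neg_add_cancel x := by ext <;> simp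
  mul_assoc x y z := by ext <;> simp <;> ring
  one_mul x := by ext <;> simp
  mul_one x := by ext <;> simp
  left_distrib x y z := by ext <;> simp <;> ring
  right_distrib x y z := by ext <;> simp <;> ring
  mul_comm x y := by ext <;> simp <;> ring
  zero_mul x := by ext <;> simp
  mul_zero x := by ext <;> simp
  nsmul := nsmulRec
  zsmul := zsmulRec

/-- The coefficient of `θ²`. -/
def coeffC : FourthRootSix →+ ℤ := ⟨⟨c, rfl⟩, fun _ _ => rfl⟩

/-- The coefficient of `θ³`. -/
def coeffD : FourthRootSix →+ ℤ := ⟨⟨d, rfl⟩, fun _ _ => rfl⟩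

theorem intCast_mul (n : ℤ) (x : FourthRootSix) :
    (n : FourthRootSix) * x = ⟨n * x.a, n * x.b, n * x.c, n * x.d⟩ := by
  rw [← zsmul_eq_mul]
  ext
  · exact map_zsmul (⟨⟨a, rfl⟩, fun _ _ => rfl⟩ : FourthRootSix →+ ℤ) n x
  · exact map_zsmul (⟨⟨b, rfl⟩, fun _ _ => rfl⟩ : FourthRootSix →+ ℤ) n x
  · exact map_zsmul coeffC n x
  · exact map_zsmul coeffD n x

/-- The automorphism sending `θ` to `-θ`. -/
def conj : FourthRootSix →+* FourthRootSix where
  toFun x := ⟨x.a, -x.b, x.c, -x.d⟩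
  map_one' := by ext <;> simp
  map_zero' := by ext <;> simp
  map_add' x y := by ext <;> simp <;> ring
  map_mul' x y := by ext <;> simp <;> ring

/-- The embedding sending `θ` to a real fourth root `t` of `6`. -/
noncomputable def toReal (t : ℝ) (ht : t ^ 4 = 6) : FourthRootSix →+* ℝ where
  toFun x := x.a + x.b * t + x.c * t ^ 2 + x.d * t ^ 3
  map_one' := by simp
  map_zero' := by simp
  map_add' x y := by simp; ring
  map_mul' x y := by
    simp
    linear_combination (-(x.b * y.d + x.c * y.c + x.d * y.b : ℝ) -
      (x.c * y.d + x.d * y.c) * t - x.d * y.d * t ^ 2) * ht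

/-- The unit `5 + 2 θ²`. -/
def pellUnit : FourthRootSixˣ :=
  ⟨⟨5, 0, 2, 0⟩, ⟨5, 0, -2, 0⟩, by ext <;> simp, by ext <;> simp⟩

/-- The unit `53 + 34 θ + 22 θ² + 14 θ³` of relative norm `1` over `ℤ[θ²]`. -/
def relUnit : FourthRootSixˣ :=
  ⟨⟨53, 34, 22, 14⟩, ⟨53, -34, 22, -14⟩, by ext <;> simp, by ext <;> simp⟩

theorem conj_pellUnit_zpow (n : ℤ) :
    conj (pellUnit ^ n : FourthRootSixˣ) = (pellUnit ^ n : FourthRootSixˣ) := by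
  have h : Units.map (conj : FourthRootSix →* FourthRootSix) pellUnit = pellUnit := by
    ext <;> simp [conj, pellUnit]
  have h' := congrArg Units.val
    (map_zpow (Units.map (conj : FourthRootSix →* FourthRootSix)) pellUnit n)
  rw [h] at h'
  exact h'

theorem conj_relUnit_zpow (n : ℤ) :
    conj (relUnit ^ n : FourthRootSixˣ) = (relUnit ^ (-n) : FourthRootSixˣ) := by
  have h : Units.map (conj : FourthRootSix →* FourthRootSix) relUnit = relUnit⁻¹ := by
    ext <;> simp [conj, relUnit]
  have h' := congrArg Units.val
    (map_zpow (Units.map (conj : FourthRootSix →* FourthRootSix)) relUnit n)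
  rw [h, inv_zpow'] at h'
  exact h'

set_option maxHeartbeats 800000 in
theorem exists_reduced {α : FourthRootSix} (h : α * conj α = ⟨1, 0, -1, 0⟩) :
    ∃ β : FourthRootSix, ∃ n : ℤ, α = β * (relUnit ^ n : FourthRootSixˣ) ∧
      β * conj β = ⟨1, 0, -1, 0⟩ ∧
      (-5 ≤ β.a ∧ β.a ≤ 5) ∧ (-3 ≤ β.b ∧ β.b ≤ 3) ∧ (-2 ≤ β.c ∧ β.c ≤ 2) ∧
      (-1 ≤ β.d ∧ β.d ≤ 1) := by
  obtain ⟨t, ht0, ht⟩ : ∃ t : ℝ, 0 ≤ t ∧ t ^ 4 = 6 :=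
    ⟨6 ^ ((1 : ℝ) / 4), by positivity, by rw [← Real.rpow_natCast, ← Real.rpow_mul] <;> norm_num⟩
  have ht1 : 1.565 < t := lt_of_pow_lt_pow_left₀ 4 ht0 (by rw [ht]; norm_num)
  have ht2 : t < 1.5651 := lt_of_pow_lt_pow_left₀ 4 (by norm_num) (by rw [ht]; norm_num)
  have hs1 : 2.449 < t ^ 2 := by nlinarith
  have hs2 : t ^ 2 < 2.45 := by nlinarith
  have hc1 : 3.832 < t ^ 3 := by nlinarith
  have hc2 : t ^ 3 < 3.835 := by nlinarith
  have hsplit : ∀ x : FourthRootSix, x * conj x = ⟨1, 0, -1, 0⟩ →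
      toReal t ht x * toReal t ht (conj x) = 1 - t ^ 2 := by
    intro x hx
    rw [← map_mul, hx]
    simp [toReal]
    ring
  have hne : ∀ x : FourthRootSix, x * conj x = ⟨1, 0, -1, 0⟩ → toReal t ht x ≠ 0 := by
    intro x hx h0
    have := hsplit x hx
    rw [h0] at this
    nlinarith
  have hu : toReal t ht (relUnit : FourthRootSixˣ) = 53 + 34 * t + 22 * t ^ 2 + 14 * t ^ 3 := by
    simp [toReal, relUnit]
  obtain ⟨n, hn1, hn2⟩ := exists_mem_Ico_zpow (x := |toReal t ht α| / 0.083)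
    (y := toReal t ht (relUnit : FourthRootSixˣ))
    (div_pos (abs_pos.2 (hne α h)) (by norm_num)) (by rw [hu]; nlinarith)
  have hmap : ∀ k : ℤ, toReal t ht (relUnit : FourthRootSixˣ) ^ k =
      toReal t ht ((relUnit ^ k : FourthRootSixˣ) : FourthRootSix) := by
    intro k
    have h := map_zpow (Units.map (toReal t ht : FourthRootSix →* ℝ)) relUnit k
    have h' := congrArg Units.val h
    rw [Units.val_zpow_eq_zpow_val] at h'
    exact h'.symm
  set β : FourthRootSix := α * (relUnit ^ (-n) : FourthRootSixˣ) with hβ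
  have hy : 0 < toReal t ht (relUnit : FourthRootSixˣ) := by rw [hu]; positivity
  have hβs : |toReal t ht β| = |toReal t ht α| / toReal t ht (relUnit : FourthRootSixˣ) ^ n := by
    rw [hβ, map_mul, ← hmap, abs_mul, abs_of_pos (zpow_pos hy _), zpow_neg, div_eq_mul_inv]
  have hlo : 0.083 ≤ |toReal t ht β| := by
    rw [hβs, le_div_iff₀ (zpow_pos hy n)]
    rw [le_div_iff₀ (by norm_num)] at hn1
    linarith
  have hhi : |toReal t ht β| < 17.8 := by
    rw [hβs, div_lt_iff₀ (zpow_pos hy n)]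
    rw [div_lt_iff₀ (by norm_num), zpow_add_one₀ hy.ne'] at hn2
    have h1 : toReal t ht (relUnit : FourthRootSixˣ) < 214 := by rw [hu]; linarith
    nlinarith [zpow_pos hy n]
  have hNβ : β * conj β = ⟨1, 0, -1, 0⟩ := by
    rw [hβ, map_mul, conj_relUnit_zpow, ← h, mul_mul_mul_comm, ← Units.val_mul, ← zpow_add]
    simp
  have hP : (β.a : ℝ) ^ 2 + 6 * β.c ^ 2 - 12 * β.b * β.d = 1 := by
    have := congrArg FourthRootSix.a hNβ
    simp [conj] at this
    have h' : β.a ^ 2 + 6 * β.c ^ 2 - 12 * β.b * β.d = 1 := by linarith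
    exact_mod_cast h'
  have hQ : 2 * (β.a : ℝ) * β.c - β.b ^ 2 - 6 * β.d ^ 2 = -1 := by
    have := congrArg FourthRootSix.c hNβ
    simp [conj] at this
    have h' : 2 * β.a * β.c - β.b ^ 2 - 6 * β.d ^ 2 = -1 := by linarith
    exact_mod_cast h'
  have hprod := hsplit β hNβ
  have e1 : toReal t ht β = β.a + β.b * t + β.c * t ^ 2 + β.d * t ^ 3 := rfl
  have e2 : toReal t ht (conj β) = β.a - β.b * t + β.c * t ^ 2 - β.d * t ^ 3 := by
    simp [toReal, conj]
    ring
  set σ := toReal t ht β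
  set τ := toReal t ht (conj β)
  have hτ : |τ| < 17.8 := by
    have h1 : |σ| * |τ| = t ^ 2 - 1 := by
      rw [← abs_mul, hprod, abs_of_neg (by linarith)]
      ring
    by_contra! hcon
    nlinarith
  have hsum : (σ + τ) ^ 2 ≤ 17.8 ^ 2 := by
    have h1 : σ ^ 2 ≤ 17.8 ^ 2 := sq_le_sq' (by linarith [(abs_lt.1 hhi).1]) (abs_lt.1 hhi).2.le
    have h2 : τ ^ 2 ≤ 17.8 ^ 2 := sq_le_sq' (by linarith [(abs_lt.1 hτ).1]) (abs_lt.1 hτ).2.le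
    have h3 : σ * τ < 0 := by linarith
    rcases mul_neg_iff.1 h3 with ⟨h4, h5⟩ | ⟨h4, h5⟩
    · exact sq_le_sq' (by linarith [(abs_lt.1 hτ).1]) (by linarith [(abs_lt.1 hhi).2])
    · exact sq_le_sq' (by linarith [(abs_lt.1 hhi).1]) (by linarith [(abs_lt.1 hτ).2])
  have hdiff : (σ - τ) ^ 2 ≤ 17.97 ^ 2 := by nlinarith
  have hcirc : (β.a - β.c * t ^ 2) ^ 2 + (t * (β.b - β.d * t ^ 2)) ^ 2 < 3.45 := by
    have : (β.a - β.c * t ^ 2) ^ 2 + (t * (β.b - β.d * t ^ 2)) ^ 2 = 1 + t ^ 2 := by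
      linear_combination hP - t ^ 2 * hQ +
        ((β.c : ℝ) ^ 2 - 2 * β.b * β.d + β.d ^ 2 * t ^ 2) * ht
    linarith
  have hA := abs_le_of_sq_le_sq' hsum (by norm_num)
  have hB := abs_le_of_sq_le_sq' hdiff (by norm_num)
  have hA' := abs_le_of_sq_le_sq' (a := β.a - β.c * t ^ 2) (b := 1.86)
    (by nlinarith [sq_nonneg (t * (β.b - β.d * t ^ 2))]) (by norm_num)
  have hB' := abs_le_of_sq_le_sq' (a := t * (β.b - β.d * t ^ 2)) (b := 1.86)
    (by nlinarith [sq_nonneg (β.a - β.c * t ^ 2)]) (by norm_num)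
  have hlow : ∀ (z : ℤ) (k : ℤ), (k : ℝ) - 1 < z → k ≤ z := fun z k h => by
    have : k - 1 < z := by exact_mod_cast h
    omega
  have hupp : ∀ (z : ℤ) (k : ℤ), (z : ℝ) < k + 1 → z ≤ k := fun z k h => by
    have : z < k + 1 := by exact_mod_cast h
    omega
  have ebt : 4 * (β.b * t) = (σ - τ) + 2 * (t * (β.b - β.d * t ^ 2)) := by rw [e1, e2]; ring
  have ect : 4 * (β.c * t ^ 2) = (σ + τ) - 2 * (β.a - β.c * t ^ 2) := by rw [e1, e2]; ring
  have edt : 4 * (β.d * t ^ 3) = (σ - τ) - 2 * (t * (β.b - β.d * t ^ 2)) := by rw [e1, e2]; ring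
  have eat : 4 * (β.a : ℝ) = (σ + τ) + 2 * (β.a - β.c * t ^ 2) := by rw [e1, e2]; ring
  refine ⟨β, n, ?_, hNβ, ⟨hlow _ _ ?_, hupp _ _ ?_⟩, ⟨hlow _ _ ?_, hupp _ _ ?_⟩,
    ⟨hlow _ _ ?_, hupp _ _ ?_⟩, ⟨hlow _ _ ?_, hupp _ _ ?_⟩⟩
  · rw [hβ, mul_assoc, ← Units.val_mul, ← zpow_add, neg_add_cancel, zpow_zero, Units.val_one,
      mul_one]
  · push_cast; linarith
  · push_cast; linarith
  · push_cast
    by_contra! hcon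
    have := mul_le_mul_of_nonneg_right hcon ht0
    linarith
  · push_cast
    by_contra! hcon
    have := mul_le_mul_of_nonneg_right hcon ht0
    linarith
  · push_cast
    by_contra! hcon
    have := mul_le_mul_of_nonneg_right hcon (sq_nonneg t)
    linarith
  · push_cast
    by_contra! hcon
    have := mul_le_mul_of_nonneg_right hcon (sq_nonneg t)
    linarith
  · push_cast
    by_contra! hcon
    have := mul_le_mul_of_nonneg_right hcon (pow_nonneg ht0 3)
    linarith
  · push_cast
    by_contra! hcon
    have := mul_le_mul_of_nonneg_right hcon (pow_nonneg ht0 3)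
    linarith

end FourthRootSix

namespace FourthRootSix

theorem eq_of_reduced {β : FourthRootSix} (h : β * conj β = ⟨1, 0, -1, 0⟩)
    (ha : -5 ≤ β.a ∧ β.a ≤ 5) (hb : -3 ≤ β.b ∧ β.b ≤ 3) (hc : -2 ≤ β.c ∧ β.c ≤ 2)
    (hd : -1 ≤ β.d ∧ β.d ≤ 1) :
    β = ⟨1, 1, 0, 0⟩ ∨ β = -⟨1, 1, 0, 0⟩ ∨ β = ⟨1, -1, 0, 0⟩ ∨ β = -⟨1, -1, 0, 0⟩ := by
  have hP := congrArg FourthRootSix.a h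
  have hQ := congrArg FourthRootSix.c h
  obtain ⟨a, b, c, d⟩ := β
  simp only [conj, RingHom.coe_mk, MonoidHom.coe_mk, OneHom.coe_mk, mul_a, mul_c] at hP hQ
  dsimp only at ha hb hc hd
  have hbox : ∀ c ∈ Finset.Icc (-2 : ℤ) 2, ∀ d ∈ Finset.Icc (-1 : ℤ) 1,
      ∀ a ∈ Finset.Icc (-5 : ℤ) 5, ∀ b ∈ Finset.Icc (-3 : ℤ) 3,
      a * a + 6 * (b * -d + c * c + d * -b) = 1 →
      a * c + b * -b + c * a + 6 * (d * -d) = -1 →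
      c = 0 ∧ d = 0 ∧ (a = 1 ∨ a = -1) ∧ (b = 1 ∨ b = -1) := by decide +kernel
  obtain ⟨rfl, rfl, rfl | rfl, rfl | rfl⟩ := hbox c (by simpa using hc) d (by simpa using hd) a
    (by simpa using ha) b (by simpa using hb) hP hQ
  · exact Or.inl rfl
  · exact Or.inr (Or.inr (Or.inl rfl))
  · exact Or.inr (Or.inr (Or.inr rfl))
  · exact Or.inr (Or.inl rfl)

theorem exists_pell {y : ℕ} : ∀ {x : ℕ}, 0 < x → 0 < y → x ^ 2 + 5 = 6 * y ^ 2 →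
    ∃ n : ℕ, (⟨x, 0, -y, 0⟩ : FourthRootSix) = ⟨1, 0, -1, 0⟩ * ⟨5, 0, -2, 0⟩ ^ n ∨
      (⟨x, 0, -y, 0⟩ : FourthRootSix) = ⟨-1, 0, -1, 0⟩ * ⟨5, 0, -2, 0⟩ ^ n := by
  induction y using Nat.strong_induction_on with
  | _ y ih =>
    intro x hx hy h
    rcases Nat.lt_or_ge y 5 with hlt | hge
    · have hx10 : x < 10 := by nlinarith
      have hcases : (x = 1 ∧ y = 1) ∨ (x = 7 ∧ y = 3) := by
        interval_cases y <;> interval_cases x <;> omega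
      rcases hcases with ⟨rfl, rfl⟩ | ⟨rfl, rfl⟩
      · exact ⟨0, Or.inl (by ext <;> simp)⟩
      · exact ⟨1, Or.inr (by ext <;> simp)⟩
    · have h1 : 12 * y < 5 * x := by nlinarith
      have h2 : 2 * x < 5 * y := by nlinarith
      have h3 : 2 * y < x := by nlinarith
      obtain ⟨x', hx'⟩ := Nat.exists_eq_add_of_lt h1
      obtain ⟨y', hy'⟩ := Nat.exists_eq_add_of_lt h2
      have ex : ((x' + 1 : ℕ) : ℤ) = 5 * x - 12 * y := by push_cast; omega
      have ey : ((y' + 1 : ℕ) : ℤ) = 5 * y - 2 * x := by push_cast; omega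
      have heq : (x' + 1) ^ 2 + 5 = 6 * (y' + 1) ^ 2 := by
        have : ((x' + 1 : ℕ) : ℤ) ^ 2 + 5 = 6 * ((y' + 1 : ℕ) : ℤ) ^ 2 := by
          rw [ex, ey]
          have h' : (x : ℤ) ^ 2 + 5 = 6 * (y : ℤ) ^ 2 := by exact_mod_cast h
          linear_combination h'
        exact_mod_cast this
      obtain ⟨n, hn⟩ := ih (y' + 1) (by omega) (Nat.succ_pos x') (Nat.succ_pos y') heq
      have hstep : (⟨x, 0, -y, 0⟩ : FourthRootSix) =
          ⟨(x' + 1 : ℕ), 0, -(y' + 1 : ℕ), 0⟩ * ⟨5, 0, -2, 0⟩ := by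
        rw [ex, ey]
        ext <;> simp <;> ring
      refine ⟨n + 1, hn.imp (fun hn => ?_) (fun hn => ?_)⟩ <;>
        rw [hstep, hn, pow_succ, mul_assoc]

theorem pell_pow_four_mod_eight (β : FourthRootSix) (q : ℕ) :
    ((β * ((⟨5, 0, -2, 0⟩ : FourthRootSix) ^ 4) ^ q).a - β.a) % 8 = 0 ∧
      ((β * ((⟨5, 0, -2, 0⟩ : FourthRootSix) ^ 4) ^ q).c - β.c) % 8 = 0 := by
  have h4 : (⟨5, 0, -2, 0⟩ : FourthRootSix) ^ 4 = ⟨4801, 0, -1960, 0⟩ := by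
    ext <;> simp [pow_succ]
  rw [h4]
  induction q with
  | zero => simp
  | succ q ih =>
    rw [pow_succ, ← mul_assoc]
    generalize β * (⟨4801, 0, -1960, 0⟩ : FourthRootSix) ^ q = z at ih
    simp only [mul_a, mul_c]
    omega

/-- A solution of `x² - 6 y² = -5` with `x ≡ y ≡ 1 (mod 8)`. -/
theorem exists_pell_of_mod_eight {x y : ℕ} (h : x ^ 2 + 5 = 6 * y ^ 2) (hx : x % 8 = 1)
    (hy : y % 8 = 1) :
    ∃ k : ℕ, (⟨x, 0, -y, 0⟩ : FourthRootSix) = ⟨1, 0, -1, 0⟩ * ⟨5, 0, -2, 0⟩ ^ (4 * k) := by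
  obtain ⟨n, hn⟩ := exists_pell (by omega) (by omega) h
  obtain ⟨q, i, hi, rfl⟩ : ∃ q i, i < 4 ∧ n = i + 4 * q := ⟨n / 4, n % 4, by omega, by omega⟩
  rw [pow_add, pow_mul, ← mul_assoc, ← mul_assoc] at hn
  have key : ∀ e : ℤ, (⟨x, 0, -y, 0⟩ : FourthRootSix) =
      ⟨e, 0, -1, 0⟩ * ⟨5, 0, -2, 0⟩ ^ i * (⟨5, 0, -2, 0⟩ ^ 4) ^ q → (e = 1 ∨ e = -1) →
      e = 1 ∧ i = 0 := by
    intro e he hee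
    have h1 := congrArg FourthRootSix.a he
    have h2 := congrArg FourthRootSix.c he
    have h3 := pell_pow_four_mod_eight (⟨e, 0, -1, 0⟩ * ⟨5, 0, -2, 0⟩ ^ i) q
    rw [← h1, ← h2] at h3
    dsimp only at h3
    rcases hee with rfl | rfl <;> interval_cases i <;> simp [pow_succ] at h3 <;> omega
  rcases hn with hn | hn
  · obtain ⟨-, rfl⟩ := key 1 hn (Or.inl rfl)
    exact ⟨q, by rw [hn, pow_zero, mul_one, pow_mul]⟩
  · have := (key (-1) hn (Or.inr rfl)).1
    omega

theorem val_relUnit_pow_four : ((relUnit ^ 4 : FourthRootSixˣ) : FourthRootSix) =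
    ⟨522096001, 333589640, 213144800, 136187400⟩ := by
  rw [Units.val_pow_eq_pow_val, show ((relUnit : FourthRootSixˣ) : FourthRootSix) =
    ⟨53, 34, 22, 14⟩ from rfl]
  ext <;> simp [pow_succ]

theorem val_relUnit_pow_four_inv : (((relUnit ^ 4)⁻¹ : FourthRootSixˣ) : FourthRootSix) =
    ⟨522096001, -333589640, 213144800, -136187400⟩ := by
  rw [← inv_pow, Units.val_pow_eq_pow_val,
    show ((relUnit⁻¹ : FourthRootSixˣ) : FourthRootSix) = ⟨53, -34, 22, -14⟩ from rfl]
  ext <;> simp [pow_succ]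

/-- The unit `-(5 - 2 θ²)²`, congruent to `1` modulo `5`. -/
def pellUnitSq : FourthRootSixˣ :=
  ⟨⟨-49, 0, 20, 0⟩, ⟨-49, 0, -20, 0⟩, by ext <;> simp, by ext <;> simp⟩

theorem exponents_eq_zero {f g : ℤ} {k : ℕ} {n : ℤ}
    (h : (⟨f, g, 0, 0⟩ : FourthRootSix) =
      ⟨1, 1, 0, 0⟩ * ((pellUnitSq ^ k : FourthRootSixˣ) * (relUnit ^ n : FourthRootSixˣ))) :
    k = 0 ∧ n = 0 := by
  obtain ⟨i, j, hi, rfl⟩ : ∃ (i : ℕ) (j : ℤ), i < 4 ∧ n = i + 4 * j :=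
    ⟨(n % 4).toNat, n / 4, by omega, by omega⟩
  have hn : ((relUnit ^ (i + 4 * j : ℤ) : FourthRootSixˣ) : FourthRootSix) =
      (⟨53, 34, 22, 14⟩ : FourthRootSix) ^ i * ((relUnit ^ 4) ^ j : FourthRootSixˣ) := by
    rw [zpow_add, zpow_natCast, Units.val_mul, Units.val_pow_eq_pow_val, zpow_mul]
    rfl
  have hu1 : ((5 : ℤ) : FourthRootSix) ∣ (pellUnitSq : FourthRootSixˣ) - 1 := by
    refine ⟨⟨-10, 0, 4, 0⟩, ?_⟩
    rw [intCast_mul, sub_eq_add_neg]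
    ext <;> simp [pellUnitSq]
  have hu2 : ((5 : ℤ) : FourthRootSix) ∣ (relUnit ^ 4 : FourthRootSixˣ) - 1 := by
    refine ⟨⟨104419200, 66717928, 42628960, 27237480⟩, ?_⟩
    rw [intCast_mul, val_relUnit_pow_four, sub_eq_add_neg]
    ext <;> simp
  have hdvd : ∀ φ : FourthRootSix →+ ℤ, φ ⟨f, g, 0, 0⟩ = 0 →
      5 ∣ φ (⟨1, 1, 0, 0⟩ * (⟨53, 34, 22, 14⟩ : FourthRootSix) ^ i) := by
    intro φ hφ
    refine dvd_map_of_dvd_map_mul_zpow φ hu1 (j := k) (dvd_map_of_dvd_map_mul_zpow φ hu2 (j := j) ?_)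
    rw [h, hn] at hφ
    rw [zpow_natCast]
    rw [show ∀ A B C D : FourthRootSix, A * B * C * D = A * (C * (B * D)) by intros; ring, hφ]
    exact dvd_zero 5
  have hi0 : i = 0 := by
    have h1 := hdvd coeffC rfl
    interval_cases i
    · rfl
    all_goals
      exfalso
      simp [coeffC, pow_succ] at h1
  have e0 := intCast_mul 5 ⟨-10, 0, 4, 0⟩
  have e1 := intCast_mul 5 ⟨104419200, 66717928, 42628960, 27237480⟩
  have e2 := intCast_mul 5 ⟨104419200, -66717928, 42628960, -27237480⟩
  push_cast at e0 e1 e2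
  have hp : ((pellUnitSq : FourthRootSixˣ) : FourthRootSix) =
      1 + (2 * (2 : ℕ) + 1) * ⟨-10, 0, 4, 0⟩ := by
    norm_num
    rw [e0]
    ext <;> simp [pellUnitSq]
  have hc : coeffC ⟨f, g, 0, 0⟩ = 0 := rfl
  have hd : coeffD ⟨f, g, 0, 0⟩ = 0 := rfl
  rw [h, hn, hi0, pow_zero, one_mul, Units.val_pow_eq_pow_val, hp] at hc hd
  obtain ⟨m, rfl | rfl⟩ := j.eq_nat_or_neg
  · have hr : ((relUnit ^ 4 : FourthRootSixˣ) : FourthRootSix) =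
        1 + (2 * (2 : ℕ) + 1) * ⟨104419200, 66717928, 42628960, 27237480⟩ := by
      rw [val_relUnit_pow_four]
      norm_num
      rw [e1]
      ext <;> simp
    rw [zpow_natCast, Units.val_pow_eq_pow_val, hr] at hc hd
    obtain ⟨h1, h2⟩ := exponents_eq_zero_of_map_eq_zero coeffC coeffD two_pos (by rfl) (by rfl)
      (by norm_num [coeffC, coeffD]) hc hd
    exact ⟨h1, by omega⟩
  · have hr : (((relUnit ^ 4)⁻¹ : FourthRootSixˣ) : FourthRootSix) =
        1 + (2 * (2 : ℕ) + 1) * ⟨104419200, -66717928, 42628960, -27237480⟩ := by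
      rw [val_relUnit_pow_four_inv]
      norm_num
      rw [e2]
      ext <;> simp
    rw [zpow_neg, zpow_natCast, ← inv_pow, Units.val_pow_eq_pow_val, hr] at hc hd
    obtain ⟨h1, h2⟩ := exponents_eq_zero_of_map_eq_zero coeffC coeffD two_pos (by rfl) (by rfl)
      (by norm_num [coeffC, coeffD]) hc hd
    exact ⟨h1, by omega⟩

theorem eq_one_of_eq_mul {f g : ℤ} {k : ℕ} {n : ℤ}
    (h : (⟨f, g, 0, 0⟩ : FourthRootSix) =
      ⟨1, 1, 0, 0⟩ * ((pellUnitSq ^ k : FourthRootSixˣ) * (relUnit ^ n : FourthRootSixˣ))) :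
    f = 1 := by
  obtain ⟨rfl, rfl⟩ := exponents_eq_zero h
  simpa using congrArg FourthRootSix.a h

/-- The only solutions of `f⁴ - 6 g⁴ = -5` have `f = ± 1`. -/
theorem eq_one_of_pow_four_add_five_eq {f g : ℕ} (h : f ^ 4 + 5 = 6 * g ^ 4) : f = 1 := by
  have hmod : ∀ x < 16, ∀ y < 16, (x ^ 4 + 5) % 16 = 6 * y ^ 4 % 16 →
      x % 2 = 1 ∧ y % 2 = 1 := by decide
  have hpar := hmod (f % 16) (Nat.mod_lt _ (by norm_num)) (g % 16) (Nat.mod_lt _ (by norm_num)) (by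
    have h4 := ((Nat.mod_modEq g 16).pow 4).mul_left 6
    have h5 := (((Nat.mod_modEq f 16).pow 4).add_right 5)
    rw [← h] at h4
    exact h5.trans h4.symm)
  have hsq : ∀ z : ℕ, z % 2 = 1 → z ^ 2 % 8 = 1 := by
    intro z hz
    rw [Nat.pow_mod]
    have : z % 8 = 1 ∨ z % 8 = 3 ∨ z % 8 = 5 ∨ z % 8 = 7 := by omega
    rcases this with h | h | h | h <;> rw [h]
  obtain ⟨k, hk⟩ := exists_pell_of_mod_eight (x := f ^ 2) (y := g ^ 2) (by linarith)
    (hsq f (by omega)) (hsq g (by omega))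
  set α : FourthRootSix := ⟨f, g, 0, 0⟩ * (pellUnit ^ (2 * k : ℤ) : FourthRootSixˣ) with hα
  have hinv : ((pellUnit ^ (-(2 * k) : ℤ) : FourthRootSixˣ) : FourthRootSix) =
      ⟨5, 0, -2, 0⟩ ^ (2 * k) := by
    rw [zpow_neg, ← inv_zpow, show (2 * k : ℤ) = (2 * k : ℕ) by push_cast; rfl, zpow_natCast,
      Units.val_pow_eq_pow_val]
    rfl
  have hnorm : α * conj α = ⟨1, 0, -1, 0⟩ := by
    have h1 : (⟨f, g, 0, 0⟩ : FourthRootSix) * conj ⟨f, g, 0, 0⟩ =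
        ⟨(f ^ 2 : ℕ), 0, -(g ^ 2 : ℕ), 0⟩ := by
      ext <;> simp [conj] <;> ring
    rw [hα, map_mul, conj_pellUnit_zpow, mul_mul_mul_comm, h1, hk,
      show 4 * k = 2 * k + 2 * k by ring, pow_add, ← hinv, mul_assoc, ← Units.val_mul,
      ← Units.val_mul, ← Units.val_mul, ← zpow_add, ← zpow_add, ← zpow_add]
    simp
  obtain ⟨β, n, hβ, hβN, ha, hb, hc, hd⟩ := exists_reduced hnorm
  have hfg : (⟨f, g, 0, 0⟩ : FourthRootSix) =
      (-1) ^ k * (β * ((pellUnitSq ^ k : FourthRootSixˣ) * (relUnit ^ n : FourthRootSixˣ))) := by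
    have h1 : (⟨f, g, 0, 0⟩ : FourthRootSix) = α * ⟨5, 0, -2, 0⟩ ^ (2 * k) := by
      rw [hα, ← hinv, mul_assoc, ← Units.val_mul, ← zpow_add]
      simp
    have h2 : (⟨5, 0, -2, 0⟩ : FourthRootSix) ^ 2 = -1 * (pellUnitSq : FourthRootSixˣ) := by
      ext <;> simp [pow_succ, pellUnitSq]
    rw [h1, hβ, pow_mul, h2, mul_pow, Units.val_pow_eq_pow_val]
    ring
  have hconj : ∀ e : ℤ, conj ⟨e, 0, 0, 0⟩ = ⟨e, 0, 0, 0⟩ := by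
    intro e
    ext <;> simp [conj]
  have hconjp : conj (pellUnitSq ^ k : FourthRootSixˣ) = (pellUnitSq ^ k : FourthRootSixˣ) := by
    rw [Units.val_pow_eq_pow_val, map_pow]
    congr 1
  have hneg : ∀ x y : ℤ, -(⟨x, y, 0, 0⟩ : FourthRootSix) = ⟨-x, -y, 0, 0⟩ := by
    intro x y
    ext <;> simp
  have hcfg : ∀ x y : ℤ, conj (⟨x, y, 0, 0⟩ : FourthRootSix) = ⟨x, -y, 0, 0⟩ := by
    intro x y
    ext <;> simp [conj]
  -- up to sign and conjugation `β = 1 + θ`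
  have hgen : ∀ e : FourthRootSix, (e = 1 ∨ e = -1) → ∀ γ : FourthRootSix,
      (γ = ⟨1, 1, 0, 0⟩ ∨ γ = ⟨1, -1, 0, 0⟩) → (⟨f, g, 0, 0⟩ : FourthRootSix) =
      e * (γ * ((pellUnitSq ^ k : FourthRootSixˣ) * (relUnit ^ n : FourthRootSixˣ))) → f = 1 := by
    intro e he γ hγ hEq
    have hEq' : e * (⟨f, g, 0, 0⟩ : FourthRootSix) =
        γ * ((pellUnitSq ^ k : FourthRootSixˣ) * (relUnit ^ n : FourthRootSixˣ)) := by
      rw [hEq, ← mul_assoc]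
      rcases he with rfl | rfl <;> ring
    obtain ⟨f', g', hf', hff⟩ : ∃ f' g' : ℤ, e * (⟨f, g, 0, 0⟩ : FourthRootSix) = ⟨f', g', 0, 0⟩ ∧
        (f' = 1 → f = 1) := by
      rcases he with rfl | rfl
      · exact ⟨f, g, one_mul _, fun h => by exact_mod_cast h⟩
      · exact ⟨-f, -g, by rw [neg_one_mul, hneg], fun h => by omega⟩
    rw [hf'] at hEq'
    apply hff
    rcases hγ with rfl | rfl
    · exact eq_one_of_eq_mul hEq'
    · have h3 := congrArg conj hEq'
      rw [map_mul, map_mul, hcfg, hcfg, hconjp, conj_relUnit_zpow, neg_neg] at h3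
      exact eq_one_of_eq_mul h3
  have hpow : ((-1 : FourthRootSix) ^ k = 1 ∨ (-1 : FourthRootSix) ^ k = -1) :=
    neg_one_pow_eq_or _ k
  rcases eq_of_reduced hβN ha hb hc hd with h1 | h1 | h1 | h1 <;> rw [h1] at hfg
  · exact hgen _ hpow _ (Or.inl rfl) hfg
  · exact hgen (-(-1) ^ k) (by rcases hpow with h | h <;> simp [h]) _ (Or.inl rfl)
      (by rw [hfg]; ring)
  · exact hgen _ hpow _ (Or.inr rfl) hfg
  · exact hgen (-(-1) ^ k) (by rcases hpow with h | h <;> simp [h]) _ (Or.inr rfl)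
      (by rw [hfg]; ring)

end FourthRootSix

/-- A factorisation of `c * t ^ k` into coprime factors splits `c` and `t` compatibly. -/
theorem Nat.Coprime.exists_eq_mul_pow {A B c t k : ℕ} (hAB : A.Coprime B) (hc : 0 < c)
    (h : A * B = c * t ^ k) :
    ∃ a b f g, a * b = c ∧ a.Coprime b ∧ A = a * f ^ k ∧ B = b * g ^ k ∧ t ^ k = (f * g) ^ k := by
  have hab : Nat.gcd c A * Nat.gcd c B = c := by
    rw [← Nat.Coprime.gcd_mul c hAB, h]
    exact Nat.gcd_eq_left (Dvd.intro _ rfl)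
  obtain ⟨A', hA'⟩ := Nat.gcd_dvd_right c A
  obtain ⟨B', hB'⟩ := Nat.gcd_dvd_right c B
  have hcop : A'.Coprime B' := by
    rw [hA', hB'] at hAB
    exact Nat.Coprime.coprime_mul_left_right (Nat.Coprime.coprime_mul_left hAB)
  have hprod : A' * B' = t ^ k := by
    apply Nat.eq_of_mul_eq_mul_left hc
    rw [← h]
    nth_rewrite 1 [← hab]
    nth_rewrite 2 [hA', hB']
    ring
  obtain ⟨f, hf⟩ := exists_eq_pow_of_mul_eq_pow (a := A') (b := B')
    (by rw [Nat.isUnit_iff]; exact hcop) hprod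
  obtain ⟨g, hg⟩ := exists_eq_pow_of_mul_eq_pow (a := B') (b := A')
    (by rw [Nat.isUnit_iff]; exact hcop.symm) (by rw [mul_comm]; exact hprod)
  refine ⟨_, _, f, g, hab, ?_, ?_, ?_, ?_⟩
  · exact Nat.Coprime.coprime_dvd_left (Nat.gcd_dvd_right _ _)
      (Nat.Coprime.coprime_dvd_right (Nat.gcd_dvd_right _ _) hAB)
  · rw [← hf]; exact hA'
  · rw [← hg]; exact hB'
  · rw [← hprod, hf, hg, mul_pow]

/-- Coprime nonnegative integers whose product is a square are squares. -/
theorem Int.exists_eq_sq_of_mul_eq_sq {a b c : ℤ} (ha : 0 ≤ a) (hab : IsCoprime a b)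
    (h : a * b = c ^ 2) : ∃ d, 0 ≤ d ∧ a = d ^ 2 := by
  obtain ⟨d, hd | hd⟩ := Int.sq_of_gcd_eq_one (Int.isCoprime_iff_gcd_eq_one.1 hab) h
  · exact ⟨|d|, abs_nonneg d, by rw [sq_abs]; exact hd⟩
  · have : d ^ 2 = 0 := by nlinarith [sq_nonneg d]
    exact ⟨0, le_rfl, by rw [hd, this]; norm_num⟩

/-- The sum of an odd fourth power and four times a fourth power, if a square, yields a
difference of two fourth powers that is a square. -/
theorem exists_pow_four_sub_of_sq_eq {x f e : ℤ} (hx : 0 < x) (hf : f % 2 = 1) (he : e ≠ 0)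
    (hfe : IsCoprime f e) (h : x ^ 2 = f ^ 4 + 4 * e ^ 4) :
    ∃ X Y : ℤ, 0 < X ∧ X < x ∧ Y ≠ 0 ∧ IsCoprime X Y ∧ X ^ 4 = Y ^ 4 + f ^ 2 := by
  have hf2 : (f ^ 2) % 2 = 1 := by rw [pow_two, Int.mul_emod, hf]; norm_num
  have h2f : IsCoprime f 2 := by
    rw [Int.isCoprime_iff_gcd_eq_one]
    have : Odd f := Int.odd_iff.2 hf
    exact Int.isCoprime_iff_gcd_eq_one.1 (Int.isCoprime_two_right.2 this)
  have hcop : IsCoprime (f ^ 2) (2 * e ^ 2) :=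
    IsCoprime.pow_left (IsCoprime.mul_right h2f (IsCoprime.pow_right hfe))
  have hp : PythagoreanTriple (f ^ 2) (2 * e ^ 2) x := by
    unfold PythagoreanTriple; linear_combination -h
  obtain ⟨c, d, h1, h2, h3, h4, h5, h6⟩ := PythagoreanTriple.coprime_classification' hp
    (Int.isCoprime_iff_gcd_eq_one.1 hcop) hf2 hx
  have hcd : IsCoprime c d := Int.isCoprime_iff_gcd_eq_one.2 h4
  have he2 : c * d = e ^ 2 := by linarith
  have hepos : 0 < e ^ 2 := by positivity
  have hcpos : 0 < c := by
    rcases h6.lt_or_eq with h | h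
    · exact h
    · rw [← h] at he2; linarith
  have hdpos : 0 < d := by
    by_contra hd
    have := mul_nonneg hcpos.le (by linarith : 0 ≤ -d)
    linarith
  obtain ⟨X, hX0, hX⟩ := Int.exists_eq_sq_of_mul_eq_sq h6 hcd he2
  obtain ⟨Y, hY0, hY⟩ := Int.exists_eq_sq_of_mul_eq_sq hdpos.le hcd.symm (by rw [mul_comm]; exact he2)
  have hXpos : 0 < X := by
    rcases hX0.lt_or_eq with h | h
    · exact h
    · rw [hX, ← h] at hcpos; norm_num at hcpos
  have hYpos : 0 < Y := by
    rcases hY0.lt_or_eq with h | h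
    · exact h
    · rw [hY, ← h] at hdpos; norm_num at hdpos
  refine ⟨X, Y, hXpos, ?_, hYpos.ne', ?_, ?_⟩
  · rw [h3, hX]
    have : X ≤ X ^ 2 := by nlinarith
    have : X ^ 2 ≤ (X ^ 2) ^ 2 := by nlinarith
    have : 0 < d ^ 2 := by positivity
    linarith
  · rw [hX, hY] at hcd
    exact (IsCoprime.pow_iff (by norm_num) (by norm_num)).1 hcd
  · rw [hX, hY] at h1; linear_combination -h1

/-- If `2ab` is a square and `a ^ 2 + b ^ 2 = x ^ 2` with `a` odd, then `x ^ 2 = f ^ 4 + 4 e ^ 4`. -/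
theorem exists_sq_eq_pow_four_add {x y a b : ℤ} (hy : y ≠ 0) (ha : 0 ≤ a) (hb : 0 ≤ b)
    (ha2 : a % 2 = 1) (hab : IsCoprime a b) (h2 : y ^ 2 = 2 * a * b)
    (h3 : x ^ 2 = a ^ 2 + b ^ 2) :
    ∃ f e : ℤ, f % 2 = 1 ∧ e ≠ 0 ∧ IsCoprime f e ∧ x ^ 2 = f ^ 4 + 4 * e ^ 4 := by
  have ha2' : IsCoprime a 2 := Int.isCoprime_two_right.2 (Int.odd_iff.2 ha2)
  have hc : IsCoprime a (2 * b) := IsCoprime.mul_right ha2' hab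
  obtain ⟨f, -, hf⟩ := Int.exists_eq_sq_of_mul_eq_sq ha hc (by linear_combination -h2 : _ = y ^ 2)
  obtain ⟨g, -, hg⟩ := Int.exists_eq_sq_of_mul_eq_sq (by linarith) hc.symm
    (by linear_combination -h2 : _ = y ^ 2)
  have hg2 : (2 : ℤ) ∣ g := Int.prime_two.dvd_of_dvd_pow (hg ▸ dvd_mul_right 2 b)
  obtain ⟨e, rfl⟩ := hg2
  have hbe : b = 2 * e ^ 2 := by linarith
  refine ⟨f, e, ?_, ?_, ?_, ?_⟩
  · rcases Int.emod_two_eq f with h | h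
    · exfalso
      rw [hf, pow_two, Int.mul_emod, h] at ha2; norm_num at ha2
    · exact h
  · rintro rfl
    apply hy
    rw [hbe] at h2
    exact pow_eq_zero_iff (two_ne_zero) |>.1 (by rw [h2]; ring)
  · rw [hf, hbe] at hab
    have := (IsCoprime.mul_right_iff.1 hab).2
    exact (IsCoprime.pow_iff (by norm_num) (by norm_num)).1 this
  · rw [h3, hf, hbe]; ring

/-- A difference of two coprime nonzero fourth powers is not an odd square. -/
theorem eq_zero_of_pow_four_eq_pow_four_add_odd_sq :
    ∀ n : ℕ, ∀ x y z : ℤ, x.toNat = n → 0 < x → IsCoprime x y → z % 2 = 1 →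
      x ^ 4 = y ^ 4 + z ^ 2 → y = 0 := by
  intro n
  induction n using Nat.strong_induction_on with
  | _ n ih =>
    intro x y z hn hx hxy hz h
    by_contra hy
    have hp : PythagoreanTriple z (y ^ 2) (x ^ 2) := by
      unfold PythagoreanTriple; linear_combination -h
    have hcop : IsCoprime z (y ^ 2) := by
      have : IsCoprime (z ^ 2) (y ^ 4) := by
        have h1 : z ^ 2 = x ^ 4 + y ^ 4 * (-1) := by linear_combination -h
        rw [h1]
        exact IsCoprime.add_mul_left_left (IsCoprime.pow hxy) (-1)
      have := (IsCoprime.pow_iff (by norm_num) (by norm_num)).1 this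
      exact IsCoprime.pow_right this
    obtain ⟨a, b, h1, h2, h3, h4, h5, h6⟩ := PythagoreanTriple.coprime_classification' hp
      (Int.isCoprime_iff_gcd_eq_one.1 hcop) hz (by positivity)
    have hab : IsCoprime a b := Int.isCoprime_iff_gcd_eq_one.2 h4
    have hy2 : 0 < y ^ 2 := by positivity
    have hb : 0 ≤ b := by
      by_contra hb
      have := mul_nonneg h6 (by linarith : 0 ≤ -b)
      nlinarith
    have key : ∃ f e : ℤ, f % 2 = 1 ∧ e ≠ 0 ∧ IsCoprime f e ∧ x ^ 2 = f ^ 4 + 4 * e ^ 4 := by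
      rcases h5 with ⟨-, h5'⟩ | ⟨h5, -⟩
      · exact exists_sq_eq_pow_four_add hy hb h6 h5' hab.symm (by rw [h2]; ring)
          (by rw [h3]; ring)
      · exact exists_sq_eq_pow_four_add hy h6 hb h5 hab h2 h3
    obtain ⟨f, e, hf, he, hfe, hxe⟩ := key
    obtain ⟨X, Y, hX, hXx, hY, hXY, hXYf⟩ := exists_pow_four_sub_of_sq_eq hx hf he hfe hxe
    exact hY (ih X.toNat (by omega) X Y f rfl hX hXY hf hXYf)

/-- The only natural solution of `u ^ 4 + 1 = 2 k ^ 2` is `u = k = 1`. -/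
theorem eq_one_of_pow_four_add_one_eq_two_mul_sq {u k : ℕ} (h : u ^ 4 + 1 = 2 * k ^ 2) :
    u = 1 ∧ k = 1 := by
  have hu : Odd u := by
    by_contra hu
    obtain ⟨r, rfl⟩ := (Nat.not_odd_iff_even.1 hu).two_dvd
    have : (2 * r) ^ 4 = 2 * (8 * r ^ 4) := by ring
    omega
  obtain ⟨r, hr⟩ := hu
  have hu4 : u ^ 4 = 2 * (8 * r ^ 4 + 16 * r ^ 3 + 12 * r ^ 2 + 4 * r) + 1 := by rw [hr]; ring
  set w : ℕ := 8 * r ^ 4 + 16 * r ^ 3 + 12 * r ^ 2 + 4 * r with hw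
  have hk2 : k ^ 2 = w + 1 := by omega
  have hk0 : 0 < k := by
    rcases Nat.eq_zero_or_pos k with rfl | h0
    · omega
    · exact h0
  have huZ : (u : ℤ) ^ 4 = 2 * w + 1 := by exact_mod_cast hu4
  have hkZ : (k : ℤ) ^ 2 = w + 1 := by exact_mod_cast hk2
  have hp : PythagoreanTriple ((u : ℤ) ^ 2) w ((k : ℤ) ^ 2) := by
    unfold PythagoreanTriple; linear_combination huZ - (k ^ 2 + w + 1) * hkZ
  have hcop : IsCoprime ((u : ℤ) ^ 2) w := by
    refine ⟨u ^ 2, -2, ?_⟩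
    linear_combination huZ
  have huodd : (u : ℤ) % 2 = 1 := by omega
  have hu2 : ((u : ℤ) ^ 2) % 2 = 1 := by rw [pow_two, Int.mul_emod, huodd]; norm_num
  obtain ⟨a, b, h1, h2, h3, h4, h5, h6⟩ := PythagoreanTriple.coprime_classification' hp
    (Int.isCoprime_iff_gcd_eq_one.1 hcop) hu2 (by positivity)
  have hab : IsCoprime a b := Int.isCoprime_iff_gcd_eq_one.2 h4
  have ha : 0 < a := by
    rcases h6.lt_or_eq with h | h
    · exact h
    · rw [← h] at h1
      have : 0 < u := by omega
      have : (0 : ℤ) < (u : ℤ) ^ 2 := by positivity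
      nlinarith
  have hkodd : (k : ℤ) % 2 = 1 := by
    rcases Nat.even_or_odd k with ⟨s, hs⟩ | ⟨s, hs⟩
    · exfalso
      have h4 : k ^ 2 = 4 * s ^ 2 := by rw [hs]; ring
      have h8 : w = 4 * (2 * r ^ 4 + 4 * r ^ 3 + 3 * r ^ 2 + r) := by rw [hw]; ring
      omega
    · omega
  have hb0 := eq_zero_of_pow_four_eq_pow_four_add_odd_sq _ a b (u * k) rfl ha hab
    (by rw [Int.mul_emod, huodd, hkodd]; norm_num)
    (by linear_combination (-(k : ℤ) ^ 2) * h1 - (a ^ 2 - b ^ 2) * h3)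
  have hw0 : w = 0 := by
    have : (w : ℤ) = 0 := by rw [h2, hb0]; ring
    exact_mod_cast this
  rw [hw0] at hk2 hu4
  exact ⟨by simpa using hu4,
    by simpa using hk2⟩

/-- Congruence obstruction for a two-term equation. -/
theorem ne_of_forall_zmod_ne (N a b c i j : ℕ)
    (h : ∀ x y : ZMod N, (a : ZMod N) * x ^ i + (c : ZMod N) ≠ (b : ZMod N) * y ^ j) (f g : ℕ) :
    a * f ^ i + c ≠ b * g ^ j := by
  intro hfg
  apply h f g
  exact_mod_cast congrArg (Nat.cast : ℕ → ZMod N) hfg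

/-- The possible first factors of a factorisation of `c` are its divisors. -/
theorem Nat.mem_divisors_of_mul_eq {a b c : ℕ} (hc : c ≠ 0) (h : a * b = c) : a ∈ c.divisors :=
  Nat.mem_divisors.2 ⟨Dvd.intro _ h, hc⟩

theorem Nat.exists_of_sq_mul_eq_odd {n : ℕ} (h : n % 2 = 1) :
    ∃ r, n = 2 * r + 1 ∧ n ^ 2 = 2 * (2 * r ^ 2 + 2 * r) + 1 := by
  refine ⟨n / 2, by omega, ?_⟩
  have : n = 2 * (n / 2) + 1 := by omega
  generalize n / 2 = r at this
  rw [this]; ring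

theorem eq_zero_of_pow_four_eq_twelve_mul_pow_four_add_one :
    ∀ k h : ℕ, h ^ 4 = 12 * k ^ 4 + 1 → k = 0 := by
  intro k
  induction k using Nat.strong_induction_on with
  | _ k ih =>
    intro h hk
    by_contra hk0
    have hodd : h % 2 = 1 := by
      have := congrArg (· % 2) hk
      rcases Nat.mod_two_eq_zero_or_one h with h0 | h0 <;> simp [Nat.pow_mod, h0] at this ⊢ <;> omega
    obtain ⟨r, -, hr⟩ := Nat.exists_of_sq_mul_eq_odd hodd
    have hAB : (2 * r ^ 2 + 2 * r + 1) * (2 * r ^ 2 + 2 * r) = 3 * k ^ 4 := by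
      have : h ^ 4 = (h ^ 2) ^ 2 := by ring
      rw [this, hr] at hk
      nlinarith
    have hco : Nat.Coprime (2 * r ^ 2 + 2 * r + 1) (2 * r ^ 2 + 2 * r) := by simp
    obtain ⟨a, b, f, g, hab, -, hf, hg, hfg⟩ := hco.exists_eq_mul_pow (by norm_num) hAB
    have ha := Nat.mem_divisors_of_mul_eq (by norm_num) hab
    rw [show Nat.divisors 3 = {1, 3} by decide] at ha
    simp only [Finset.mem_insert, Finset.mem_singleton] at ha
    rcases ha with rfl | rfl
    · obtain rfl : b = 3 := by omega
      have hgeven : g % 2 = 0 := by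
        have h3 : (3 * g ^ 4) % 2 = 0 := by rw [← hg]; omega
        rcases Nat.mod_two_eq_zero_or_one g with h0 | h0
        · exact h0
        · simp [Nat.mul_mod, Nat.pow_mod, h0] at h3
      obtain ⟨e, rfl⟩ : ∃ e, g = 2 * e := ⟨g / 2, by omega⟩
      have hfodd : f % 2 = 1 := by
        have h3 : (1 * f ^ 4) % 2 = 1 := by rw [← hf]; omega
        rcases Nat.mod_two_eq_zero_or_one f with h0 | h0
        · simp [Nat.pow_mod, h0] at h3
        · exact h0
      have hfe : f ^ 4 = 48 * e ^ 4 + 1 := by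
        have : (2 * e) ^ 4 = 16 * e ^ 4 := by ring
        omega
      obtain ⟨s, -, hs⟩ := Nat.exists_of_sq_mul_eq_odd hfodd
      have hAB' : (2 * s ^ 2 + 2 * s + 1) * (2 * s ^ 2 + 2 * s) = 12 * e ^ 4 := by
        have : f ^ 4 = (f ^ 2) ^ 2 := by ring
        rw [this, hs] at hfe
        nlinarith
      have hco' : Nat.Coprime (2 * s ^ 2 + 2 * s + 1) (2 * s ^ 2 + 2 * s) := by simp
      obtain ⟨c, d, p, q, hcd, hcdco, hp, hq, hpq⟩ := hco'.exists_eq_mul_pow (by norm_num) hAB'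
      have hc := Nat.mem_divisors_of_mul_eq (by norm_num) hcd
      rw [show Nat.divisors 12 = {1, 2, 3, 4, 6, 12} by decide] at hc
      simp only [Finset.mem_insert, Finset.mem_singleton] at hc
      rcases hc with rfl | rfl | rfl | rfl | rfl | rfl
      · obtain rfl : d = 12 := by omega
        have hpq' : e = p * q := Nat.pow_left_injective (by norm_num : 4 ≠ 0) hpq
        have hkk : k = f * (2 * e) := Nat.pow_left_injective (by norm_num : 4 ≠ 0) hfg
        have hf0 : 0 < f := by omega
        have he0 : 0 < e := by
          rcases Nat.eq_zero_or_pos e with rfl | h0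
          · simp at hkk; exact absurd hkk hk0
          · exact h0
        have hp0 : 0 < p := by
          rcases Nat.eq_zero_or_pos p with rfl | h0
          · simp at hpq'; omega
          · exact h0
        have hqe : q ≤ e := by rw [hpq']; exact Nat.le_mul_of_pos_left q hp0
        have hek : e < k := by rw [hkk]; nlinarith
        have := ih q (by omega) p (by omega)
        rw [this] at hpq'
        omega
      · omega
      · obtain rfl : d = 4 := by omega
        exact absurd (by omega : 4 * q ^ 4 + 1 = 3 * p ^ 4)
          (ne_of_forall_zmod_ne 4 4 3 1 4 4 (by decide) q p)
      · omega
      · omega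
      · omega
    · obtain rfl : b = 1 := by omega
      exact absurd (by omega : 1 * g ^ 4 + 1 = 3 * f ^ 4)
        (ne_of_forall_zmod_ne 3 1 3 1 4 4 (by decide) g f)

theorem eq_one_or_eq_seven_of_sq_eq {P c : ℕ} (h : P ^ 2 = 48 * c ^ 4 + 1) : P = 1 ∨ P = 7 := by
  have hodd : P % 2 = 1 := by
    have := congrArg (· % 2) h
    rcases Nat.mod_two_eq_zero_or_one P with h0 | h0 <;> simp [Nat.pow_mod, h0] at this ⊢ <;> omega
  obtain ⟨B, hB⟩ : ∃ B, P = 2 * B + 1 := ⟨P / 2, by omega⟩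
  have hAB : B * (B + 1) = 12 * c ^ 4 := by rw [hB] at h; nlinarith
  have hco : Nat.Coprime B (B + 1) := by simp
  obtain ⟨a, b, f, g, hab, hcop, hf, hg, hfg⟩ := hco.exists_eq_mul_pow (by norm_num) hAB
  have ha := Nat.mem_divisors_of_mul_eq (by norm_num) hab
  rw [show Nat.divisors 12 = {1, 2, 3, 4, 6, 12} by decide] at ha
  simp only [Finset.mem_insert, Finset.mem_singleton] at ha
  rcases ha with rfl | rfl | rfl | rfl | rfl | rfl
  · obtain rfl : b = 12 := by omega
    exact absurd (by omega : 1 * f ^ 4 + 1 = 12 * g ^ 4)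
      (ne_of_forall_zmod_ne 3 1 12 1 4 4 (by decide) f g)
  · obtain rfl : b = 6 := by omega
    norm_num at hcop
  · obtain rfl : b = 4 := by omega
    right
    have hg0 : 0 < g ^ 2 := by
      rcases Nat.eq_zero_or_pos g with rfl | h0
      · omega
      · positivity
    obtain ⟨D, hD⟩ : ∃ D, g ^ 2 = D + 1 := ⟨g ^ 2 - 1, by omega⟩
    have hprod : (2 * D + 1) * (2 * D + 3) = 3 * f ^ 4 := by
      have : 4 * g ^ 4 = 4 * (D + 1) ^ 2 := by rw [← hD]; ring
      nlinarith
    have hco2 : Nat.Coprime (2 * D + 1) (2 * D + 3) := by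
      rw [show 2 * D + 3 = 2 * D + 1 + 2 by ring, Nat.coprime_self_add_right]
      exact Nat.coprime_two_right.2 ⟨D, rfl⟩
    obtain ⟨a', b', u, v, hab', -, hu, hv, huv⟩ := hco2.exists_eq_mul_pow (by norm_num) hprod
    have ha' := Nat.mem_divisors_of_mul_eq (by norm_num) hab'
    rw [show Nat.divisors 3 = {1, 3} by decide] at ha'
    simp only [Finset.mem_insert, Finset.mem_singleton] at ha'
    rcases ha' with rfl | rfl
    · obtain ⟨-, h1⟩ := eq_one_of_pow_four_add_one_eq_two_mul_sq
        (by omega : u ^ 4 + 1 = 2 * g ^ 2)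
      subst h1
      omega
    · exact absurd (by omega : 3 * u ^ 4 + 1 = 2 * g ^ 2)
        (ne_of_forall_zmod_ne 3 3 2 1 4 2 (by decide) u g)
  · obtain rfl : b = 3 := by omega
    exact absurd (by omega : 4 * f ^ 4 + 1 = 3 * g ^ 4)
      (ne_of_forall_zmod_ne 4 4 3 1 4 4 (by decide) f g)
  · obtain rfl : b = 2 := by omega
    norm_num at hcop
  · obtain rfl : b = 1 := by omega
    left
    have := eq_zero_of_pow_four_eq_twelve_mul_pow_four_add_one f g (by omega)
    subst this
    omega

theorem pow_two_ne_fortyeight_hundred_one (p : ℕ) : p ^ 2 ≠ 4801 := by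
  intro h
  have h1 : p < 70 := by nlinarith
  have h2 : 69 < p := by nlinarith
  omega

theorem eq_zero_or_eq_fourteen_of_sq_eq :
    ∀ s z : ℕ, z ^ 2 = 600 * s ^ 4 + 1 → s = 0 ∨ s = 14 := by
  intro s
  induction s using Nat.strong_induction_on with
  | _ s ih =>
    intro z hz
    have hodd : z % 2 = 1 := by
      have := congrArg (· % 2) hz
      rcases Nat.mod_two_eq_zero_or_one z with h0 | h0 <;>
        simp [Nat.pow_mod, h0] at this ⊢ <;> omega
    obtain ⟨A, hA⟩ : ∃ A, z = 2 * A + 1 := ⟨z / 2, by omega⟩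
    have hAB : A * (A + 1) = 150 * s ^ 4 := by rw [hA] at hz; nlinarith
    have hco : Nat.Coprime A (A + 1) := by simp
    obtain ⟨a, b, f, g, hab, hcop, hf, hg, hfg⟩ := hco.exists_eq_mul_pow (by norm_num) hAB
    have ha := Nat.mem_divisors_of_mul_eq (by norm_num) hab
    rw [show Nat.divisors 150 = {1, 2, 3, 5, 6, 10, 15, 25, 30, 50, 75, 150} by decide +kernel] at ha
    simp only [Finset.mem_insert, Finset.mem_singleton] at ha
    rcases ha with rfl | rfl | rfl | rfl | rfl | rfl | rfl | rfl | rfl | rfl | rfl | rfl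
    · obtain rfl : b = 150 := by omega
      exact absurd (by omega : 1 * f ^ 4 + 1 = 150 * g ^ 4)
        (ne_of_forall_zmod_ne 3 1 150 1 4 4 (by decide) f g)
    · obtain rfl : b = 75 := by omega
      exact absurd (by omega : 2 * f ^ 4 + 1 = 75 * g ^ 4)
        (ne_of_forall_zmod_ne 5 2 75 1 4 4 (by decide) f g)
    · obtain rfl : b = 50 := by omega
      exact absurd (by omega : 3 * f ^ 4 + 1 = 50 * g ^ 4)
        (ne_of_forall_zmod_ne 5 3 50 1 4 4 (by decide) f g)
    · obtain rfl : b = 30 := by omega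
      norm_num at hcop
    · obtain rfl : b = 25 := by omega
      exact absurd (by omega : 6 * f ^ 4 + 1 = 25 * g ^ 4)
        (ne_of_forall_zmod_ne 5 6 25 1 4 4 (by decide) f g)
    · obtain rfl : b = 15 := by omega
      norm_num at hcop
    · obtain rfl : b = 10 := by omega
      norm_num at hcop
    · obtain rfl : b = 6 := by omega
      exact absurd (by omega : 25 * f ^ 4 + 1 = 6 * g ^ 4)
        (ne_of_forall_zmod_ne 3 25 6 1 4 4 (by decide) f g)
    · obtain rfl : b = 5 := by omega
      norm_num at hcop
    · obtain rfl : b = 3 := by omega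
      exact absurd (by omega : 50 * f ^ 4 + 1 = 3 * g ^ 4)
        (ne_of_forall_zmod_ne 5 50 3 1 4 4 (by decide) f g)
    · obtain rfl : b = 2 := by omega
      exact absurd (by omega : 75 * f ^ 4 + 1 = 2 * g ^ 4)
        (ne_of_forall_zmod_ne 5 75 2 1 4 4 (by decide) f g)
    · obtain rfl : b = 1 := by omega
      have hsfg : s = f * g := Nat.pow_left_injective (by norm_num : 4 ≠ 0) hfg
      have hgf : g ^ 4 = 150 * f ^ 4 + 1 := by omega
      have hfeven : f % 2 = 0 := by
        by_contra h0
        obtain ⟨e, he⟩ : ∃ e, f = 2 * e + 1 := ⟨f / 2, by omega⟩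
        rw [he] at hgf
        exact absurd (by rw [one_mul]; omega : 150 * (2 * e + 1) ^ 4 + 1 = 1 * g ^ 4) <| by
          intro h
          have h' := congrArg (Nat.cast : ℕ → ZMod 16) h
          push_cast at h'
          revert h'
          generalize (e : ZMod 16) = x
          generalize (g : ZMod 16) = y
          revert x y
          decide
      obtain ⟨R, rfl⟩ : ∃ R, f = 2 * R := ⟨f / 2, by omega⟩
      have hgodd : g % 2 = 1 := by
        have := congrArg (· % 2) hgf
        rcases Nat.mod_two_eq_zero_or_one g with h0 | h0 <;>
          simp [Nat.pow_mod, h0] at this ⊢ <;> omega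
      obtain ⟨r, -, hr⟩ := Nat.exists_of_sq_mul_eq_odd hgodd
      have hgR : g ^ 4 = 2400 * R ^ 4 + 1 := by rw [hgf]; ring
      have hAB' : (2 * r ^ 2 + 2 * r + 1) * (2 * r ^ 2 + 2 * r) = 600 * R ^ 4 := by
        have : g ^ 4 = (g ^ 2) ^ 2 := by ring
        rw [this, hr] at hgR
        nlinarith
      have hco' : Nat.Coprime (2 * r ^ 2 + 2 * r + 1) (2 * r ^ 2 + 2 * r) := by simp
      obtain ⟨c, d, p, q, hcd, hcdco, hp, hq, hpq⟩ := hco'.exists_eq_mul_pow (by norm_num) hAB'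
      have hpq' : R = p * q := Nat.pow_left_injective (by norm_num : 4 ≠ 0) hpq
      have hc2 : ¬ 2 ∣ c := fun ⟨e, he⟩ => by rw [he, mul_assoc] at hp; omega
      have hc3 : ¬ 3 ∣ c := by
        rintro ⟨e, he⟩
        rw [he, mul_assoc] at hp
        have : (r % 3 = 0 ∨ r % 3 = 1 ∨ r % 3 = 2) := by omega
        have h3 : (2 * r ^ 2 + 2 * r + 1) % 3 = 0 := by rw [hp]; omega
        rcases this with h0 | h0 | h0 <;> simp [Nat.add_mod, Nat.mul_mod, Nat.pow_mod, h0] at h3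
      have hcs : c = 1 ∨ c = 5 ∨ c = 25 := by
        have hc := Nat.mem_divisors_of_mul_eq (by norm_num) hcd
        have : ∀ x ∈ Nat.divisors 600, ¬ 2 ∣ x → ¬ 3 ∣ x → x = 1 ∨ x = 5 ∨ x = 25 := by
          decide +kernel
        exact this c hc hc2 hc3
      rcases hcs with rfl | rfl | rfl
      · obtain rfl : d = 600 := by omega
        rcases Nat.eq_zero_or_pos s with hs0 | hs0
        · exact Or.inl hs0
        · exfalso
          have hR0 : 0 < R := by
            rcases Nat.eq_zero_or_pos R with rfl | h0
            · simp at hsfg; omega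
            · exact h0
          have hp0 : 0 < p := by
            rcases Nat.eq_zero_or_pos p with rfl | h0
            · simp at hpq'; omega
            · exact h0
          have hqR : q ≤ R := by rw [hpq']; exact Nat.le_mul_of_pos_left q hp0
          have hg0 : 0 < g := by omega
          have hRs : R < s := by rw [hsfg]; nlinarith
          have hp4 : (p ^ 2) ^ 2 = p ^ 4 := by ring
          rcases ih q (by omega) (p ^ 2) (by omega) with h0 | h0
          · rw [h0] at hpq'; omega
          · rw [h0] at hq
            have h4801 : p ^ 2 = 4801 := by
              have : (p ^ 2) ^ 2 = 4801 ^ 2 := by omega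
              exact Nat.pow_left_injective (by norm_num : 2 ≠ 0) this
            exact pow_two_ne_fortyeight_hundred_one p h4801
      · obtain rfl : d = 120 := by omega
        norm_num at hcdco
      · obtain rfl : d = 24 := by omega
        rcases eq_one_or_eq_seven_of_sq_eq (by omega : g ^ 2 = 48 * q ^ 4 + 1) with rfl | rfl
        · left
          have : R ^ 4 = 0 := by omega
          have : R = 0 := by simpa using this
          rw [hsfg, this]
        · right
          have : R ^ 4 = 1 := by omega
          have : R = 1 := by simpa using this
          rw [hsfg, this]

theorem eq_of_twentyfour_mul_pow_four_add_eq_sq {t w : ℕ} (h : 24 * t ^ 4 + 25 = w ^ 2) :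
    t = 0 ∨ t = 1 ∨ t = 70 := by
  by_cases h5 : 5 ∣ t
  · obtain ⟨s, rfl⟩ := h5
    have h5w : 5 ∣ w := by
      apply Nat.prime_five.dvd_of_dvd_pow (n := 2)
      rw [← h]
      exact ⟨24 * 125 * s ^ 4 + 5, by ring⟩
    obtain ⟨z, rfl⟩ := h5w
    rcases eq_zero_or_eq_fourteen_of_sq_eq s z (by nlinarith) with rfl | rfl
    · left; rfl
    · right; right; rfl
  · right; left
    have hodd : w % 2 = 1 := by
      have := congrArg (· % 2) h
      rcases Nat.mod_two_eq_zero_or_one w with h0 | h0 <;>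
        simp [Nat.pow_mod, h0] at this ⊢ <;> omega
    have hw5 : 5 ≤ w := by nlinarith [Nat.zero_le (t ^ 4)]
    obtain ⟨A, hA⟩ : ∃ A, w = 2 * A + 5 := ⟨(w - 5) / 2, by omega⟩
    have hAB : A * (A + 5) = 6 * t ^ 4 := by rw [hA] at h; nlinarith
    have h5A : ¬ 5 ∣ A := by
      rintro ⟨B, rfl⟩
      have : 5 ∣ 6 * t ^ 4 := by rw [← hAB]; exact ⟨B * (5 * B + 5), by ring⟩
      rcases (Nat.prime_five.dvd_mul).1 this with h | h
      · omega
      · exact h5 (Nat.prime_five.dvd_of_dvd_pow h)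
    have hco : Nat.Coprime A (A + 5) := by
      rw [Nat.coprime_self_add_right]
      exact ((Nat.prime_five.coprime_iff_not_dvd).2 h5A).symm
    obtain ⟨a, b, f, g, hab, hcop, hf, hg, hfg⟩ := hco.exists_eq_mul_pow (by norm_num) hAB
    have htfg : t = f * g := Nat.pow_left_injective (by norm_num : 4 ≠ 0) hfg
    have ha := Nat.mem_divisors_of_mul_eq (by norm_num) hab
    rw [show Nat.divisors 6 = {1, 2, 3, 6} by decide] at ha
    simp only [Finset.mem_insert, Finset.mem_singleton] at ha
    rcases ha with rfl | rfl | rfl | rfl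
    · obtain rfl : b = 6 := by omega
      have hf1 := FourthRootSix.eq_one_of_pow_four_add_five_eq (by omega : f ^ 4 + 5 = 6 * g ^ 4)
      subst hf1
      have : g ^ 4 = 1 := by omega
      have : g = 1 := by simpa using this
      rw [htfg, this]
    · obtain rfl : b = 3 := by omega
      exact absurd (by omega : 2 * f ^ 4 + 5 = 3 * g ^ 4)
        (by
          intro h3
          have h9 := congrArg (Nat.cast : ℕ → ZMod 3) h3
          push_cast at h9
          revert h9
          generalize (f : ZMod 3) = x
          generalize (g : ZMod 3) = y
          revert x y
          decide)
    · obtain rfl : b = 2 := by omega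
      exfalso
      have hf5 : ¬ 5 ∣ f := fun hd => h5 (htfg ▸ hd.mul_right g)
      have hg5 : ¬ 5 ∣ g := fun hd => h5 (htfg ▸ hd.mul_left f)
      have h3 : 3 * f ^ 4 + 5 = 2 * g ^ 4 := by omega
      have key : ∀ x y : ZMod 5, x ≠ 0 → y ≠ 0 → 3 * x ^ 4 + 5 ≠ 2 * y ^ 4 := by decide
      refine key f g ?_ ?_ ?_
      · rwa [Ne, ZMod.natCast_eq_zero_iff]
      · rwa [Ne, ZMod.natCast_eq_zero_iff]
      · exact_mod_cast congrArg (Nat.cast : ℕ → ZMod 5) h3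
    · obtain rfl : b = 1 := by omega
      exact absurd (by omega : 6 * f ^ 4 + 5 = 1 * g ^ 4)
        (ne_of_forall_zmod_ne 3 6 1 5 4 4 (by decide) f g)

theorem eq_five_of_pow_four_add_sixHundred_eq_sq {u v : ℕ} (h : u ^ 4 + 600 = v ^ 2) : u = 5 := by
  have hlt : u ^ 2 < v := by
    have : (u ^ 2) ^ 2 = u ^ 4 := by ring
    exact lt_of_pow_lt_pow_left₀ 2 (Nat.zero_le _) (by omega)
  have hu : u ≤ 17 := by
    by_contra hu
    have h1 : u ^ 4 + 2 * u ^ 2 + 1 ≤ v ^ 2 := by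
      calc u ^ 4 + 2 * u ^ 2 + 1 = (u ^ 2 + 1) ^ 2 := by ring
        _ ≤ v ^ 2 := Nat.pow_le_pow_left hlt 2
    nlinarith
  have hv : v ≤ 340 := by
    have : u ^ 4 ≤ 17 ^ 4 := Nat.pow_le_pow_left hu 4
    nlinarith
  have key : ∀ u < 18, u ^ 4 + 600 = (u ^ 4 + 600).sqrt ^ 2 → u = 5 := by decide +kernel
  refine key u (by omega) ?_
  rw [h, Nat.sqrt_eq']

/-- The only `m > 25` for which `m (m ^ 2 + 600)` is a square is `117600`. -/
theorem eq_of_mul_sq_add_sixHundred_eq_sq {m z : ℕ} (hm : 26 ≤ m)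
    (h : m * (m ^ 2 + 600) = z ^ 2) : m = 117600 := by
  obtain ⟨d, u, hd0, hu0, hdu, hsq⟩ := Nat.sq_mul_squarefree_of_pos (by omega : 0 < m)
  have huz : u ∣ z := by
    apply (Nat.pow_dvd_pow_iff (n := 2) (by norm_num)).1
    rw [← h, ← hdu, mul_assoc]
    exact Dvd.intro _ rfl
  obtain ⟨z₁, rfl⟩ := huz
  have h1 : d * (m ^ 2 + 600) = z₁ ^ 2 := by
    apply Nat.eq_of_mul_eq_mul_left (by positivity : 0 < u ^ 2)
    rw [← mul_assoc, hdu, h]; ring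
  have hdz : d ∣ z₁ := (hsq.dvd_pow_iff_dvd (by norm_num : 2 ≠ 0)).1 (h1 ▸ Dvd.intro _ rfl)
  obtain ⟨v, rfl⟩ := hdz
  have h2 : m ^ 2 + 600 = d * v ^ 2 := by
    apply Nat.eq_of_mul_eq_mul_left hd0
    rw [h1]; ring
  have hd600 : d ∣ 600 := by
    have hdm : d ∣ m ^ 2 := Dvd.dvd.pow (hdu ▸ Dvd.intro_left _ rfl) (by norm_num)
    exact (Nat.dvd_add_right hdm).1 (h2 ▸ Dvd.intro _ rfl)
  have hd4 : ¬ 4 ∣ d := fun h4 => by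
    have := hsq 2 h4
    rw [Nat.isUnit_iff] at this; omega
  have hd25 : ¬ 25 ∣ d := fun h4 => by
    have := hsq 5 h4
    rw [Nat.isUnit_iff] at this; omega
  have hds : d = 1 ∨ d = 2 ∨ d = 3 ∨ d = 5 ∨ d = 6 ∨ d = 10 ∨ d = 15 ∨ d = 30 := by
    have key : ∀ x ∈ Nat.divisors 600, ¬ 4 ∣ x → ¬ 25 ∣ x →
        x = 1 ∨ x = 2 ∨ x = 3 ∨ x = 5 ∨ x = 6 ∨ x = 10 ∨ x = 15 ∨ x = 30 := by decide +kernel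
    exact key d (Nat.mem_divisors.2 ⟨hd600, by norm_num⟩) hd4 hd25
  have h3 : d * (d * u ^ 4) + 600 = d * v ^ 2 := by
    calc d * (d * u ^ 4) + 600 = (u ^ 2 * d) ^ 2 + 600 := by ring
      _ = d * v ^ 2 := by rw [hdu, h2]
  rcases hds with rfl | rfl | rfl | rfl | rfl | rfl | rfl | rfl
  · have hu5 : u = 5 := eq_five_of_pow_four_add_sixHundred_eq_sq (v := v) (by linarith)
    subst hu5; omega
  · exact absurd (by omega : 2 * u ^ 4 + 300 = 1 * v ^ 2)
      (ne_of_forall_zmod_ne 16 2 1 300 4 2 (by decide) u v)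
  · exact absurd (by omega : 3 * u ^ 4 + 200 = 1 * v ^ 2)
      (ne_of_forall_zmod_ne 3 3 1 200 4 2 (by decide) u v)
  · exact absurd (by omega : 5 * u ^ 4 + 120 = 1 * v ^ 2)
      (ne_of_forall_zmod_ne 9 5 1 120 4 2 (by decide) u v)
  · have h4 : 6 * u ^ 4 + 100 = v ^ 2 := by omega
    have hu2 : 2 ∣ u := by
      by_contra hu2
      have key : ∀ e y : ZMod 16, 6 * (2 * e + 1) ^ 4 + 100 ≠ y ^ 2 := by decide
      obtain ⟨e, rfl⟩ : ∃ e, u = 2 * e + 1 := ⟨u / 2, by omega⟩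
      apply key e v
      exact_mod_cast congrArg (Nat.cast : ℕ → ZMod 16) h4
    obtain ⟨t, rfl⟩ := hu2
    have hv2 : 2 ∣ v := by
      apply Nat.prime_two.dvd_of_dvd_pow (n := 2)
      rw [← h4]
      omega
    obtain ⟨w, rfl⟩ := hv2
    rcases eq_of_twentyfour_mul_pow_four_add_eq_sq (by nlinarith : 24 * t ^ 4 + 25 = w ^ 2) with
      rfl | rfl | rfl <;> omega
  · exact absurd (by omega : 10 * u ^ 4 + 60 = 1 * v ^ 2)
      (ne_of_forall_zmod_ne 16 10 1 60 4 2 (by decide) u v)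
  · exact absurd (by omega : 15 * u ^ 4 + 40 = 1 * v ^ 2)
      (ne_of_forall_zmod_ne 25 15 1 40 4 2 (by decide) u v)
  · exact absurd (by omega : 30 * u ^ 4 + 20 = 1 * v ^ 2)
      (ne_of_forall_zmod_ne 32 30 1 20 4 2 (by decide) u v)

theorem Nat.coprime_of_dvd_of_dvd_sq_add_sixHundred {m X Y : ℕ} (hX : X ∣ m)
    (hY : Y ∣ m ^ 2 + 600) (h2 : ¬ (2 ∣ X ∧ 2 ∣ Y)) (h3 : ¬ (3 ∣ X ∧ 3 ∣ Y))
    (h5 : ¬ (5 ∣ X ∧ 5 ∣ Y)) : X.Coprime Y := by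
  apply Nat.coprime_of_dvd
  intro r hr hrX hrY
  have hrm : r ∣ m ^ 2 := (hrX.trans hX).trans (Dvd.intro_left m (by ring))
  have h600 : r ∣ 2 ^ 3 * 3 * 5 ^ 2 := (Nat.dvd_add_right hrm).1 (hrY.trans hY)
  rcases (Nat.Prime.dvd_mul hr).1 h600 with h | h
  · rcases (Nat.Prime.dvd_mul hr).1 h with h | h
    · rw [(Nat.prime_dvd_prime_iff_eq hr Nat.prime_two).1 (hr.dvd_of_dvd_pow h)] at hrX hrY
      exact h2 ⟨hrX, hrY⟩
    · rw [(Nat.prime_dvd_prime_iff_eq hr Nat.prime_three).1 h] at hrX hrY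
      exact h3 ⟨hrX, hrY⟩
  · rw [(Nat.prime_dvd_prime_iff_eq hr Nat.prime_five).1 (hr.dvd_of_dvd_pow h)] at hrX hrY
    exact h5 ⟨hrX, hrY⟩

theorem sq_add_sixHundred_two_adic (m : ℕ) :
    m % 2 = 1 ∧ (m ^ 2 + 600) % 2 = 1 ∨ m % 4 = 2 ∧ (m ^ 2 + 600) % 8 = 4 ∨
      m % 4 = 0 ∧ (m ^ 2 + 600) % 16 = 8 := by
  have key : ∀ r < 16, r % 2 = 1 ∧ (r ^ 2 + 600) % 2 = 1 ∨ r % 4 = 2 ∧ (r ^ 2 + 600) % 8 = 4 ∨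
      r % 4 = 0 ∧ (r ^ 2 + 600) % 16 = 8 := by decide
  have h := key (m % 16) (by omega)
  have hm : (m ^ 2 + 600) % 16 = ((m % 16) ^ 2 + 600) % 16 := by
    simp [Nat.add_mod, Nat.pow_mod]
  generalize m ^ 2 + 600 = M at *
  generalize (m % 16) ^ 2 + 600 = R at *
  omega

theorem sq_add_sixHundred_three_adic (m : ℕ) :
    m % 3 ≠ 0 ∨ m % 3 = 0 ∧ (m ^ 2 + 600) % 3 = 0 ∧ (m ^ 2 + 600) % 9 ≠ 0 := by
  have key : ∀ r < 9, r % 3 ≠ 0 ∨ r % 3 = 0 ∧ (r ^ 2 + 600) % 3 = 0 ∧ (r ^ 2 + 600) % 9 ≠ 0 := by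
    decide
  have h := key (m % 9) (by omega)
  have hm : (m ^ 2 + 600) % 9 = ((m % 9) ^ 2 + 600) % 9 := by
    simp [Nat.add_mod, Nat.pow_mod]
  generalize m ^ 2 + 600 = M at *
  generalize (m % 9) ^ 2 + 600 = R at *
  omega

theorem sq_add_sixHundred_five_adic (m : ℕ) :
    m % 5 ≠ 0 ∧ (m ^ 2 + 600) % 5 ≠ 0 ∨ m % 5 = 0 ∧ m % 25 ≠ 0 ∧ (m ^ 2 + 600) % 25 = 0 ∨
      m % 25 = 0 ∧ (m ^ 2 + 600) % 25 = 0 ∧ (m ^ 2 + 600) % 125 ≠ 0 := by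
  have key : ∀ r < 125, r % 5 ≠ 0 ∧ (r ^ 2 + 600) % 5 ≠ 0 ∨
      r % 5 = 0 ∧ r % 25 ≠ 0 ∧ (r ^ 2 + 600) % 25 = 0 ∨
      r % 25 = 0 ∧ (r ^ 2 + 600) % 25 = 0 ∧ (r ^ 2 + 600) % 125 ≠ 0 := by decide +kernel
  have h := key (m % 125) (by omega)
  have hm : (m ^ 2 + 600) % 125 = ((m % 125) ^ 2 + 600) % 125 := by
    simp [Nat.add_mod, Nat.pow_mod]
  generalize m ^ 2 + 600 = M at *
  generalize (m % 125) ^ 2 + 600 = R at *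
  omega

theorem exists_cube_factors {m y : ℕ} (h : 49 * (m * (m ^ 2 + 600)) = y ^ 3) (α β k c : ℕ)
    (hα : α ∣ m) (hβ : β ∣ m ^ 2 + 600)
    (h2 : ∀ X Y, m = α * X → m ^ 2 + 600 = β * Y → ¬ (2 ∣ X ∧ 2 ∣ Y))
    (h3 : ∀ X Y, m = α * X → m ^ 2 + 600 = β * Y → ¬ (3 ∣ X ∧ 3 ∣ Y))
    (h5 : ∀ X Y, m = α * X → m ^ 2 + 600 = β * Y → ¬ (5 ∣ X ∧ 5 ∣ Y))
    (hk : 49 * (α * β) * c = k ^ 3) (hk0 : 0 < k) (hksq : Squarefree k) (hkd : k ∣ 49 * (α * β)) :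
    ∃ a b f g, a * b = c ∧ m = α * (a * f ^ 3) ∧ m ^ 2 + 600 = β * (b * g ^ 3) := by
  obtain ⟨X, hX⟩ := hα
  obtain ⟨Y, hY⟩ := hβ
  have hco := Nat.coprime_of_dvd_of_dvd_sq_add_sixHundred (Dvd.intro_left α hX.symm)
    (Dvd.intro_left β hY.symm) (h2 X Y hX hY) (h3 X Y hX hY) (h5 X Y hX hY)
  have hy : 49 * (α * β) * (X * Y) = y ^ 3 := by
    rw [← h, hY, hX]; ring
  have hky : k ∣ y := by
    apply (hksq.dvd_pow_iff_dvd (by norm_num : 3 ≠ 0)).1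
    rw [← hy]
    exact hkd.mul_right _
  obtain ⟨t, rfl⟩ := hky
  have hpos : 0 < 49 * (α * β) := by
    apply Nat.pos_of_ne_zero
    intro h0
    rw [h0, zero_mul] at hk
    have : 0 < k ^ 3 := by positivity
    omega
  have hc : 0 < c := by
    apply Nat.pos_of_ne_zero
    rintro rfl
    have : 0 < k ^ 3 := by positivity
    omega
  have hXY : X * Y = c * t ^ 3 := by
    apply Nat.eq_of_mul_eq_mul_left hpos
    rw [hy, mul_pow, ← hk]; ring
  obtain ⟨a, b, f, g, hab, -, hf, hg, -⟩ := hco.exists_eq_mul_pow hc hXY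
  exact ⟨a, b, f, g, hab, hf ▸ hX, hg ▸ hY⟩

theorem eq_one_of_sq_mul_add_eight_eq {p q : ℕ} (hp : 0 < p) (h : 1323 * p ^ 6 + 8 = q ^ 3) :
    p = 1 := by
  have hZ : (q : ℤ) ^ 3 - 49 * (3 * (p : ℤ) ^ 2) ^ 3 = 8 := by
    have : (1323 : ℤ) * p ^ 6 + 8 = q ^ 3 := by exact_mod_cast h
    linear_combination -this
  have hp2 : (0 : ℤ) < (p : ℤ) ^ 2 := by positivity
  rcases CbrtSeven.eq_of_cube_sub_fortynine_mul_cube_eq_eight hZ with h0 | h0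
  · omega
  · have h1 : (p : ℤ) ^ 2 = 1 := by omega
    have h2 : p ^ 2 = 1 := by exact_mod_cast h1
    simpa using h2

theorem eq_one_of_pow_six_add_six_eq {p q : ℕ} (h : p ^ 6 + 6 = 7 * q ^ 3) : p = 1 := by
  have hZ : ((p : ℤ) ^ 2) ^ 3 - 7 * (q : ℤ) ^ 3 = -6 := by
    have : (p : ℤ) ^ 6 + 6 = 7 * q ^ 3 := by exact_mod_cast h
    linear_combination this
  have h1 := CbrtSeven.eq_one_of_cube_sub_seven_mul_cube_eq hZ
  have h2 : p ^ 2 = 1 := by exact_mod_cast h1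
  simpa using h2

theorem Nat.eq_of_mul_eq_seven {a b : ℕ} (h : a * b = 7) : a = 7 ∧ b = 1 ∨ a = 1 ∧ b = 7 := by
  have ha := Nat.mem_divisors_of_mul_eq (by norm_num) h
  rw [show Nat.divisors 7 = {1, 7} by decide] at ha
  simp only [Finset.mem_insert, Finset.mem_singleton] at ha
  rcases ha with rfl | rfl <;> omega

theorem Nat.eq_of_mul_eq_twentyone {a b : ℕ} (h : a * b = 21) (h3 : b % 3 ≠ 0) :
    a = 21 ∧ b = 1 ∨ a = 3 ∧ b = 7 := by
  have ha := Nat.mem_divisors_of_mul_eq (by norm_num) h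
  rw [show Nat.divisors 21 = {1, 3, 7, 21} by decide] at ha
  simp only [Finset.mem_insert, Finset.mem_singleton] at ha
  rcases ha with rfl | rfl | rfl | rfl <;> omega

set_option maxHeartbeats 1000000 in
/-- The only `m > 25` for which `49 m (m ^ 2 + 600)` is a cube is `315`. -/
theorem eq_of_fortynine_mul_eq_cube {m y : ℕ} (hm : 26 ≤ m)
    (h : 49 * (m * (m ^ 2 + 600)) = y ^ 3) : m = 315 := by
  have hs2 := sq_add_sixHundred_two_adic m
  have hs3 := sq_add_sixHundred_three_adic m
  have hs5 : m % 5 ≠ 0 ∨ m % 5 = 0 ∧ (m ^ 2 + 600) % 25 = 0 ∧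
      (m % 25 ≠ 0 ∨ (m ^ 2 + 600) % 125 ≠ 0) := by
    have := sq_add_sixHundred_five_adic m
    omega
  have hsq : ∀ A p : ℕ, m = A * p ^ 3 → m ^ 2 = A ^ 2 * p ^ 6 := by
    rintro A p rfl; ring
  rcases hs2 with hs2 | hs2 | hs2 <;> rcases hs3 with hs3 | hs3 <;> rcases hs5 with hs5 | hs5
  · obtain ⟨a, b, f, g, hab, hf, hg⟩ := exists_cube_factors h 1 1 7 7 (by omega)
      (by omega) (by clear hs3 hs5; omega) (by clear hs2 hs5; omega) (by clear hs2 hs3; omega)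
      (by norm_num) (by norm_num)
      (by decide +kernel) (by norm_num)
    clear h hs2 hs3 hs5
    rcases Nat.eq_of_mul_eq_seven hab with ⟨rfl, rfl⟩ | ⟨rfl, rfl⟩
    · have h6 := hsq 7 f (by omega)
      exact absurd (by omega : 49 * f ^ 6 + 600 = 1 * g ^ 3)
        (ne_of_forall_zmod_ne 7 49 1 600 6 3 (by decide) f g)
    · have h6 := hsq 1 f (by omega)
      exact absurd (by omega : 1 * f ^ 6 + 600 = 7 * g ^ 3)
        (ne_of_forall_zmod_ne 7 1 7 600 6 3 (by decide) f g)
  · obtain ⟨a, b, f, g, hab, hf, hg⟩ := exists_cube_factors h 5 25 35 7 (by omega)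
      (by omega) (by clear hs3 hs5; omega) (by clear hs2 hs5; omega) (by clear hs2 hs3; omega)
      (by norm_num) (by norm_num)
      (by decide +kernel) (by norm_num)
    clear h hs2 hs3 hs5
    rcases Nat.eq_of_mul_eq_seven hab with ⟨rfl, rfl⟩ | ⟨rfl, rfl⟩
    · have h6 := hsq 35 f (by omega)
      exact absurd (by omega : 49 * f ^ 6 + 24 = 1 * g ^ 3)
        (ne_of_forall_zmod_ne 7 49 1 24 6 3 (by decide) f g)
    · have h6 := hsq 5 f (by omega)
      exact absurd (by omega : 1 * f ^ 6 + 24 = 7 * g ^ 3)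
        (ne_of_forall_zmod_ne 7 1 7 24 6 3 (by decide) f g)
  · obtain ⟨a, b, f, g, hab, hf, hg⟩ := exists_cube_factors h 3 3 21 21 (by omega)
      (by omega) (by clear hs3 hs5; omega) (by clear hs2 hs5; omega) (by clear hs2 hs3; omega)
      (by norm_num) (by norm_num)
      (by decide +kernel) (by norm_num)
    clear h hs2 hs5
    have hb3 : b % 3 ≠ 0 := by
      intro hb
      obtain ⟨e, rfl⟩ : ∃ e, b = 3 * e := ⟨b / 3, by omega⟩
      rw [mul_assoc] at hg
      omega
    clear hs3
    rcases Nat.eq_of_mul_eq_twentyone hab hb3 with ⟨rfl, rfl⟩ | ⟨rfl, rfl⟩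
    · have h6 := hsq 63 f (by omega)
      exact absurd (by omega : 1323 * f ^ 6 + 200 = 1 * g ^ 3)
        (ne_of_forall_zmod_ne 7 1323 1 200 6 3 (by decide) f g)
    · have h6 := hsq 9 f (by omega)
      exact absurd (by omega : 27 * f ^ 6 + 200 = 7 * g ^ 3)
        (ne_of_forall_zmod_ne 7 27 7 200 6 3 (by decide) f g)
  · obtain ⟨a, b, f, g, hab, hf, hg⟩ := exists_cube_factors h 15 75 105 21 (by omega)
      (by omega) (by clear hs3 hs5; omega) (by clear hs2 hs5; omega) (by clear hs2 hs3; omega)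
      (by norm_num) (by norm_num)
      (by decide +kernel) (by norm_num)
    clear h hs2 hs5
    have hb3 : b % 3 ≠ 0 := by
      intro hb
      obtain ⟨e, rfl⟩ : ∃ e, b = 3 * e := ⟨b / 3, by omega⟩
      rw [mul_assoc] at hg
      omega
    clear hs3
    rcases Nat.eq_of_mul_eq_twentyone hab hb3 with ⟨rfl, rfl⟩ | ⟨rfl, rfl⟩
    · have h6 := hsq 315 f (by omega)
      have hf0 : 0 < f := by
        rcases Nat.eq_zero_or_pos f with rfl | h0
        · omega
        · exact h0
      have hf1 : f = 1 := eq_one_of_sq_mul_add_eight_eq (q := g) hf0 (by omega)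
      subst hf1
      omega
    · have h6 := hsq 45 f (by omega)
      exact absurd (by omega : 27 * f ^ 6 + 8 = 7 * g ^ 3)
        (ne_of_forall_zmod_ne 9 27 7 8 6 3 (by decide) f g)
  · obtain ⟨a, b, f, g, hab, hf, hg⟩ := exists_cube_factors h 2 4 14 7 (by omega)
      (by omega) (by clear hs3 hs5; omega) (by clear hs2 hs5; omega) (by clear hs2 hs3; omega)
      (by norm_num) (by norm_num)
      (by decide +kernel) (by norm_num)
    clear h hs2 hs3 hs5
    rcases Nat.eq_of_mul_eq_seven hab with ⟨rfl, rfl⟩ | ⟨rfl, rfl⟩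
    · have h6 := hsq 14 f (by omega)
      exact absurd (by omega : 49 * f ^ 6 + 150 = 1 * g ^ 3)
        (ne_of_forall_zmod_ne 7 49 1 150 6 3 (by decide) f g)
    · have h6 := hsq 2 f (by omega)
      exact absurd (by omega : 1 * f ^ 6 + 150 = 7 * g ^ 3)
        (ne_of_forall_zmod_ne 7 1 7 150 6 3 (by decide) f g)
  · obtain ⟨a, b, f, g, hab, hf, hg⟩ := exists_cube_factors h 10 100 70 7 (by omega)
      (by omega) (by clear hs3 hs5; omega) (by clear hs2 hs5; omega) (by clear hs2 hs3; omega)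
      (by norm_num) (by norm_num)
      (by decide +kernel) (by norm_num)
    clear h hs2 hs3 hs5
    rcases Nat.eq_of_mul_eq_seven hab with ⟨rfl, rfl⟩ | ⟨rfl, rfl⟩
    · have h6 := hsq 70 f (by omega)
      exact absurd (by omega : 49 * f ^ 6 + 6 = 1 * g ^ 3)
        (ne_of_forall_zmod_ne 13 49 1 6 6 3 (by decide) f g)
    · have h6 := hsq 10 f (by omega)
      have hf1 : f = 1 := eq_one_of_pow_six_add_six_eq (q := g) (by omega)
      subst hf1
      omega
  · obtain ⟨a, b, f, g, hab, hf, hg⟩ := exists_cube_factors h 6 12 42 21 (by omega)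
      (by omega) (by clear hs3 hs5; omega) (by clear hs2 hs5; omega) (by clear hs2 hs3; omega)
      (by norm_num) (by norm_num)
      (by decide +kernel) (by norm_num)
    clear h hs2 hs5
    have hb3 : b % 3 ≠ 0 := by
      intro hb
      obtain ⟨e, rfl⟩ : ∃ e, b = 3 * e := ⟨b / 3, by omega⟩
      rw [mul_assoc] at hg
      omega
    clear hs3
    rcases Nat.eq_of_mul_eq_twentyone hab hb3 with ⟨rfl, rfl⟩ | ⟨rfl, rfl⟩
    · have h6 := hsq 126 f (by omega)
      exact absurd (by omega : 1323 * f ^ 6 + 50 = 1 * g ^ 3)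
        (ne_of_forall_zmod_ne 9 1323 1 50 6 3 (by decide) f g)
    · have h6 := hsq 18 f (by omega)
      exact absurd (by omega : 27 * f ^ 6 + 50 = 7 * g ^ 3)
        (ne_of_forall_zmod_ne 9 27 7 50 6 3 (by decide) f g)
  · obtain ⟨a, b, f, g, hab, hf, hg⟩ := exists_cube_factors h 30 300 210 21 (by omega)
      (by omega) (by clear hs3 hs5; omega) (by clear hs2 hs5; omega) (by clear hs2 hs3; omega)
      (by norm_num) (by norm_num)
      (by decide +kernel) (by norm_num)
    clear h hs2 hs5
    have hb3 : b % 3 ≠ 0 := by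
      intro hb
      obtain ⟨e, rfl⟩ : ∃ e, b = 3 * e := ⟨b / 3, by omega⟩
      rw [mul_assoc] at hg
      omega
    clear hs3
    rcases Nat.eq_of_mul_eq_twentyone hab hb3 with ⟨rfl, rfl⟩ | ⟨rfl, rfl⟩
    · have h6 := hsq 630 f (by omega)
      exact absurd (by omega : 1323 * f ^ 6 + 2 = 1 * g ^ 3)
        (ne_of_forall_zmod_ne 7 1323 1 2 6 3 (by decide) f g)
    · have h6 := hsq 90 f (by omega)
      exact absurd (by omega : 27 * f ^ 6 + 2 = 7 * g ^ 3)
        (ne_of_forall_zmod_ne 7 27 7 2 6 3 (by decide) f g)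
  · obtain ⟨a, b, f, g, hab, hf, hg⟩ := exists_cube_factors h 1 8 14 7 (by omega)
      (by omega) (by clear hs3 hs5; omega) (by clear hs2 hs5; omega) (by clear hs2 hs3; omega)
      (by norm_num) (by norm_num)
      (by decide +kernel) (by norm_num)
    clear h hs2 hs3 hs5
    rcases Nat.eq_of_mul_eq_seven hab with ⟨rfl, rfl⟩ | ⟨rfl, rfl⟩
    · have h6 := hsq 7 f (by omega)
      exact absurd (by omega : 49 * f ^ 6 + 600 = 8 * g ^ 3)
        (ne_of_forall_zmod_ne 7 49 8 600 6 3 (by decide) f g)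
    · have h6 := hsq 1 f (by omega)
      exact absurd (by omega : 1 * f ^ 6 + 600 = 56 * g ^ 3)
        (ne_of_forall_zmod_ne 7 1 56 600 6 3 (by decide) f g)
  · obtain ⟨a, b, f, g, hab, hf, hg⟩ := exists_cube_factors h 5 200 70 7 (by omega)
      (by omega) (by clear hs3 hs5; omega) (by clear hs2 hs5; omega) (by clear hs2 hs3; omega)
      (by norm_num) (by norm_num)
      (by decide +kernel) (by norm_num)
    clear h hs2 hs3 hs5
    rcases Nat.eq_of_mul_eq_seven hab with ⟨rfl, rfl⟩ | ⟨rfl, rfl⟩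
    · have h6 := hsq 35 f (by omega)
      exact absurd (by omega : 49 * f ^ 6 + 24 = 8 * g ^ 3)
        (ne_of_forall_zmod_ne 7 49 8 24 6 3 (by decide) f g)
    · have h6 := hsq 5 f (by omega)
      exact absurd (by omega : 1 * f ^ 6 + 24 = 56 * g ^ 3)
        (ne_of_forall_zmod_ne 7 1 56 24 6 3 (by decide) f g)
  · obtain ⟨a, b, f, g, hab, hf, hg⟩ := exists_cube_factors h 3 24 42 21 (by omega)
      (by omega) (by clear hs3 hs5; omega) (by clear hs2 hs5; omega) (by clear hs2 hs3; omega)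
      (by norm_num) (by norm_num)
      (by decide +kernel) (by norm_num)
    clear h hs2 hs5
    have hb3 : b % 3 ≠ 0 := by
      intro hb
      obtain ⟨e, rfl⟩ : ∃ e, b = 3 * e := ⟨b / 3, by omega⟩
      rw [mul_assoc] at hg
      omega
    clear hs3
    rcases Nat.eq_of_mul_eq_twentyone hab hb3 with ⟨rfl, rfl⟩ | ⟨rfl, rfl⟩
    · have h6 := hsq 63 f (by omega)
      exact absurd (by omega : 1323 * f ^ 6 + 200 = 8 * g ^ 3)
        (ne_of_forall_zmod_ne 7 1323 8 200 6 3 (by decide) f g)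
    · have h6 := hsq 9 f (by omega)
      exact absurd (by omega : 27 * f ^ 6 + 200 = 56 * g ^ 3)
        (ne_of_forall_zmod_ne 7 27 56 200 6 3 (by decide) f g)
  · obtain ⟨a, b, f, g, hab, hf, hg⟩ := exists_cube_factors h 15 600 210 21 (by omega)
      (by omega) (by clear hs3 hs5; omega) (by clear hs2 hs5; omega) (by clear hs2 hs3; omega)
      (by norm_num) (by norm_num)
      (by decide +kernel) (by norm_num)
    clear h hs2 hs5
    have hb3 : b % 3 ≠ 0 := by
      intro hb
      obtain ⟨e, rfl⟩ : ∃ e, b = 3 * e := ⟨b / 3, by omega⟩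
      rw [mul_assoc] at hg
      omega
    clear hs3
    rcases Nat.eq_of_mul_eq_twentyone hab hb3 with ⟨rfl, rfl⟩ | ⟨rfl, rfl⟩
    · have h6 := hsq 315 f (by omega)
      have hf0 : 0 < f := by
        rcases Nat.eq_zero_or_pos f with rfl | h0
        · omega
        · exact h0
      have hg8 : (2 * g) ^ 3 = 8 * g ^ 3 := by ring
      have hf1 : f = 1 := eq_one_of_sq_mul_add_eight_eq (q := 2 * g) hf0 (by omega)
      subst hf1
      omega
    · have h6 := hsq 45 f (by omega)
      exact absurd (by omega : 27 * f ^ 6 + 8 = 56 * g ^ 3)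
        (ne_of_forall_zmod_ne 9 27 56 8 6 3 (by decide) f g)

/-- Thue's lemma, in the form giving a vector of small norm for `a ^ 2 + 6 b ^ 2`. -/
theorem exists_dvd_sub_mul_and_sq_add_six_mul_sq_lt {q : ℕ} (hq : 0 < q) (n : ℤ) :
    ∃ a b : ℤ, (q : ℤ) ∣ b - n * a ∧ 0 < a ^ 2 + 6 * b ^ 2 ∧ a ^ 2 + 6 * b ^ 2 < 7 * q := by
  have : NeZero q := ⟨hq.ne'⟩
  set s := Nat.sqrt q with hs
  set B := q / (s + 1) with hB
  have hcard : (Finset.univ : Finset (ZMod q)).card <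
      (Finset.range (s + 1) ×ˢ Finset.range (B + 1)).card := by
    rw [Finset.card_univ, ZMod.card, Finset.card_product, Finset.card_range, Finset.card_range]
    exact Nat.lt_mul_div_succ q (Nat.succ_pos s)
  obtain ⟨⟨i, j⟩, hij, ⟨i', j'⟩, hij', hne, heq⟩ :=
    Finset.exists_ne_map_eq_of_card_lt_of_maps_to hcard
      (f := fun v : ℕ × ℕ => ((v.2 : ZMod q) - (n : ZMod q) * v.1)) (fun _ _ => Finset.mem_univ _)
  simp only [Finset.mem_product, Finset.mem_range] at hij hij'
  refine ⟨(i : ℤ) - i', (j : ℤ) - j', ?_, ?_, ?_⟩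
  · rw [← ZMod.intCast_zmod_eq_zero_iff_dvd]
    push_cast
    linear_combination heq
  · by_contra hcon
    have h1 := sq_nonneg ((i : ℤ) - i')
    have h2 := sq_nonneg ((j : ℤ) - j')
    have h3 : ((i : ℤ) - i') ^ 2 = 0 := by linarith
    have h4 : ((j : ℤ) - j') ^ 2 = 0 := by linarith
    rw [sq_eq_zero_iff] at h3 h4
    apply hne
    rw [Prod.mk.injEq]
    omega
  · have hs2 : s ^ 2 ≤ q := Nat.sqrt_le' q
    have hs3 : q < (s + 1) ^ 2 := Nat.lt_succ_sqrt' q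
    have hBs : B * (s + 1) ≤ q := Nat.div_mul_le_self q (s + 1)
    have hBs' : B ≤ s := by nlinarith
    have h1 : ((i : ℤ) - i') ^ 2 ≤ (s : ℤ) ^ 2 := sq_le_sq' (by omega) (by omega)
    have h2 : ((j : ℤ) - j') ^ 2 ≤ (B : ℤ) ^ 2 := sq_le_sq' (by omega) (by omega)
    have h3 : s ^ 2 + 6 * B ^ 2 < 7 * q := by
      rcases Nat.eq_zero_or_pos B with h0 | h0
      · rw [h0]; omega
      · nlinarith
    have h4 : (s : ℤ) ^ 2 + 6 * (B : ℤ) ^ 2 < 7 * q := by exact_mod_cast h3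
    linarith

namespace Zsqrtd

theorem norm_neg_six (z : ℤ√(-6)) : z.norm = z.re ^ 2 + 6 * z.im ^ 2 := by
  rw [Zsqrtd.norm_def]; ring

theorem norm_pow' {d : ℤ} (z : ℤ√d) (k : ℕ) : (z ^ k).norm = z.norm ^ k := by
  induction k with
  | zero => simp
  | succ k ih => rw [pow_succ, pow_succ, Zsqrtd.norm_mul, ih]

/-- If `α` has norm `q ^ ℓ` and `γ` lies in the ideal `(q, α)`, then `q ^ ℓ` divides
`α * star γ ^ ℓ`. -/
theorem pow_dvd_mul_star_pow {d : ℤ} {α γ : ℤ√d} {q : ℤ} {ℓ : ℕ} (hα : α.norm = q ^ ℓ)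
    (x y : ℤ√d) (hγ : γ = x * α + y * (q : ℤ√d)) : ((q : ℤ√d) ^ ℓ) ∣ α * star γ ^ ℓ := by
  have h1 : star γ = star x * star α + star y * (q : ℤ√d) := by
    rw [hγ, star_add, star_mul, star_mul]
    have : star (q : ℤ√d) = q := by ext <;> simp
    rw [this]; ring
  have h2 : star γ - star y * (q : ℤ√d) ∣ star γ ^ ℓ - (star y * (q : ℤ√d)) ^ ℓ :=
    sub_dvd_pow_sub_pow _ _ _
  obtain ⟨w, hw⟩ := h2
  have h3 : α * star α = (q : ℤ√d) ^ ℓ := by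
    rw [← Zsqrtd.norm_eq_mul_conj, hα]; push_cast; rfl
  refine ⟨star x * w + α * star y ^ ℓ, ?_⟩
  have h4 : star γ ^ ℓ = star x * star α * w + (star y * (q : ℤ√d)) ^ ℓ := by
    have : star γ - star y * (q : ℤ√d) = star x * star α := by rw [h1]; ring
    rw [this] at hw
    rw [← hw]; ring
  rw [h4, mul_pow, ← h3]; ring

end Zsqrtd

theorem sq_add_six_mul_sq_ne_of_mod_three {A B N : ℤ} (hN : N % 3 = 2) : A ^ 2 + 6 * B ^ 2 ≠ N := by
  intro h
  have : A % 3 = 0 ∨ A % 3 = 1 ∨ A % 3 = 2 := by omega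
  have h3 : (A ^ 2) % 3 = 2 := by omega
  rcases this with h0 | h0 | h0 <;> simp [pow_two, Int.mul_emod, h0] at h3

theorem sq_add_six_mul_sq_ne_of_mod_eight {A B N : ℤ} (hN : N % 8 = 3) : A ^ 2 + 6 * B ^ 2 ≠ N := by
  intro h
  have key : ∀ x y : ZMod 8, x ^ 2 + 6 * y ^ 2 ≠ 3 := by decide
  apply key A B
  have h1 : ((N : ℤ) : ZMod 8) = ((3 : ℤ) : ZMod 8) :=
    (ZMod.intCast_eq_intCast_iff' N 3 8).2 (by push_cast; omega)
  have h2 := congrArg (Int.cast : ℤ → ZMod 8) h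
  push_cast at h1 h2
  rw [h2, h1]

theorem pow_odd_modEq_self {x N : ℤ} (h : x ^ 2 ≡ 1 [ZMOD N]) (e : ℕ) :
    x ^ (2 * e + 1) ≡ x [ZMOD N] := by
  have := (h.pow e).mul_right x
  rwa [one_pow, one_mul, ← pow_mul, ← pow_succ] at this

/-- A generator of the ideal `(q, 1 + n √-6)` when its odd power is principal. -/
theorem exists_sq_add_six_mul_sq_eq {ℓ : ℕ} (hℓ : Odd ℓ) {n : ℤ} {q : ℕ}
    (h : 6 * n ^ 2 + 1 = (q : ℤ) ^ ℓ) :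
    ∃ a b : ℤ, (q : ℤ) ∣ b - n * a ∧ a ^ 2 + 6 * b ^ 2 = q := by
  have hℓ0 : ℓ ≠ 0 := by rintro rfl; simp at hℓ
  have hq : 0 < q := by
    apply Nat.pos_of_ne_zero
    rintro rfl
    rw [Nat.cast_zero, zero_pow hℓ0] at h
    nlinarith [sq_nonneg n]
  have hqdvd : (q : ℤ) ∣ 6 * n ^ 2 + 1 := h ▸ dvd_pow_self _ hℓ0
  have hq2 : ¬ (2 : ℤ) ∣ q := by
    intro hd
    have := hd.trans hqdvd
    omega
  obtain ⟨a, b, hab, hpos, hlt⟩ := exists_dvd_sub_mul_and_sq_add_six_mul_sq_lt hq n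
  have hdvd : (q : ℤ) ∣ a ^ 2 + 6 * b ^ 2 := by
    obtain ⟨s, hs⟩ := hab
    obtain ⟨r, hr⟩ := hqdvd
    refine ⟨a ^ 2 * r + 12 * n * a * s + 6 * q * s ^ 2, ?_⟩
    have hb : b = n * a + q * s := by linarith
    rw [hb]
    linear_combination a ^ 2 * hr
  obtain ⟨j, hj⟩ := hdvd
  have hqZ : (0 : ℤ) < q := by exact_mod_cast hq
  have hj0 : 0 < j := by
    by_contra hcon
    nlinarith
  have hj7 : j < 7 := by
    by_contra hcon
    nlinarith
  have hnorm : ∃ A B : ℤ, A ^ 2 + 6 * B ^ 2 = j ^ ℓ := by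
    obtain ⟨s, hs⟩ := hab
    have hα : (⟨1, n⟩ : ℤ√(-6)).norm = (q : ℤ) ^ ℓ := by
      rw [Zsqrtd.norm_neg_six, ← h]; ring
    have hγ : (⟨a, b⟩ : ℤ√(-6)) = (a : ℤ√(-6)) * ⟨1, n⟩ + ⟨0, s⟩ * ((q : ℤ) : ℤ√(-6)) := by
      ext
      · simp
      · simp; linarith
    obtain ⟨δ, hδ⟩ := Zsqrtd.pow_dvd_mul_star_pow hα _ _ hγ
    have hN := congrArg Zsqrtd.norm hδ
    rw [Zsqrtd.norm_mul, Zsqrtd.norm_mul, Zsqrtd.norm_pow', Zsqrtd.norm_pow', hα,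
      Zsqrtd.norm_conj, Zsqrtd.norm_intCast, Zsqrtd.norm_neg_six, Zsqrtd.norm_neg_six] at hN
    simp only at hN
    rw [hj, mul_pow, mul_pow] at hN
    refine ⟨δ.re, δ.im, ?_⟩
    have hqp : ((q : ℤ) ^ ℓ * (q : ℤ) ^ ℓ) ≠ 0 := by positivity
    apply mul_left_cancel₀ hqp
    rw [← hN]; ring
  obtain ⟨A, B, hAB⟩ := hnorm
  obtain ⟨e, he⟩ := hℓ
  interval_cases j
  · exact ⟨a, b, hab, by linarith⟩
  · exfalso
    refine sq_add_six_mul_sq_ne_of_mod_three ?_ hAB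
    exact he ▸ pow_odd_modEq_self (by decide) e
  · exfalso
    refine sq_add_six_mul_sq_ne_of_mod_eight ?_ hAB
    exact he ▸ pow_odd_modEq_self (by decide) e
  · have ha2 : (2 : ℤ) ∣ a := by
      apply Int.prime_two.dvd_of_dvd_pow (n := 2)
      exact ⟨2 * q - 3 * b ^ 2, by linarith⟩
    obtain ⟨a', rfl⟩ := ha2
    have hb2 : (2 : ℤ) ∣ b := by
      apply Int.prime_two.dvd_of_dvd_pow (n := 2)
      have : (2 * a') ^ 2 = 4 * a' ^ 2 := by ring
      omega
    obtain ⟨b', rfl⟩ := hb2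
    refine ⟨a', b', ?_, by nlinarith⟩
    have hc : IsCoprime (q : ℤ) 2 := (Int.isCoprime_two_right).2 (by
      rw [← Int.not_even_iff_odd, even_iff_two_dvd]; exact hq2)
    exact hc.dvd_of_dvd_mul_left (by rwa [show 2 * (b' - n * a') = 2 * b' - n * (2 * a') by ring])
  · exfalso
    refine sq_add_six_mul_sq_ne_of_mod_three ?_ hAB
    exact he ▸ pow_odd_modEq_self (by decide) e
  · have ha2 : (2 : ℤ) ∣ a := by
      apply Int.prime_two.dvd_of_dvd_pow (n := 2)
      exact ⟨3 * q - 3 * b ^ 2, by linarith⟩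
    have ha3 : (3 : ℤ) ∣ a := by
      apply Int.prime_three.dvd_of_dvd_pow (n := 2)
      exact ⟨2 * q - 2 * b ^ 2, by linarith⟩
    obtain ⟨c, rfl⟩ : ∃ c, a = 6 * c := ⟨a / 6, by omega⟩
    refine ⟨b, -c, ?_, by nlinarith⟩
    obtain ⟨s, hs⟩ := hab
    obtain ⟨r, hr⟩ := hqdvd
    refine ⟨-(c * r) - n * s, ?_⟩
    linear_combination -n * hs - c * hr

namespace Zsqrtd

theorem re_sum {d : ℤ} {ι : Type*} (s : Finset ι) (f : ι → ℤ√d) :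
    (∑ i ∈ s, f i).re = ∑ i ∈ s, (f i).re :=
  map_sum (⟨⟨Zsqrtd.re, rfl⟩, fun _ _ => rfl⟩ : ℤ√d →+ ℤ) f s

theorem pow_two_mul_of_re_eq_zero {d : ℤ} (c : ℤ) (k : ℕ) :
    (⟨0, c⟩ : ℤ√d) ^ (2 * k) = (((d * c ^ 2) ^ k : ℤ) : ℤ√d) := by
  rw [pow_mul]
  have : (⟨0, c⟩ : ℤ√d) ^ 2 = ((d * c ^ 2 : ℤ) : ℤ√d) := by
    rw [pow_two]; ext
    · rw [Zsqrtd.re_intCast, Zsqrtd.re_mul]; ring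
    · rw [Zsqrtd.im_intCast, Zsqrtd.im_mul]; ring
  rw [this]; push_cast; rfl

theorem re_pow_odd_of_re_eq_zero {d : ℤ} (c : ℤ) (k : ℕ) :
    ((⟨0, c⟩ : ℤ√d) ^ (2 * k + 1)).re = 0 := by
  rw [pow_succ, pow_two_mul_of_re_eq_zero, Zsqrtd.re_mul, Zsqrtd.im_intCast]
  ring

theorem one_add_pow_modEq (c : ℤ) (k : ℕ) :
    ((⟨1, c⟩ : ℤ√(-6)) ^ k).re ≡ 1 [ZMOD 6] ∧ ((⟨1, c⟩ : ℤ√(-6)) ^ k).im ≡ k * c [ZMOD 6] := by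
  induction k with
  | zero => simp
  | succ k ih =>
    obtain ⟨⟨r, hr⟩, ⟨s, hs⟩⟩ := And.imp (fun h => h.dvd) (fun h => h.dvd) ih
    rw [pow_succ]
    generalize (⟨1, c⟩ : ℤ√(-6)) ^ k = z at *
    constructor
    · apply Int.modEq_of_dvd
      refine ⟨r + z.im * c, ?_⟩
      simp
      linear_combination hr
    · apply Int.modEq_of_dvd
      refine ⟨s + r * c, ?_⟩
      simp
      linear_combination hs + c * hr

theorem re_pow_eq_sum (c : ℤ) (k : ℕ) :
    ((⟨1, c⟩ : ℤ√(-6)) ^ (k + 2)).re = 1 + (k + 2).choose 2 * (-6 * c ^ 2) +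
      ∑ i ∈ Finset.range k, ((⟨0, c⟩ : ℤ√(-6)) ^ (i + 3)).re * (k + 2).choose (i + 3) := by
  have h1 : (⟨1, c⟩ : ℤ√(-6)) = ⟨0, c⟩ + 1 := by ext <;> simp
  have h2 : ∀ i, (((⟨0, c⟩ : ℤ√(-6)) ^ i) * 1 ^ (k + 2 - i) * ((k + 2).choose i : ℤ√(-6))).re =
      ((⟨0, c⟩ : ℤ√(-6)) ^ i).re * (k + 2).choose i := by
    intro i; simp
  rw [h1, add_pow, re_sum, Finset.sum_congr rfl (fun i _ => h2 i), Finset.sum_range_succ',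
    Finset.sum_range_succ', Finset.sum_range_succ']
  have h3 : ((⟨0, c⟩ : ℤ√(-6)) ^ 2).re = -6 * c ^ 2 := by rw [pow_two]; simp; ring
  simp [h3]
  ring

end Zsqrtd

theorem mul_two_mul_sub_one_lt_pow (k : ℕ) : (k + 2) * (2 * k + 3) < 3 ^ (3 * k + 2) + 1 := by
  induction k with
  | zero => norm_num
  | succ k ih =>
    have : 3 ^ (3 * (k + 1) + 2) = 27 * 3 ^ (3 * k + 2) := by ring
    rw [this]
    nlinarith

theorem choose_mul_eq (m k : ℕ) :
    (m + 2).choose (2 * k + 4) * ((k + 2) * (2 * k + 3)) =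
      (m + 2).choose 2 * m.choose (2 * k + 2) := by
  have h1 := Nat.add_one_mul_choose_eq (m + 1) (2 * k + 3)
  have h2 := Nat.add_one_mul_choose_eq m (2 * k + 2)
  have h3 : (m + 2).choose 2 * 2 = (m + 2) * (m + 1) := by
    have := Nat.add_one_mul_choose_eq (m + 1) 1
    rw [Nat.choose_one_right] at this
    linarith
  apply Nat.eq_of_mul_eq_mul_right (by norm_num : 0 < 2)
  calc (m + 2).choose (2 * k + 4) * ((k + 2) * (2 * k + 3)) * 2
      = ((m + 2).choose (2 * k + 4) * (2 * k + 4)) * (2 * k + 3) := by ring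
    _ = ((m + 2) * (m + 1).choose (2 * k + 3)) * (2 * k + 3) := by rw [← h1]
    _ = (m + 2) * ((m + 1).choose (2 * k + 3) * (2 * k + 3)) := by ring
    _ = (m + 2) * ((m + 1) * m.choose (2 * k + 2)) := by rw [← h2]
    _ = (m + 2).choose 2 * m.choose (2 * k + 2) * 2 := by
      rw [← mul_assoc, ← h3]; ring

/-- The 3-adic valuation of the higher binomial terms exceeds that of the quadratic one. -/
theorem three_pow_dvd_choose_mul_pow (m k e : ℕ) (he : 3 ^ e ∣ (m + 2).choose 2) :
    3 ^ (e + 1) ∣ (m + 2).choose (2 * k + 4) * 27 ^ (k + 1) := by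
  rcases Nat.eq_zero_or_pos ((m + 2).choose (2 * k + 4)) with h0 | h0
  · rw [h0, zero_mul]; exact dvd_zero _
  have hw0 : (k + 2) * (2 * k + 3) ≠ 0 := by positivity
  obtain ⟨f, w, hw, hfw⟩ := Nat.exists_eq_pow_mul_and_not_dvd hw0 3 (by norm_num)
  have hf : f ≤ 3 * k + 2 := by
    have hle : 3 ^ f ≤ (k + 2) * (2 * k + 3) := Nat.le_of_dvd (by positivity) (hfw ▸ Dvd.intro _ rfl)
    have := mul_two_mul_sub_one_lt_pow k
    exact (Nat.pow_le_pow_iff_right (by norm_num : 1 < 3)).1 (by omega)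
  have h1 : 3 ^ e ∣ (m + 2).choose (2 * k + 4) * 3 ^ f := by
    have : 3 ^ e ∣ (m + 2).choose (2 * k + 4) * 3 ^ f * w := by
      rw [mul_assoc, ← hfw, choose_mul_eq]
      exact he.mul_right _
    refine Nat.Coprime.dvd_of_dvd_mul_right ?_ this
    exact Nat.Coprime.pow_left e ((Nat.prime_three.coprime_iff_not_dvd).2 hw)
  obtain ⟨g, hg⟩ : ∃ g, 3 * (k + 1) = f + 1 + g := ⟨3 * (k + 1) - (f + 1), by omega⟩
  have h27 : (27 : ℕ) ^ (k + 1) = 3 ^ f * (3 * 3 ^ g) := by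
    rw [show (27 : ℕ) = 3 ^ 3 by norm_num, ← pow_mul, hg]; ring
  rw [h27, ← mul_assoc, pow_succ]
  exact mul_dvd_mul h1 (Dvd.intro _ rfl)

theorem re_one_add_pow_ne_one {c : ℤ} (hc : c ≠ 0) (h3 : 3 ∣ c) (k : ℕ) :
    ((⟨1, c⟩ : ℤ√(-6)) ^ (k + 2)).re ≠ 1 := by
  intro h
  rw [Zsqrtd.re_pow_eq_sum] at h
  set E : ℤ := -6 * c ^ 2 with hE
  have hE0 : E ≠ 0 := by
    rw [hE]; exact mul_ne_zero (by norm_num) (pow_ne_zero _ hc)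
  have h27 : (27 : ℤ) ∣ E := by
    obtain ⟨t, rfl⟩ := h3
    exact ⟨-2 * t ^ 2, by rw [hE]; ring⟩
  have hD0 : (k + 2).choose 2 ≠ 0 := (Nat.choose_pos (by omega)).ne'
  obtain ⟨e, D, hD, hDe⟩ := Nat.exists_eq_pow_mul_and_not_dvd hD0 3 (by norm_num)
  have hterm : ∀ i ∈ Finset.range k, (3 ^ (e + 1) * E : ℤ) ∣
      ((⟨0, c⟩ : ℤ√(-6)) ^ (i + 3)).re * (k + 2).choose (i + 3) := by
    intro i _
    rcases Nat.even_or_odd' i with ⟨j, rfl | rfl⟩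
    · rw [show 2 * j + 3 = 2 * (j + 1) + 1 by ring, Zsqrtd.re_pow_odd_of_re_eq_zero, zero_mul]
      exact dvd_zero _
    · rw [show 2 * j + 1 + 3 = 2 * (j + 2) by ring, Zsqrtd.pow_two_mul_of_re_eq_zero,
        Zsqrtd.re_intCast, ← hE]
      have h1 := three_pow_dvd_choose_mul_pow k j e (hDe ▸ Dvd.intro _ rfl)
      have h2 : ((3 ^ (e + 1) : ℕ) : ℤ) ∣ (((k + 2).choose (2 * j + 4) * 27 ^ (j + 1) : ℕ) : ℤ) :=
        Int.natCast_dvd_natCast.2 h1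
      push_cast at h2
      have h3 : (3 ^ (e + 1) : ℤ) ∣ ((k + 2).choose (2 * j + 4) : ℤ) * E ^ (j + 1) :=
        h2.trans (mul_dvd_mul_left _ (pow_dvd_pow_of_dvd h27 _))
      have := mul_dvd_mul_right h3 E
      rw [mul_assoc, ← pow_succ] at this
      rw [mul_comm (E ^ (j + 2))]
      exact this
  have hsum := Finset.dvd_sum hterm
  have h4 : (3 ^ (e + 1) * E : ℤ) ∣ ((k + 2).choose 2 : ℤ) * E := by
    have h5 : ((k + 2).choose 2 : ℤ) * E = -(∑ i ∈ Finset.range k,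
        ((⟨0, c⟩ : ℤ√(-6)) ^ (i + 3)).re * (k + 2).choose (i + 3)) := by linarith
    rw [h5]
    exact (dvd_neg).2 hsum
  have h6 : ((3 ^ (e + 1) : ℕ) : ℤ) ∣ (((k + 2).choose 2 : ℕ) : ℤ) := by
    push_cast
    exact Int.dvd_of_mul_dvd_mul_right hE0 h4
  have h7 := Int.natCast_dvd_natCast.1 h6
  rw [hDe, pow_succ] at h7
  exact hD (Nat.dvd_of_mul_dvd_mul_left (by positivity) h7)

/-- `6 n ^ 2 + 1` is not an odd prime power `q ^ ℓ` with `ℓ ≥ 5` when `n` is a nonzero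
multiple of three. -/
theorem six_mul_sq_add_one_ne_pow {ℓ : ℕ} (hℓ : ℓ.Prime) (h5 : 5 ≤ ℓ) {n : ℤ} (hn : n ≠ 0)
    (h3 : 3 ∣ n) (q : ℕ) : 6 * n ^ 2 + 1 ≠ (q : ℤ) ^ ℓ := by
  intro h
  have hodd : Odd ℓ := hℓ.odd_of_ne_two (by omega)
  obtain ⟨a, b, ⟨s, hs⟩, hab⟩ := exists_sq_add_six_mul_sq_eq hodd h
  have hq0 : (q : ℤ) ≠ 0 := by
    intro h0
    rw [h0, zero_pow (by omega)] at h
    nlinarith [sq_nonneg n]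
  have hα : (⟨1, n⟩ : ℤ√(-6)).norm = (q : ℤ) ^ ℓ := by
    rw [Zsqrtd.norm_neg_six, ← h]; ring
  have hγ : (⟨a, b⟩ : ℤ√(-6)) = (a : ℤ√(-6)) * ⟨1, n⟩ + ⟨0, s⟩ * ((q : ℤ) : ℤ√(-6)) := by
    ext
    · simp
    · simp; linarith
  obtain ⟨δ, hδ⟩ := Zsqrtd.pow_dvd_mul_star_pow hα _ _ hγ
  have hγn : (⟨a, b⟩ : ℤ√(-6)).norm = q := by rw [Zsqrtd.norm_neg_six]; exact hab
  have hδn : δ.re ^ 2 + 6 * δ.im ^ 2 = 1 := by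
    have hN := congrArg Zsqrtd.norm hδ
    rw [Zsqrtd.norm_mul, Zsqrtd.norm_mul, Zsqrtd.norm_pow', Zsqrtd.norm_pow', hα,
      Zsqrtd.norm_conj, Zsqrtd.norm_intCast, hγn, Zsqrtd.norm_neg_six, mul_pow] at hN
    have hqp : ((q : ℤ) ^ ℓ * (q : ℤ) ^ ℓ) ≠ 0 := by positivity
    apply mul_left_cancel₀ hqp
    rw [← hN]; ring
  have him : δ.im = 0 := by
    by_contra h0
    have : 0 < δ.im ^ 2 := by positivity
    nlinarith [sq_nonneg δ.re]
  have hre : δ.re ^ 2 = 1 := by rw [him] at hδn; linarith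
  have hδ' : δ = (δ.re : ℤ√(-6)) := by ext <;> simp [him]
  have hαγ : (⟨1, n⟩ : ℤ√(-6)) = (δ.re : ℤ√(-6)) * ⟨a, b⟩ ^ ℓ := by
    have h1 : (((q : ℤ) ^ ℓ : ℤ) : ℤ√(-6)) * ⟨1, n⟩ =
        (((q : ℤ) ^ ℓ : ℤ) : ℤ√(-6)) * ((δ.re : ℤ√(-6)) * ⟨a, b⟩ ^ ℓ) := by
      rw [← hδ']
      have h2 : (((q : ℤ) : ℤ√(-6))) = ⟨a, b⟩ * star ⟨a, b⟩ := by
        rw [← Zsqrtd.norm_eq_mul_conj, hγn]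
      push_cast
      calc ((q : ℤ) : ℤ√(-6)) ^ ℓ * ⟨1, n⟩
          = (⟨1, n⟩ * star ⟨a, b⟩ ^ ℓ) * ⟨a, b⟩ ^ ℓ := by rw [h2, mul_pow]; ring
        _ = _ := by rw [hδ]; push_cast; ring
    exact Zsqrtd.eq_of_smul_eq_smul_left (pow_ne_zero ℓ hq0) h1
  have ha_dvd : a ∣ (⟨1, n⟩ : ℤ√(-6)).re := by
    have h1 : (⟨a, b⟩ : ℤ√(-6)) - ⟨0, b⟩ ∣ ⟨a, b⟩ ^ ℓ - ⟨0, b⟩ ^ ℓ := sub_dvd_pow_sub_pow _ _ _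
    have h2 : (⟨a, b⟩ : ℤ√(-6)) - ⟨0, b⟩ = (a : ℤ√(-6)) := by ext <;> simp
    rw [h2, Zsqrtd.intCast_dvd] at h1
    obtain ⟨e, he⟩ := hodd
    have h3 := h1.1
    rw [Zsqrtd.re_sub, he, Zsqrtd.re_pow_odd_of_re_eq_zero, sub_zero, ← he] at h3
    rw [hαγ]
    have : ((δ.re : ℤ√(-6)) * (⟨a, b⟩ : ℤ√(-6)) ^ ℓ).re = δ.re * ((⟨a, b⟩ : ℤ√(-6)) ^ ℓ).re := by
      simp
    rw [this]
    exact h3.mul_left _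
  have ha2 : a * a = 1 := by
    rcases Int.isUnit_iff.1 (isUnit_of_dvd_one ha_dvd) with rfl | rfl <;> norm_num
  have hab1 : (⟨a, b⟩ : ℤ√(-6)) = (a : ℤ√(-6)) * ⟨1, a * b⟩ := by
    ext
    · simp
    · simp; rw [← mul_assoc, ha2, one_mul]
  rw [hab1, mul_pow, ← mul_assoc, ← Int.cast_pow, ← Int.cast_mul] at hαγ
  set σ : ℤ := δ.re * a ^ ℓ with hσ
  have hσ2 : σ ^ 2 = 1 := by
    rw [hσ, mul_pow, hre, ← pow_mul, mul_comm ℓ 2, pow_mul, pow_two a, ha2, one_pow, one_mul]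
  obtain ⟨hmr, hmi⟩ := Zsqrtd.one_add_pow_modEq (a * b) ℓ
  have hr := congrArg Zsqrtd.re hαγ
  have hi := congrArg Zsqrtd.im hαγ
  simp only [Zsqrtd.re_smul, Zsqrtd.im_smul] at hr hi
  have hσ1 : σ = 1 := by
    rcases sq_eq_sq_iff_eq_or_eq_neg.1 (hσ2.trans (one_pow 2).symm) with h0 | h0
    · exact h0
    · exfalso
      rw [h0] at hr
      have := hmr.dvd
      omega
  rw [hσ1, one_mul] at hr hi
  have hc0 : a * b ≠ 0 := by
    intro h0
    rw [h0] at hi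
    have : (⟨1, 0⟩ : ℤ√(-6)) = 1 := rfl
    rw [this, one_pow] at hi
    exact hn hi
  have hc3 : 3 ∣ a * b := by
    have h1 : (3 : ℤ) ∣ ℓ * (a * b) := by
      have h2 := hmi.dvd
      rw [← hi] at h2
      have h6 : (3 : ℤ) ∣ ℓ * (a * b) - n := (by norm_num : (3 : ℤ) ∣ 6).trans h2
      exact (dvd_sub_left h3).1 h6
    refine (Int.prime_three.dvd_or_dvd h1).resolve_left ?_
    intro h2
    have h2' : 3 ∣ ℓ := by exact_mod_cast h2
    have := (Nat.prime_dvd_prime_iff_eq Nat.prime_three hℓ).1 h2'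
    omega
  obtain ⟨k, rfl⟩ : ∃ k, ℓ = k + 2 := ⟨ℓ - 2, by omega⟩
  exact re_one_add_pow_ne_one hc0 hc3 k hr.symm

theorem sq_add_sixHundred_seven_adic (m : ℕ) :
    m % 7 ≠ 0 ∨ m % 7 = 0 ∧ (m ^ 2 + 600) % 7 ≠ 0 := by
  by_cases h : m % 7 = 0
  · right
    refine ⟨h, ?_⟩
    simp [Nat.add_mod, Nat.pow_mod, h]
  · exact Or.inl h

/-- Splitting of `49 m (m ^ 2 + 600) = y ^ ℓ` into two coprime powers. -/
theorem exists_pow_factors {ℓ m y : ℕ} (h : 49 * (m * (m ^ 2 + 600)) = y ^ ℓ) (u v : ℕ)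
    (hu0 : 0 < u) (hv0 : 0 < v) (huv : u * v ∣ 210 ^ 4) (hu : u ∣ v * m)
    (hv : v ∣ 49 * u * (m ^ 2 + 600))
    (h2 : ∀ X Y, v * m = u * X → 49 * u * (m ^ 2 + 600) = v * Y → ¬ (2 ∣ X ∧ 2 ∣ Y))
    (h3 : ∀ X Y, v * m = u * X → 49 * u * (m ^ 2 + 600) = v * Y → ¬ (3 ∣ X ∧ 3 ∣ Y))
    (h5 : ∀ X Y, v * m = u * X → 49 * u * (m ^ 2 + 600) = v * Y → ¬ (5 ∣ X ∧ 5 ∣ Y))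
    (h7 : ∀ X Y, v * m = u * X → 49 * u * (m ^ 2 + 600) = v * Y → ¬ (7 ∣ X ∧ 7 ∣ Y)) :
    ∃ p q, v * m = u * p ^ ℓ ∧ 49 * u * (m ^ 2 + 600) = v * q ^ ℓ := by
  obtain ⟨X, hX⟩ := hu
  obtain ⟨Y, hY⟩ := hv
  have hco : X.Coprime Y := by
    apply Nat.coprime_of_dvd
    intro r hr hrX hrY
    by_cases hr210 : r ∣ 2 * 3 * 5 * 7
    · simp only [hr.dvd_mul, Nat.prime_dvd_prime_iff_eq hr Nat.prime_two,
        Nat.prime_dvd_prime_iff_eq hr Nat.prime_three, Nat.prime_dvd_prime_iff_eq hr Nat.prime_five,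
        Nat.prime_dvd_prime_iff_eq hr Nat.prime_seven] at hr210
      rcases hr210 with ((rfl | rfl) | rfl) | rfl
      · exact h2 X Y hX hY ⟨hrX, hrY⟩
      · exact h3 X Y hX hY ⟨hrX, hrY⟩
      · exact h5 X Y hX hY ⟨hrX, hrY⟩
      · exact h7 X Y hX hY ⟨hrX, hrY⟩
    · have hr4 : ¬ r ∣ u * v := fun hd => hr210 (hr.dvd_of_dvd_pow (hd.trans huv))
      have hru : ¬ r ∣ u := fun hd => hr4 (hd.mul_right v)
      have hrv : ¬ r ∣ v := fun hd => hr4 (hd.mul_left u)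
      have hrm : r ∣ m := by
        have : r ∣ v * m := hX ▸ hrX.mul_left u
        exact (hr.dvd_mul.1 this).resolve_left hrv
      have hrM : r ∣ m ^ 2 + 600 := by
        have : r ∣ 49 * u * (m ^ 2 + 600) := hY ▸ hrY.mul_left v
        refine (hr.dvd_mul.1 this).resolve_left fun hd => ?_
        refine (hr.dvd_mul.1 hd).elim (fun h49 => hr210 ?_) hru
        exact (hr.dvd_of_dvd_pow (n := 2) (m := 7) h49).trans (by norm_num)
      have h600 : r ∣ 600 := (Nat.dvd_add_right (hrm.trans (Dvd.intro_left m (by ring)))).1 hrM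
      exact hr210 (hr.dvd_of_dvd_pow (n := 3) (h600.trans (by norm_num)))
  have hXY : X * Y = y ^ ℓ := by
    apply Nat.eq_of_mul_eq_mul_left (Nat.mul_pos hu0 hv0)
    calc u * v * (X * Y) = (u * X) * (v * Y) := by ring
      _ = u * v * (49 * (m * (m ^ 2 + 600))) := by rw [← hX, ← hY]; ring
      _ = u * v * y ^ ℓ := by rw [h]
  obtain ⟨p, hp⟩ := exists_eq_pow_of_mul_eq_pow (a := X) (b := Y)
    (by rw [Nat.isUnit_iff]; exact hco) hXY
  obtain ⟨q, hq⟩ := exists_eq_pow_of_mul_eq_pow (a := Y) (b := X)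
    (by rw [Nat.isUnit_iff]; exact hco.symm) (by rw [mul_comm]; exact hXY)
  exact ⟨p, q, hp ▸ hX, hq ▸ hY⟩

theorem noSolution_of_five_le {ℓ m u v p q : ℕ} (hℓ : ℓ.Prime) (h5 : 5 ≤ ℓ) (hm : 26 ≤ m)
    (hmem : (u, v) ∈ sievePairs) (hp : v * m = u * p ^ ℓ)
    (hq : 49 * u * (m ^ 2 + 600) = v * q ^ ℓ) : False := by
  have heq : v ^ 3 * q ^ ℓ = 49 * u * (u ^ 2 * (p ^ ℓ) ^ 2 + 600 * v ^ 2) := by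
    calc v ^ 3 * q ^ ℓ = v ^ 2 * (v * q ^ ℓ) := by ring
      _ = 49 * u * ((v * m) ^ 2 + 600 * v ^ 2) := by rw [← hq]; ring
      _ = _ := by rw [hp]; ring
  have hbound : ∀ c ∈ sievePairs, 0 < c.1 ∧ c.1 ≤ 5 ∧ 0 < c.2 ∧ c.2 ≤ 9800 := by decide
  obtain ⟨hu0, hu5, hv0, hv1⟩ := hbound (u, v) hmem
  simp only at hu0 hu5 hv0 hv1
  rcases lt_or_ge ℓ 32001 with hlt | hge
  · rcases lt_or_ge ℓ 11 with h11 | h11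
    · have : ℓ = 5 ∨ ℓ = 7 := by
        interval_cases ℓ <;> first | omega | (exfalso; revert hℓ; decide)
      rcases this with rfl | rfl
      · exact noSolution_five (u, v) hmem p q heq
      · exact noSolution_seven (u, v) hmem p q heq
    · exact noSolution_of_exponent_range hℓ h11 hlt (u, v) hmem p q heq
  · have hp2 : 2 ≤ p := by
      by_contra hp2
      have hp1 : p ^ ℓ ≤ 1 := by
        calc p ^ ℓ ≤ 1 ^ ℓ := Nat.pow_le_pow_left (by omega) ℓ
          _ = 1 := one_pow ℓ
      nlinarith
    exact no_solution_large_exponent ℓ u v p q (by omega) hu0 hu5 hv0 hv1 hp2 heq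

theorem false_of_all_divide {ℓ m p q : ℕ} (hℓ : ℓ.Prime) (h5 : 5 ≤ ℓ) (hm : 26 ≤ m)
    (h60 : 60 ∣ m) (hp : 29400 * m = 1 * p ^ ℓ)
    (hq : 49 * 1 * (m ^ 2 + 600) = 29400 * q ^ ℓ) : False := by
  obtain ⟨n, rfl⟩ := h60
  have h3p : 3 ∣ p := by
    apply Nat.prime_three.dvd_of_dvd_pow (n := ℓ)
    omega
  have h243 : 3 ^ 5 ∣ p ^ ℓ := (pow_dvd_pow 3 h5).trans (pow_dvd_pow_of_dvd h3p ℓ)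
  have h3n : 3 ∣ n := by omega
  refine six_mul_sq_add_one_ne_pow hℓ h5 (n := n) (by omega) (by exact_mod_cast h3n) q ?_
  have hn : 6 * n ^ 2 + 1 = q ^ ℓ := by nlinarith
  exact_mod_cast hn

theorem mod_four_ne_two_of_eq_pow {ℓ m y : ℕ} (h5 : 5 ≤ ℓ)
    (h : 49 * (m * (m ^ 2 + 600)) = y ^ ℓ) : ¬ (m % 4 = 2 ∧ (m ^ 2 + 600) % 8 = 4) := by
  rintro ⟨h1, h2⟩
  generalize m ^ 2 + 600 = M at *
  obtain ⟨a, rfl⟩ : ∃ a, m = 4 * a + 2 := ⟨m / 4, by omega⟩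
  obtain ⟨b, rfl⟩ : ∃ b, M = 8 * b + 4 := ⟨M / 8, by omega⟩
  have hprod : (4 * a + 2) * (8 * b + 4) = 16 * (2 * (a * b) + a + b) + 8 := by ring
  have h2y : 2 ∣ y := by
    apply Nat.prime_two.dvd_of_dvd_pow (n := ℓ)
    omega
  have h32 : 2 ^ 5 ∣ y ^ ℓ := (pow_dvd_pow 2 h5).trans (pow_dvd_pow_of_dvd h2y ℓ)
  rw [← h, hprod] at h32
  omega

set_option maxHeartbeats 4000000 in
/-- `49 m (m ^ 2 + 600)` is never a prime power with exponent at least five when `m > 25`. -/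
theorem fortynine_mul_ne_pow {ℓ m y : ℕ} (hℓ : ℓ.Prime) (h5 : 5 ≤ ℓ) (hm : 26 ≤ m) :
    49 * (m * (m ^ 2 + 600)) ≠ y ^ ℓ := by
  intro h
  have hs2 : m % 2 = 1 ∧ (m ^ 2 + 600) % 2 = 1 ∨ m % 4 = 0 ∧ (m ^ 2 + 600) % 16 = 8 := by
    have h1 := sq_add_sixHundred_two_adic m
    have h2 := mod_four_ne_two_of_eq_pow h5 h
    tauto
  have hs3 := sq_add_sixHundred_three_adic m
  have hs5 := sq_add_sixHundred_five_adic m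
  have hs7 := sq_add_sixHundred_seven_adic m
  rcases hs2 with hs2 | hs2 <;> rcases hs3 with hs3 | hs3 <;>
    rcases hs5 with hs5 | hs5 | hs5 <;> rcases hs7 with hs7 | hs7
  · obtain ⟨p, q, hp, hq⟩ := exists_pow_factors h 1 1 (by norm_num) (by norm_num)
      (by norm_num) (by clear h hs2 hs3 hs7; omega) (by clear h hs2 hs3 hs5 hs7; omega)
      (by clear h hs3 hs5 hs7; omega) (by clear h hs2 hs5 hs7; omega)
      (by clear h hs2 hs3 hs7; omega) (by clear h hs2 hs3 hs5; omega)
    exact noSolution_of_five_le hℓ h5 hm (by decide) hp hq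
  · obtain ⟨p, q, hp, hq⟩ := exists_pow_factors h 1 49 (by norm_num) (by norm_num)
      (by norm_num) (by clear h hs2 hs3 hs7; omega) (by clear h hs2 hs3 hs5 hs7; omega)
      (by clear h hs3 hs5 hs7; omega) (by clear h hs2 hs5 hs7; omega)
      (by clear h hs2 hs3 hs7; omega) (by clear h hs2 hs3 hs5; omega)
    exact noSolution_of_five_le hℓ h5 hm (by decide) hp hq
  · obtain ⟨p, q, hp, hq⟩ := exists_pow_factors h 5 1 (by norm_num) (by norm_num)
      (by norm_num) (by clear h hs2 hs3 hs7; omega) (by clear h hs2 hs3 hs5 hs7; omega)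
      (by clear h hs3 hs5 hs7; omega) (by clear h hs2 hs5 hs7; omega)
      (by clear h hs2 hs3 hs7; omega) (by clear h hs2 hs3 hs5; omega)
    exact noSolution_of_five_le hℓ h5 hm (by decide) hp hq
  · obtain ⟨p, q, hp, hq⟩ := exists_pow_factors h 5 49 (by norm_num) (by norm_num)
      (by norm_num) (by clear h hs2 hs3 hs7; omega) (by clear h hs2 hs3 hs5 hs7; omega)
      (by clear h hs3 hs5 hs7; omega) (by clear h hs2 hs5 hs7; omega)
      (by clear h hs2 hs3 hs7; omega) (by clear h hs2 hs3 hs5; omega)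
    exact noSolution_of_five_le hℓ h5 hm (by decide) hp hq
  · obtain ⟨p, q, hp, hq⟩ := exists_pow_factors h 1 25 (by norm_num) (by norm_num)
      (by norm_num) (by clear h hs2 hs3 hs7; omega) (by clear h hs2 hs3 hs7; omega)
      (by clear h hs3 hs5 hs7; omega) (by clear h hs2 hs5 hs7; omega)
      (by clear h hs2 hs3 hs7; omega) (by clear h hs2 hs3 hs5; omega)
    exact noSolution_of_five_le hℓ h5 hm (by decide) hp hq
  · obtain ⟨p, q, hp, hq⟩ := exists_pow_factors h 1 1225 (by norm_num) (by norm_num)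
      (by norm_num) (by clear h hs2 hs3 hs7; omega) (by clear h hs2 hs3 hs7; omega)
      (by clear h hs3 hs5 hs7; omega) (by clear h hs2 hs5 hs7; omega)
      (by clear h hs2 hs3 hs7; omega) (by clear h hs2 hs3 hs5; omega)
    exact noSolution_of_five_le hℓ h5 hm (by decide) hp hq
  · obtain ⟨p, q, hp, hq⟩ := exists_pow_factors h 1 3 (by norm_num) (by norm_num)
      (by norm_num) (by clear h hs2 hs3 hs7; omega) (by clear h hs2 hs5 hs7; omega)
      (by clear h hs3 hs5 hs7; omega) (by clear h hs2 hs5 hs7; omega)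
      (by clear h hs2 hs3 hs7; omega) (by clear h hs2 hs3 hs5; omega)
    exact noSolution_of_five_le hℓ h5 hm (by decide) hp hq
  · obtain ⟨p, q, hp, hq⟩ := exists_pow_factors h 1 147 (by norm_num) (by norm_num)
      (by norm_num) (by clear h hs2 hs3 hs7; omega) (by clear h hs2 hs5 hs7; omega)
      (by clear h hs3 hs5 hs7; omega) (by clear h hs2 hs5 hs7; omega)
      (by clear h hs2 hs3 hs7; omega) (by clear h hs2 hs3 hs5; omega)
    exact noSolution_of_five_le hℓ h5 hm (by decide) hp hq
  · obtain ⟨p, q, hp, hq⟩ := exists_pow_factors h 5 3 (by norm_num) (by norm_num)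
      (by norm_num) (by clear h hs2 hs3 hs7; omega) (by clear h hs2 hs5 hs7; omega)
      (by clear h hs3 hs5 hs7; omega) (by clear h hs2 hs5 hs7; omega)
      (by clear h hs2 hs3 hs7; omega) (by clear h hs2 hs3 hs5; omega)
    exact noSolution_of_five_le hℓ h5 hm (by decide) hp hq
  · obtain ⟨p, q, hp, hq⟩ := exists_pow_factors h 5 147 (by norm_num) (by norm_num)
      (by norm_num) (by clear h hs2 hs3 hs7; omega) (by clear h hs2 hs5 hs7; omega)
      (by clear h hs3 hs5 hs7; omega) (by clear h hs2 hs5 hs7; omega)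
      (by clear h hs2 hs3 hs7; omega) (by clear h hs2 hs3 hs5; omega)
    exact noSolution_of_five_le hℓ h5 hm (by decide) hp hq
  · obtain ⟨p, q, hp, hq⟩ := exists_pow_factors h 1 75 (by norm_num) (by norm_num)
      (by norm_num) (by clear h hs2 hs3 hs7; omega) (by clear h hs2 hs7; omega)
      (by clear h hs3 hs5 hs7; omega) (by clear h hs2 hs5 hs7; omega)
      (by clear h hs2 hs3 hs7; omega) (by clear h hs2 hs3 hs5; omega)
    exact noSolution_of_five_le hℓ h5 hm (by decide) hp hq
  · obtain ⟨p, q, hp, hq⟩ := exists_pow_factors h 1 3675 (by norm_num) (by norm_num)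
      (by norm_num) (by clear h hs2 hs3 hs7; omega) (by clear h hs2 hs7; omega)
      (by clear h hs3 hs5 hs7; omega) (by clear h hs2 hs5 hs7; omega)
      (by clear h hs2 hs3 hs7; omega) (by clear h hs2 hs3 hs5; omega)
    exact noSolution_of_five_le hℓ h5 hm (by decide) hp hq
  · obtain ⟨p, q, hp, hq⟩ := exists_pow_factors h 1 8 (by norm_num) (by norm_num)
      (by norm_num) (by clear h hs2 hs3 hs7; omega) (by clear h hs3 hs5 hs7; omega)
      (by clear h hs3 hs5 hs7; omega) (by clear h hs2 hs5 hs7; omega)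
      (by clear h hs2 hs3 hs7; omega) (by clear h hs2 hs3 hs5; omega)
    exact noSolution_of_five_le hℓ h5 hm (by decide) hp hq
  · obtain ⟨p, q, hp, hq⟩ := exists_pow_factors h 1 392 (by norm_num) (by norm_num)
      (by norm_num) (by clear h hs2 hs3 hs7; omega) (by clear h hs3 hs5 hs7; omega)
      (by clear h hs3 hs5 hs7; omega) (by clear h hs2 hs5 hs7; omega)
      (by clear h hs2 hs3 hs7; omega) (by clear h hs2 hs3 hs5; omega)
    exact noSolution_of_five_le hℓ h5 hm (by decide) hp hq
  · obtain ⟨p, q, hp, hq⟩ := exists_pow_factors h 5 8 (by norm_num) (by norm_num)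
      (by norm_num) (by clear h hs2 hs3 hs7; omega) (by clear h hs3 hs5 hs7; omega)
      (by clear h hs3 hs5 hs7; omega) (by clear h hs2 hs5 hs7; omega)
      (by clear h hs2 hs3 hs7; omega) (by clear h hs2 hs3 hs5; omega)
    exact noSolution_of_five_le hℓ h5 hm (by decide) hp hq
  · obtain ⟨p, q, hp, hq⟩ := exists_pow_factors h 5 392 (by norm_num) (by norm_num)
      (by norm_num) (by clear h hs2 hs3 hs7; omega) (by clear h hs3 hs5 hs7; omega)
      (by clear h hs3 hs5 hs7; omega)
      (by rintro _ Y hX hY ⟨⟨Z, rfl⟩, -⟩; clear h hY hs2 hs5 hs7; omega)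
      (by clear h hs2 hs3 hs7; omega) (by clear h hs2 hs3 hs5; omega)
    exact noSolution_of_five_le hℓ h5 hm (by decide) hp hq
  · obtain ⟨p, q, hp, hq⟩ := exists_pow_factors h 1 200 (by norm_num) (by norm_num)
      (by norm_num) (by clear h hs2 hs3 hs7; omega) (by clear h hs3 hs7; omega)
      (by clear h hs3 hs5 hs7; omega) (by clear h hs2 hs5 hs7; omega)
      (by clear h hs2 hs3 hs7; omega) (by clear h hs2 hs3 hs5; omega)
    exact noSolution_of_five_le hℓ h5 hm (by decide) hp hq
  · obtain ⟨p, q, hp, hq⟩ := exists_pow_factors h 1 9800 (by norm_num) (by norm_num)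
      (by norm_num) (by clear h hs2 hs3 hs7; omega) (by clear h hs3 hs7; omega)
      (by clear h hs3 hs5 hs7; omega) (by clear h hs2 hs5 hs7; omega)
      (by clear h hs2 hs3 hs7; omega) (by clear h hs2 hs3 hs5; omega)
    exact noSolution_of_five_le hℓ h5 hm (by decide) hp hq
  · obtain ⟨p, q, hp, hq⟩ := exists_pow_factors h 1 24 (by norm_num) (by norm_num)
      (by norm_num) (by clear h hs2 hs3 hs7; omega) (by clear h hs5 hs7; omega)
      (by clear h hs3 hs5 hs7; omega) (by clear h hs2 hs5 hs7; omega)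
      (by clear h hs2 hs3 hs7; omega) (by clear h hs2 hs3 hs5; omega)
    exact noSolution_of_five_le hℓ h5 hm (by decide) hp hq
  · obtain ⟨p, q, hp, hq⟩ := exists_pow_factors h 1 1176 (by norm_num) (by norm_num)
      (by norm_num) (by clear h hs2 hs3 hs7; omega) (by clear h hs5 hs7; omega)
      (by clear h hs3 hs5 hs7; omega) (by clear h hs2 hs5 hs7; omega)
      (by clear h hs2 hs3 hs7; omega) (by clear h hs2 hs3 hs5; omega)
    exact noSolution_of_five_le hℓ h5 hm (by decide) hp hq
  · obtain ⟨p, q, hp, hq⟩ := exists_pow_factors h 5 24 (by norm_num) (by norm_num)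
      (by norm_num) (by clear h hs2 hs3 hs7; omega) (by clear h hs5 hs7; omega)
      (by clear h hs3 hs5 hs7; omega)
      (by rintro X _ hX hY ⟨-, ⟨Z, rfl⟩⟩; clear h hX hs2 hs5 hs7; omega)
      (by clear h hs2 hs3 hs7; omega) (by clear h hs2 hs3 hs5; omega)
    exact noSolution_of_five_le hℓ h5 hm (by decide) hp hq
  · obtain ⟨p, q, hp, hq⟩ := exists_pow_factors h 5 1176 (by norm_num) (by norm_num)
      (by norm_num) (by clear h hs2 hs3 hs7; omega) (by clear h hs5 hs7; omega)
      (by clear h hs3 hs5 hs7; omega) (by clear h hs2 hs5 hs7; omega)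
      (by clear h hs2 hs3 hs7; omega) (by clear h hs2 hs3 hs5; omega)
    exact noSolution_of_five_le hℓ h5 hm (by decide) hp hq
  · obtain ⟨p, q, hp, hq⟩ := exists_pow_factors h 1 600 (by norm_num) (by norm_num)
      (by norm_num) (by clear h hs2 hs3 hs7; omega) (by clear h hs7; omega)
      (by clear h hs3 hs5 hs7; omega) (by clear h hs2 hs5 hs7; omega)
      (by clear h hs2 hs3 hs7; omega) (by clear h hs2 hs3 hs5; omega)
    exact noSolution_of_five_le hℓ h5 hm (by decide) hp hq
  · obtain ⟨p, q, hp, hq⟩ := exists_pow_factors h 1 29400 (by norm_num) (by norm_num)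
      (by norm_num) (by clear h hs2 hs3 hs7; omega) (by clear h hs7; omega)
      (by clear h hs3 hs5 hs7; omega) (by clear h hs2 hs5 hs7; omega)
      (by clear h hs2 hs3 hs7; omega) (by clear h hs2 hs3 hs5; omega)
    exact false_of_all_divide hℓ h5 hm (by omega) hp hq

theorem sum_cubes_range_fortynine (x : ℤ) :
    ∑ i ∈ Finset.range 49, (x + (i : ℤ) + 1) ^ 3 = 49 * ((x + 25) * ((x + 25) ^ 2 + 600)) := by
  simp only [Finset.sum_range_succ, Finset.sum_range_zero]
  push_cast
  ring

/-- The only solutions in integers `x ≥ 1`, `y` to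
`(x+1)³ + (x+2)³ + ⋯ + (x+49)³ = yˡ` with `ℓ` prime are
`(x, y, ℓ) = (117575, ±282298800, 2)` and `(290, 1155, 3)`. -/
theorem sum_fortynine_consecutive_cubes_perfect_power (ℓ : ℕ) (hℓ : ℓ.Prime)
    (x y : ℤ) (hx : 1 ≤ x) :
    (∑ i ∈ Finset.range 49, (x + (i : ℤ) + 1) ^ 3) = y ^ ℓ ↔
      (x = 117575 ∧ y = 282298800 ∧ ℓ = 2) ∨ (x = 117575 ∧ y = -282298800 ∧ ℓ = 2) ∨
        (x = 290 ∧ y = 1155 ∧ ℓ = 3) := by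
  rw [sum_cubes_range_fortynine]
  constructor
  · intro h
    obtain ⟨m, hm⟩ : ∃ m : ℕ, (m : ℤ) = x + 25 := ⟨(x + 25).toNat, Int.toNat_of_nonneg (by omega)⟩
    have hm26 : 26 ≤ m := by omega
    rw [← hm] at h
    rcases hℓ.eq_two_or_odd' with rfl | hodd
    · have h7 : 7 ∣ y.natAbs := by
        apply Nat.prime_seven.dvd_of_dvd_pow (n := 2)
        zify
        rw [sq_abs, ← h]
        exact ⟨7 * (m * (m ^ 2 + 600)), by ring⟩
      obtain ⟨z, hz⟩ := h7
      have hy : y ^ 2 = (7 * (z : ℤ)) ^ 2 := by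
        rw [← Int.natAbs_sq, hz]
        push_cast
        ring
      have hmz : m * (m ^ 2 + 600) = z ^ 2 := by
        zify
        linarith
      have hm' := eq_of_mul_sq_add_sixHundred_eq_sq hm26 hmz
      subst hm'
      have hy' : y ^ 2 = 282298800 ^ 2 := by
        rw [← h]
        norm_num
      rcases sq_eq_sq_iff_eq_or_eq_neg.1 hy' with hy' | hy'
      · exact Or.inl ⟨by omega, hy', rfl⟩
      · exact Or.inr (Or.inl ⟨by omega, hy', rfl⟩)
    · have hy0 : 0 ≤ y := hodd.pow_nonneg_iff.1 (h ▸ by positivity)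
      lift y to ℕ using hy0
      have hN : 49 * (m * (m ^ 2 + 600)) = y ^ ℓ := by exact_mod_cast h
      have h2 := hℓ.two_le
      rcases lt_or_ge ℓ 5 with h5 | h5
      · have h3 : ℓ = 3 := by
          obtain ⟨k, hk⟩ := hodd
          omega
        subst h3
        have hm' := eq_of_fortynine_mul_eq_cube hm26 hN
        subst hm'
        have hy' : y = 1155 := Nat.pow_left_injective (n := 3) (by norm_num) (by simp [← hN])
        exact Or.inr (Or.inr ⟨by omega, by exact_mod_cast hy', rfl⟩)
      · exact absurd hN (fortynine_mul_ne_pow hℓ h5 hm26)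
  · rintro (⟨rfl, rfl, rfl⟩ | ⟨rfl, rfl, rfl⟩ | ⟨rfl, rfl, rfl⟩) <;> norm_num
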